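/- arXiv:1703.00344 — 4 statements merged into one kernel-verified Lean document; each statement's English description precedes it below -/
import Mathlib

section
/- Let m, n ≥ 2 and let ρ be a density matrix on ℂ^{mn} that is absolutely separable with respect to the bipartition m|n. Set μ = tr(ρ²). Then μ ≤ 9/(mn+8), and moreover for every integer k with 2 ≤ k ≤ mn such that 1/k ≤ μ ≤ 1/(k−1), one has 1 + √((kμ−1)/(k−1)) ≤ 3k·√(μ/(mn+8)). -/
open Matrix Kronecker BigOperators
open scoped ComplexOrder

noncomputable section


def IsDM {ι : Type*} [Fintype ι] (ρ : Matrix ι ι ℂ) : Prop :=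
  ρ.PosSemidef ∧ ρ.trace = 1

def IsSep {ι κ : Type*} [Fintype ι] [Fintype κ]
    (ρ : Matrix (ι × κ) (ι × κ) ℂ) : Prop :=
  ∃ (k : ℕ) (p : Fin k → ℝ) (A : Fin k → Matrix ι ι ℂ) (B : Fin k → Matrix κ κ ℂ),
    (∀ i, 0 ≤ p i) ∧ (∑ i, p i = 1) ∧ (∀ i, IsDM (A i)) ∧ (∀ i, IsDM (B i)) ∧
    ρ = ∑ i, (p i : ℂ) • (A i ⊗ₖ B i)

def IsAbsSep {ι κ : Type*} [Fintype ι] [Fintype κ] [DecidableEq ι] [DecidableEq κ]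
    (ρ : Matrix (ι × κ) (ι × κ) ℂ) : Prop :=
  ∀ U : Matrix (ι × κ) (ι × κ) ℂ, U * Uᴴ = 1 → IsSep (U * ρ * Uᴴ)


set_option linter.unusedSimpArgs false

open scoped MatrixOrder in
lemma aux_trace_nonneg {ι : Type*} [Fintype ι] [DecidableEq ι] (A B : Matrix ι ι ℂ)
    (hA : A.PosSemidef) (hB : B.PosSemidef) : 0 ≤ (A * B).trace := by
  obtain ⟨C, rfl⟩ := CStarAlgebra.nonneg_iff_eq_star_mul_self.1 hB.nonneg
  rw [← Matrix.mul_assoc, Matrix.trace_mul_comm, ← Matrix.mul_assoc]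
  exact (hA.mul_mul_conjTranspose_same C).trace_nonneg

lemma aux_sep {ι κ : Type*} [Fintype ι] [Fintype κ]
    (σ : Matrix (ι × κ) (ι × κ) ℂ) (h : IsSep σ) (a b : ι) (c d : κ) :
    0 ≤ σ (a, c) (a, c) + σ (b, d) (b, d) + σ (a, d) (b, c) + σ (b, c) (a, d) := by
  obtain ⟨k, p, A, B, hp, -, hA, hB, rfl⟩ := h
  simp only [Matrix.sum_apply, Matrix.smul_apply, Matrix.kroneckerMap_apply, smul_eq_mul]
  rw [← Finset.sum_add_distrib, ← Finset.sum_add_distrib, ← Finset.sum_add_distrib]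
  refine Finset.sum_nonneg fun i _ => ?_
  have h1 := aux_trace_nonneg _ _ ((hA i).1.submatrix ![a, b]) ((hB i).1.submatrix ![c, d])
  simp only [Matrix.trace, Matrix.mul_apply, Matrix.diag, Fin.sum_univ_two,
    Matrix.submatrix_apply, Matrix.cons_val_zero, Matrix.cons_val_one] at h1
  have h2 : (0 : ℂ) ≤ (p i : ℂ) := by exact_mod_cast hp i
  have h3 := mul_nonneg h2 h1
  convert h3 using 1
  ring

/-- Row-wise definition of a Hadamard-type unitary acting on the coordinates `p`, `q`. -/
def hadM {X : Type*} [DecidableEq X] (p q : X) : Matrix X X ℂ := fun x y =>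
  if x = p then ((Real.sqrt 2)⁻¹ : ℝ) * ((if y = p then 1 else 0) + (if y = q then 1 else 0))
  else if x = q then
    ((Real.sqrt 2)⁻¹ : ℝ) * ((if y = p then 1 else 0) - (if y = q then 1 else 0))
  else if y = x then 1 else 0

lemma s_sq : (((Real.sqrt 2)⁻¹ : ℝ) : ℂ) * (((Real.sqrt 2)⁻¹ : ℝ) : ℂ) = 1 / 2 := by
  rw [← Complex.ofReal_mul, ← mul_inv, Real.mul_self_sqrt (by norm_num)]
  norm_num

lemma hadM_conj_apply {X : Type*} [Fintype X] [DecidableEq X] (p q : X) (hpq : p ≠ q)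
    (d : X → ℂ) (x y : X) :
    (hadM p q * Matrix.diagonal d * (hadM p q)ᴴ) x y =
      if x = p then (if y = p then (d p + d q) / 2 else if y = q then (d p - d q) / 2 else 0)
      else if x = q then
        (if y = p then (d p - d q) / 2 else if y = q then (d p + d q) / 2 else 0)
      else if x = y then d x else 0 := by
  have hs := s_sq
  have hqp := hpq.symm
  rw [Matrix.mul_apply]
  simp only [Matrix.mul_diagonal, Matrix.conjTranspose_apply, hadM]
  generalize hS : (Real.sqrt 2)⁻¹ = S at *
  by_cases hxp : x = p
  · by_cases hyp : y = p
    · subst hxp hyp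
      simp [mul_add, add_mul, Finset.sum_add_distrib, ite_mul, mul_ite, hpq, hqp]
      linear_combination (d y + d q) * hs
    · by_cases hyq : y = q
      · subst hxp hyq
        simp [mul_add, add_mul, mul_sub, sub_mul, Finset.sum_add_distrib, Finset.sum_sub_distrib, ite_mul, mul_ite, hpq, hqp]
        linear_combination (d x - d y) * hs
      · subst hxp
        simp [mul_add, add_mul, Finset.sum_add_distrib, ite_mul, mul_ite, hpq, hqp, hyp, hyq, Ne.symm hyp, Ne.symm hyq]
        done
  · by_cases hxq : x = q
    · by_cases hyp : y = p
      · subst hxq hyp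
        simp [mul_add, add_mul, mul_sub, sub_mul, Finset.sum_add_distrib, Finset.sum_sub_distrib, ite_mul, mul_ite, hpq, hqp]
        linear_combination (d y - d x) * hs
      · by_cases hyq : y = q
        · subst hxq hyq
          simp [mul_add, add_mul, mul_sub, sub_mul, Finset.sum_add_distrib, Finset.sum_sub_distrib, ite_mul, mul_ite, hpq, hqp]
          linear_combination (d p + d y) * hs
        · subst hxq
          simp [mul_add, add_mul, mul_sub, sub_mul, Finset.sum_add_distrib, Finset.sum_sub_distrib, ite_mul, mul_ite, hpq, hqp, hyp, hyq, Ne.symm hyp, Ne.symm hyq]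
          done
    · by_cases hyp : y = p
      · subst hyp
        simp only [hxp, hxq, if_false, if_true]
        refine Finset.sum_eq_zero fun z _ => ?_
        by_cases hz : z = x
        · subst hz; simp [hxp, hxq]
        · simp [hz]
      · by_cases hyq : y = q
        · subst hyq
          simp [mul_add, add_mul, mul_sub, ite_mul, mul_ite, hpq, hqp, hxp, hxq, Ne.symm hxp, Ne.symm hxq]
        · simp [ite_mul, mul_ite, hxp, hxq, hyp, hyq]
          by_cases hxy : x = y
          · subst hxy; simp
          · simp [hxy, Ne.symm hxy]

lemma hadM_unitary {X : Type*} [Fintype X] [DecidableEq X] (p q : X) (hpq : p ≠ q) :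
    hadM p q * (hadM p q)ᴴ = 1 := by
  have h := hadM_conj_apply p q hpq (fun _ => 1)
  ext x y
  rw [Matrix.diagonal_one, Matrix.mul_one] at h
  rw [h, Matrix.one_apply]
  split_ifs <;> simp_all

/-- Key eigenvalue inequality. -/
lemma aux_eig {m n : ℕ} (hm : 2 ≤ m) (hn : 2 ≤ n)
    (ρ : Matrix (Fin m × Fin n) (Fin m × Fin n) ℂ)
    (hρ : ρ.IsHermitian) (habs : IsAbsSep ρ) (e : Fin 4 → Fin m × Fin n)
    (he : Function.Injective e) :
    hρ.eigenvalues (e 0) ≤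
      hρ.eigenvalues (e 1) + hρ.eigenvalues (e 2) + hρ.eigenvalues (e 3) := by
  let i0 : Fin m := ⟨0, by omega⟩
  let i1 : Fin m := ⟨1, by omega⟩
  let j0 : Fin n := ⟨0, by omega⟩
  let j1 : Fin n := ⟨1, by omega⟩
  have hi : i0 ≠ i1 := by simp [i0, i1]
  have hj : j0 ≠ j1 := by simp [j0, j1]
  let g : Fin 4 → Fin m × Fin n := ![(i1, j0), (i0, j1), (i0, j0), (i1, j1)]
  have hg : Function.Injective g := by
    intro a b hab
    fin_cases a <;> fin_cases b <;> simp_all [g, Prod.ext_iff, hi.symm, hj.symm]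
  obtain ⟨π, hπ⟩ : ∃ π : Equiv.Perm (Fin m × Fin n), ∀ t, π (g t) = e t := by
    classical
    obtain ⟨π, hπ⟩ := Equiv.Perm.exists_extending_pair g e hg he
    exact ⟨π, hπ⟩
  let E : Matrix (Fin m × Fin n) (Fin m × Fin n) ℂ := hρ.eigenvectorUnitary
  have hE : Eᴴ * E = 1 := by
    have := (Matrix.mem_unitaryGroup_iff').1 hρ.eigenvectorUnitary.2
    exact this
  let D : Matrix (Fin m × Fin n) (Fin m × Fin n) ℂ :=
    Matrix.diagonal (fun x => (hρ.eigenvalues x : ℂ))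
  have hsp : ρ = E * D * Eᴴ := by
    have := hρ.spectral_theorem
    exact this
  let P : Matrix (Fin m × Fin n) (Fin m × Fin n) ℂ := Eᴴ.submatrix π id
  let H := hadM (i0, j1) (i1, j0)
  have hpq : ((i0, j1) : Fin m × Fin n) ≠ (i1, j0) := by simp [hi]
  have hPP : P * Pᴴ = 1 := by
    simp only [P, Matrix.conjTranspose_submatrix, Matrix.conjTranspose_conjTranspose]
    have h0 := Matrix.submatrix_mul_equiv Eᴴ E π (Equiv.refl _) π
    rw [hE, Matrix.submatrix_one_equiv] at h0
    exact h0
  have hP : P * ρ * Pᴴ = Matrix.diagonal (fun x => (hρ.eigenvalues (π x) : ℂ)) := by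
    have h1 : Eᴴ * ρ * E = D := by
      rw [hsp]
      calc Eᴴ * (E * D * Eᴴ) * E = (Eᴴ * E) * D * (Eᴴ * E) := by simp only [Matrix.mul_assoc]
        _ = D := by simp [hE]
    have h2 : P * ρ * Pᴴ = (Eᴴ * ρ * E).submatrix π π := by
      ext x y
      simp [P, Matrix.mul_apply]
    rw [h2, h1]
    ext x y
    simp [D, Matrix.diagonal_apply]
  have hU : (H * P) * (H * P)ᴴ = 1 := by
    rw [Matrix.conjTranspose_mul, Matrix.mul_assoc, ← Matrix.mul_assoc P, hPP, Matrix.one_mul]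
    exact hadM_unitary _ _ hpq
  have hsep := habs _ hU
  have heq : H * P * ρ * (H * P)ᴴ =
      H * Matrix.diagonal (fun x => (hρ.eigenvalues (π x) : ℂ)) * Hᴴ := by
    rw [← hP, Matrix.conjTranspose_mul]
    simp only [Matrix.mul_assoc]
  rw [heq] at hsep
  have key := aux_sep _ hsep i0 i1 j0 j1
  simp only [H, hadM_conj_apply _ _ hpq] at key
  have e0 := hπ 0
  have e1 := hπ 1
  have e2 := hπ 2
  have e3 := hπ 3
  simp only [g, Matrix.cons_val] at e0 e1 e2 e3
  simp only [Prod.mk.injEq, hi, hj, hi.symm, hj.symm, and_false, false_and, and_true,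
    if_false, if_true, and_self, e0, e1, e2, e3] at key
  have key2 : (0 : ℂ) ≤ ((hρ.eigenvalues (e 1) + hρ.eigenvalues (e 2) + hρ.eigenvalues (e 3)
      - hρ.eigenvalues (e 0) : ℝ) : ℂ) := by
    convert key using 1
    push_cast
    ring
  have key3 : 0 ≤ (hρ.eigenvalues (e 1) + hρ.eigenvalues (e 2) + hρ.eigenvalues (e 3)
      - hρ.eigenvalues (e 0) : ℝ) := by exact_mod_cast key2
  linarith

lemma aux_sum {X : Type*} [DecidableEq X] (f : X → ℝ) (t : ℝ) (r : ℕ) :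
    ∀ s : Finset X, s.card = r + 3 →
    (∀ a ∈ s, ∀ b ∈ s, ∀ c ∈ s, a ≠ b → a ≠ c → b ≠ c → 3 * t ≤ f a + f b + f c) →
    (s.card : ℝ) * t ≤ ∑ x ∈ s, f x := by
  induction r with
  | zero =>
    intro s hs h
    obtain ⟨a, b, c, hab, hac, hbc, rfl⟩ := Finset.card_eq_three.1 hs
    have := h a (by simp) b (by simp) c (by simp) hab hac hbc
    rw [hs, Finset.sum_insert (by simp [hab, hac]), Finset.sum_pair hbc]
    push_cast
    linarith
  | succ r ih =>
    intro s hs h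
    obtain ⟨x, hx, hmax⟩ := Finset.exists_max_image s f (Finset.card_pos.1 (by omega))
    have hc : (s.erase x).card = r + 3 := by rw [Finset.card_erase_of_mem hx]; omega
    have h1 := ih (s.erase x) hc (fun a ha b hb c hc => h a (Finset.mem_of_mem_erase ha) b
      (Finset.mem_of_mem_erase hb) c (Finset.mem_of_mem_erase hc))
    obtain ⟨a, b, c, ha, hb, hcs, hab, hac, hbc⟩ := Finset.two_lt_card_iff.1 (show 2 < s.card by omega)
    have h2 := h a ha b hb c hcs hab hac hbc
    have h3 := hmax a ha
    have h4 := hmax b hb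
    have h5 := hmax c hcs
    rw [← Finset.add_sum_erase s f hx]
    rw [hc] at h1
    rw [hs]
    push_cast at h1 ⊢
    linarith

lemma aux_pack {X : Type*} [DecidableEq X] (f : X → ℝ) (M : ℝ) (s : Finset X) :
    (∀ x ∈ s, 0 ≤ f x ∧ f x ≤ M) → ∀ j : ℤ,
    (∑ x ∈ s, f x - j * M) * ((j + 1) * M - ∑ x ∈ s, f x) ≤ ∑ x ∈ s, f x * (M - f x) := by
  induction s using Finset.induction_on with
  | empty =>
    intro _ j
    have hj : 0 ≤ j * (j + 1) := by
      rcases le_or_gt 0 j with h | h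
      · positivity
      · nlinarith [show j + 1 ≤ 0 by omega]
    have hj' : (0 : ℝ) ≤ (j : ℝ) * (j + 1) := by exact_mod_cast hj
    simp only [Finset.sum_empty]
    nlinarith [mul_nonneg hj' (sq_nonneg M)]
  | insert a s ha ih =>
    intro h j
    have ih' := ih (fun x hx => h x (Finset.mem_insert_of_mem hx))
    obtain ⟨h0, h1⟩ := h a (Finset.mem_insert_self a s)
    rw [Finset.sum_insert ha, Finset.sum_insert ha]
    rcases le_or_gt 0 (∑ x ∈ s, f x - j * M) with hu | hu
    · have := ih' j
      nlinarith [mul_nonneg hu h0]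
    · have := ih' (j - 1)
      push_cast at this
      nlinarith [mul_nonneg (neg_nonneg.2 hu.le) (sub_nonneg.2 h1)]

theorem stmt0 (m n : ℕ) (hm : 2 ≤ m) (hn : 2 ≤ n)
    (ρ : Matrix (Fin m × Fin n) (Fin m × Fin n) ℂ)
    (hρ : IsDM ρ) (habs : IsAbsSep ρ)
    (μ : ℝ) (hμ : (ρ * ρ).trace = (μ : ℂ)) :
    μ ≤ 9 / ((m : ℝ) * n + 8) ∧
      ∀ k : ℕ, 2 ≤ k → k ≤ m * n →
        1 / (k : ℝ) ≤ μ → μ ≤ 1 / ((k : ℝ) - 1) →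
        1 + Real.sqrt (((k : ℝ) * μ - 1) / ((k : ℝ) - 1)) ≤
          3 * k * Real.sqrt (μ / ((m : ℝ) * n + 8)) := by
  have hH := hρ.1.1
  set l := hH.eigenvalues with hl
  have hl0 : ∀ x, 0 ≤ l x := hρ.1.eigenvalues_nonneg
  have hsum : ∑ x, l x = 1 := by
    have h1 := hH.trace_eq_sum_eigenvalues
    rw [hρ.2] at h1
    have h2 : ((∑ x, l x : ℝ) : ℂ) = 1 := by rw [h1]; push_cast; rfl
    exact_mod_cast h2
  have hsq : ∑ x, l x ^ 2 = μ := by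
    let E : Matrix (Fin m × Fin n) (Fin m × Fin n) ℂ := hH.eigenvectorUnitary
    have hE : Eᴴ * E = 1 := by
      have := (Matrix.mem_unitaryGroup_iff').1 hH.eigenvectorUnitary.2
      exact this
    let D : Matrix (Fin m × Fin n) (Fin m × Fin n) ℂ := Matrix.diagonal (fun x => (l x : ℂ))
    have hsp : ρ = E * D * Eᴴ := by
      have := hH.spectral_theorem
      exact this
    have h1 : ρ * ρ = E * (D * D) * Eᴴ := by
      rw [hsp]
      calc E * D * Eᴴ * (E * D * Eᴴ) = E * D * (Eᴴ * E) * D * Eᴴ := by simp only [Matrix.mul_assoc]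
        _ = _ := by simp only [hE, Matrix.mul_one, Matrix.mul_assoc]
    have h2 : (ρ * ρ).trace = ((∑ x, l x ^ 2 : ℝ) : ℂ) := by
      rw [h1, Matrix.trace_mul_comm, ← Matrix.mul_assoc, hE, Matrix.one_mul]
      simp only [D, Matrix.diagonal_mul_diagonal, Matrix.trace_diagonal]
      push_cast
      exact Finset.sum_congr rfl fun x _ => by ring
    rw [h2] at hμ
    exact_mod_cast hμ
  have hN : 4 ≤ m * n := by nlinarith
  have hNR : (4 : ℝ) ≤ (m : ℝ) * n := by exact_mod_cast hN
  obtain ⟨i, -, hi⟩ := Finset.exists_max_image (Finset.univ : Finset (Fin m × Fin n)) l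
    ⟨(⟨0, by omega⟩, ⟨0, by omega⟩), Finset.mem_univ _⟩
  have hi' : ∀ x, l x ≤ l i := fun x => hi x (Finset.mem_univ x)
  set M := l i with hM
  have hM0 : 0 ≤ M := hl0 i
  have hcard : (Finset.univ.erase i : Finset (Fin m × Fin n)).card = m * n - 1 := by
    simp [Finset.card_erase_of_mem]
  have hbig : M ^ 2 * ((m : ℝ) * n + 8) ≤ 9 * μ := by
    have h1 := aux_sum (fun x => l x ^ 2) (M ^ 2 / 9) (m * n - 4) (Finset.univ.erase i)
      (by rw [hcard]; omega) (by
        intro a ha b hb c hc hab hac hbc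
        have hai := Finset.ne_of_mem_erase ha
        have hbi := Finset.ne_of_mem_erase hb
        have hci := Finset.ne_of_mem_erase hc
        have h2 := aux_eig hm hn ρ hH habs ![i, a, b, c] (by
          intro x y hxy
          fin_cases x <;> fin_cases y <;>
            simp_all [hai.symm, hbi.symm, hci.symm, hab.symm, hac.symm, hbc.symm])
        have h3 : M ≤ l a + l b + l c := h2
        have h4 : M ^ 2 ≤ (l a + l b + l c) ^ 2 := pow_le_pow_left₀ hM0 h3 2
        nlinarith [sq_nonneg (l a - l b), sq_nonneg (l a - l c), sq_nonneg (l b - l c)])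
    rw [hcard] at h1
    have h5 := Finset.add_sum_erase Finset.univ (fun x => l x ^ 2) (Finset.mem_univ i)
    rw [Nat.cast_sub (by omega)] at h1
    push_cast at h1
    rw [hsq] at h5
    nlinarith
  have hμM : μ ≤ M := by
    rw [← hsq]
    calc ∑ x, l x ^ 2 ≤ ∑ x, M * l x := Finset.sum_le_sum fun x _ => by
          nlinarith [hl0 x, hi' x]
      _ = M := by rw [← Finset.mul_sum, hsum, mul_one]
  have hμ0 : 0 ≤ μ := by rw [← hsq]; positivity
  constructor
  · rw [le_div_iff₀ (by positivity)]
    rcases hμ0.eq_or_lt with h | h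
    · rw [← h]; norm_num
    · have h1 : μ ^ 2 ≤ M ^ 2 := pow_le_pow_left₀ hμ0 hμM 2
      have h2 : μ ^ 2 * ((m : ℝ) * n + 8) ≤ 9 * μ :=
        (mul_le_mul_of_nonneg_right h1 (by positivity)).trans hbig
      by_contra hc
      push Not at hc
      nlinarith
  · intro k hk _ hk1 _
    have hkR : (2 : ℝ) ≤ k := by exact_mod_cast hk
    have hMs : M ≤ 3 * Real.sqrt (μ / ((m : ℝ) * n + 8)) := by
      have h1 : M / 3 ≤ Real.sqrt (μ / ((m : ℝ) * n + 8)) := by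
        apply Real.le_sqrt_of_sq_le
        rw [le_div_iff₀ (by positivity)]
        linarith
      linarith
    have hp := aux_pack l M Finset.univ (fun x _ => ⟨hl0 x, hi' x⟩) ((k : ℤ) - 1)
    have hp2 : ∑ x, l x * (M - l x) = M - μ := by
      rw [← hsq]
      simp only [mul_sub, Finset.sum_sub_distrib, ← Finset.sum_mul, hsum, one_mul]
      congr 1
      exact Finset.sum_congr rfl fun x _ => by ring
    rw [hp2, hsum] at hp
    push_cast at hp
    have hkM : 1 ≤ k * M := by
      rw [div_le_iff₀ (by linarith)] at hk1
      nlinarith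
    have hs : Real.sqrt (((k : ℝ) * μ - 1) / ((k : ℝ) - 1)) ≤ k * M - 1 := by
      apply Real.sqrt_le_iff.2 ⟨by linarith, ?_⟩
      rw [div_le_iff₀ (by linarith)]
      nlinarith
    nlinarith

end
end

section
/- Let m, n ≥ 2 and let Φ be a positive trace-preserving linear map on mn×mn complex matrices. If the maximal output purity satisfies ‖Φ‖²_{1→2} ≤ 1/(mn−1), i.e., tr((Φ[ρ])²) ≤ 1/(mn−1) for every density matrix ρ on ℂ^{mn}, then Φ is absolutely separating with respect to the bipartition m|n. -/
open Matrix Kronecker BigOperators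
open scoped ComplexOrder

noncomputable section


open scoped Matrix.Norms.L2Operator MatrixOrder in
lemma unitary_dec {κ : Type*} [Fintype κ] [DecidableEq κ] (V : Matrix κ κ ℂ)
    (hV : V ∈ unitary (Matrix κ κ ℂ)) :
    ∃ (s : Finset ℂ) (P : ℂ → Matrix κ κ ℂ), (∀ z ∈ s, ‖z‖ = 1) ∧ (∀ z, (P z).PosSemidef) ∧
      ∑ z ∈ s, P z = 1 ∧ ∑ z ∈ s, z • P z = V := by
  have hfin : (spectrum ℂ V).Finite := Matrix.finite_spectrum V
  have hN : IsStarNormal V := by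
    rw [Unitary.mem_iff] at hV
    exact ⟨by rw [commute_iff_eq, hV.1, hV.2]⟩
  have hc : ∀ f : ℂ → ℂ, ContinuousOn f (spectrum ℂ V) := fun f => hfin.continuousOn f
  refine ⟨hfin.toFinset, fun z => cfc (fun w => if w = z then (1 : ℂ) else 0) V, ?_, ?_, ?_, ?_⟩
  · intro z hz
    rw [Set.Finite.mem_toFinset] at hz
    have := Unitary.spectrum_subset_circle (𝕜 := ℂ) ⟨V, hV⟩ hz
    simpa using this
  · intro z
    rw [← Matrix.nonneg_iff_posSemidef]
    apply cfc_nonneg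
    intro x _
    split_ifs <;> simp
  · rw [← cfc_sum _ _ _ (fun _ _ => hc _), ← cfc_one ℂ V]
    apply cfc_congr
    intro x hx
    simp [hx]
  · calc _ = ∑ z ∈ hfin.toFinset, cfc (fun w => z • if w = z then (1 : ℂ) else 0) V := by
          refine Finset.sum_congr rfl fun z _ => ?_
          rw [cfc_smul _ _ _ (hc _)]
      _ = V := by
          rw [← cfc_sum _ _ _ (fun _ _ => hc _)]
          conv_rhs => rw [← cfc_id ℂ V]
          apply cfc_congr
          intro x hx
          simp [hx]

lemma cs_complex {κ : Type*} [Fintype κ] (c v : κ → ℂ) :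
    ‖∑ l, c l * v l‖ ^ 2 ≤ (∑ l, ‖c l‖ ^ 2) * ∑ l, ‖v l‖ ^ 2 := by
  refine le_trans ?_ (Finset.sum_mul_sq_le_sq_mul_sq _ _ _)
  gcongr
  refine (norm_sum_le _ _).trans (le_of_eq ?_)
  simp

open scoped Matrix.Norms.L2Operator MatrixOrder in
lemma T_norm {κ : Type*} [Fintype κ] [DecidableEq κ] (C : Matrix κ κ ℂ)
    (hC : ∑ k, ∑ l, ‖C k l‖ ^ 2 ≤ 1) : ‖Matrix.fromBlocks 0 C Cᴴ 0‖ ≤ 1 := by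
  rw [Matrix.l2_opNorm_def]
  refine ContinuousLinearMap.opNorm_le_bound _ zero_le_one fun v => ?_
  rw [one_mul]
  refine (sq_le_sq₀ (norm_nonneg _) (norm_nonneg _)).1 ?_
  rw [EuclideanSpace.norm_sq_eq, EuclideanSpace.norm_sq_eq]
  simp only [Fintype.sum_sum_type]
  have h1 : ∀ k, ‖∑ l, C k l * v (Sum.inr l)‖ ^ 2 ≤ _ := fun k => cs_complex (C k) (fun l => v (Sum.inr l))
  have h2 : ∀ k, ‖∑ l, Cᴴ k l * v (Sum.inl l)‖ ^ 2 ≤ _ := fun k => cs_complex (Cᴴ k) (fun l => v (Sum.inl l))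
  have h1' := Finset.sum_le_sum fun k (_ : k ∈ Finset.univ) => h1 k
  have h2' := Finset.sum_le_sum fun k (_ : k ∈ Finset.univ) => h2 k
  rw [← Finset.sum_mul] at h1' h2'
  have e : ∑ k, ∑ l, ‖Cᴴ k l‖ ^ 2 ≤ 1 := by
    rw [Finset.sum_comm]; simpa [Matrix.conjTranspose_apply] using hC
  have n1 : 0 ≤ ∑ l, ‖v (Sum.inr l)‖ ^ 2 := by positivity
  have n2 : 0 ≤ ∑ l, ‖v (Sum.inl l)‖ ^ 2 := by positivity
  have e1 := mul_le_of_le_one_left n1 hC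
  have e2 := mul_le_of_le_one_left n2 e
  have g1 : ∀ k, (Matrix.toEuclideanLin (Matrix.fromBlocks 0 C Cᴴ 0) v) (Sum.inl k) = ∑ l, C k l * v (Sum.inr l) := by
    intro k
    simp [Matrix.toLpLin_apply, Matrix.mulVec, dotProduct]
  have g2 : ∀ k, (Matrix.toEuclideanLin (Matrix.fromBlocks 0 C Cᴴ 0) v) (Sum.inr k) = ∑ l, Cᴴ k l * v (Sum.inl l) := by
    intro k
    simp [Matrix.toLpLin_apply, Matrix.mulVec, dotProduct]
  simp only [LinearEquiv.trans_apply, LinearMap.coe_toContinuousLinearMap', g1, g2]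
  linarith

open scoped Matrix.Norms.L2Operator MatrixOrder in
lemma contr_dec {κ : Type*} [Fintype κ] [DecidableEq κ] (C : Matrix κ κ ℂ)
    (hC : ∑ k, ∑ l, ‖C k l‖ ^ 2 ≤ 1) :
    ∃ V₁ ∈ unitary (Matrix (κ ⊕ κ) (κ ⊕ κ) ℂ), ∃ V₂ ∈ unitary (Matrix (κ ⊕ κ) (κ ⊕ κ) ℂ),
      (V₁ + V₂).submatrix Sum.inl Sum.inl = (2 : ℂ) • C := by
  let T : selfAdjoint (Matrix (κ ⊕ κ) (κ ⊕ κ) ℂ) := ⟨Matrix.fromBlocks 0 C Cᴴ 0, by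
    rw [selfAdjoint.mem_iff, Matrix.star_eq_conjTranspose, Matrix.fromBlocks_conjTranspose]; simp⟩
  let V := selfAdjoint.unitarySelfAddISMul T (T_norm C hC)
  let σ : Matrix (κ ⊕ κ) (κ ⊕ κ) ℂ := Matrix.fromBlocks 0 1 1 0
  have hσ : σ ∈ unitary (Matrix (κ ⊕ κ) (κ ⊕ κ) ℂ) := by
    rw [Unitary.mem_iff, Matrix.star_eq_conjTranspose, Matrix.fromBlocks_conjTranspose]
    simp [σ, Matrix.fromBlocks_multiply]
  refine ⟨V * σ, mul_mem V.2 hσ, (star V : unitary _) * σ, mul_mem (star V).2 hσ, ?_⟩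
  rw [← add_mul]
  have : (V : Matrix (κ ⊕ κ) (κ ⊕ κ) ℂ) + (star V : unitary _) = (2 : ℂ) • (T : Matrix (κ ⊕ κ) (κ ⊕ κ) ℂ) := by
    have h := selfAdjoint.star_coe_unitarySelfAddISMul T (T_norm C hC)
    rw [show ((star V : unitary (Matrix (κ ⊕ κ) (κ ⊕ κ) ℂ)) : Matrix (κ ⊕ κ) (κ ⊕ κ) ℂ) = _ from h,
      two_smul]
    simp only [V, selfAdjoint.unitarySelfAddISMul]
    abel
  rw [this]
  ext k l
  simp [T, σ, Matrix.fromBlocks_multiply]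

abbrev SC (ι κ : Type*) : AddSubmonoid (Matrix (ι × κ) (ι × κ) ℂ) :=
  AddSubmonoid.closure {ρ | ∃ (A : Matrix ι ι ℂ) (B : Matrix κ κ ℂ),
    A.PosSemidef ∧ B.PosSemidef ∧ ρ = A ⊗ₖ B}

lemma SC_mem {ι κ : Type*} {A : Matrix ι ι ℂ} {B : Matrix κ κ ℂ} (hA : A.PosSemidef)
    (hB : B.PosSemidef) : A ⊗ₖ B ∈ SC ι κ :=
  AddSubmonoid.subset_closure ⟨A, B, hA, hB, rfl⟩

lemma SC_smul {ι κ : Type*} {ρ : Matrix (ι × κ) (ι × κ) ℂ} (h : ρ ∈ SC ι κ) (c : ℝ) (hc : 0 ≤ c) :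
    (c : ℂ) • ρ ∈ SC ι κ := by
  induction h using AddSubmonoid.closure_induction with
  | mem x hx =>
    obtain ⟨A, B, hA, hB, rfl⟩ := hx
    rw [← Matrix.smul_kronecker]
    exact SC_mem (hA.smul (by simpa using hc)) hB
  | zero => simp
  | add x y _ _ hx hy => rw [smul_add]; exact add_mem hx hy

lemma psd_single {ι : Type*} [Fintype ι] [DecidableEq ι] (i : ι) :
    (Matrix.single i i (1 : ℂ)).PosSemidef := by
  have := Matrix.posSemidef_vecMulVec_self_star (Pi.single i (1 : ℂ))
  convert this using 1
  ext a b
  simp [Matrix.single, Matrix.vecMulVec_apply, Pi.single_apply]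
  grind

lemma psd_two {ι : Type*} [Fintype ι] [DecidableEq ι] (i j : ι) (a b : ℝ)
    (z : ℂ) (hz : ‖z‖ = 1) :
    (((a : ℂ) ^ 2) • Matrix.single i i (1 : ℂ) + ((b : ℂ) ^ 2) • Matrix.single j j (1 : ℂ)
      + ((a * b : ℂ) * z) • Matrix.single i j (1 : ℂ)
      + ((a * b : ℂ) * star z) • Matrix.single j i (1 : ℂ)).PosSemidef := by
  have := Matrix.posSemidef_vecMulVec_self_star
    ((a : ℂ) • Pi.single i (1 : ℂ) + ((b : ℂ) * star z) • Pi.single j (1 : ℂ))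
  convert this using 1
  have hzz : star z * z = 1 := by
    have := Complex.conj_mul' z
    rw [hz] at this
    simpa using this
  have key : ∀ p q : ι, Matrix.single p q (1 : ℂ) = Matrix.vecMulVec (Pi.single p 1) (Pi.single q 1) := by
    intro p q
    ext x y
    simp [Matrix.single, Matrix.vecMulVec_apply, Pi.single_apply]
    grind
  have hs : ∀ p : ι, star (Pi.single p (1 : ℂ) : ι → ℂ) = Pi.single p 1 := by
    intro p; ext x; simp [Pi.single_apply]
  simp only [key, star_add, star_smul, hs, Matrix.add_vecMulVec, Matrix.vecMulVec_add,
    Matrix.smul_vecMulVec, Matrix.vecMulVec_smul]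
  have e2 : star (a : ℂ) = a := by simp
  have e3 : star (b : ℂ) = b := by simp
  ext x y
  simp only [Matrix.add_apply, Matrix.smul_apply, smul_eq_mul, e2, star_mul, star_star, e3]
  linear_combination (-(b : ℂ) ^ 2 * (Matrix.vecMulVec (Pi.single j 1) (Pi.single j (1 : ℂ)) x y)) * hzz

lemma SC_unitary {ι κ κ' : Type*} [Fintype ι] [DecidableEq ι] [Fintype κ] [DecidableEq κ]
    [Fintype κ'] [DecidableEq κ'] (f : κ → κ') (hf : Function.Injective f)
    (V : Matrix κ' κ' ℂ) (hV : V ∈ unitary (Matrix κ' κ' ℂ))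
    (i j : ι) (a b : ℝ) :
    ((a : ℂ) ^ 2) • (Matrix.single i i (1 : ℂ) ⊗ₖ (1 : Matrix κ κ ℂ))
      + ((b : ℂ) ^ 2) • (Matrix.single j j (1 : ℂ) ⊗ₖ (1 : Matrix κ κ ℂ))
      + (a * b : ℂ) • (Matrix.single i j (1 : ℂ) ⊗ₖ V.submatrix f f)
      + (a * b : ℂ) • (Matrix.single j i (1 : ℂ) ⊗ₖ (V.submatrix f f)ᴴ) ∈ SC ι κ := by
  obtain ⟨s, P, hs, hP, h1, h2⟩ := unitary_dec V hV
  have q1 : ∑ z ∈ s, (P z).submatrix f f = 1 := by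
    rw [← Matrix.submatrix_one f hf, ← h1]
    ext k l; simp [Matrix.sum_apply]
  have q2 : V.submatrix f f = ∑ z ∈ s, z • (P z).submatrix f f := by
    rw [← h2]
    ext k l; simp [Matrix.sum_apply]
  have q3 : (V.submatrix f f)ᴴ = ∑ z ∈ s, star z • (P z).submatrix f f := by
    rw [q2, Matrix.conjTranspose_sum]
    refine Finset.sum_congr rfl fun z _ => ?_
    rw [Matrix.conjTranspose_smul, ((hP z).submatrix f).isHermitian.eq]
  have : ((a : ℂ) ^ 2) • (Matrix.single i i (1 : ℂ) ⊗ₖ (1 : Matrix κ κ ℂ))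
      + ((b : ℂ) ^ 2) • (Matrix.single j j (1 : ℂ) ⊗ₖ (1 : Matrix κ κ ℂ))
      + (a * b : ℂ) • (Matrix.single i j (1 : ℂ) ⊗ₖ V.submatrix f f)
      + (a * b : ℂ) • (Matrix.single j i (1 : ℂ) ⊗ₖ (V.submatrix f f)ᴴ)
      = ∑ z ∈ s, ((((a : ℂ) ^ 2) • Matrix.single i i (1 : ℂ)
        + ((b : ℂ) ^ 2) • Matrix.single j j (1 : ℂ)
        + ((a * b : ℂ) * z) • Matrix.single i j (1 : ℂ)
        + ((a * b : ℂ) * star z) • Matrix.single j i (1 : ℂ)) ⊗ₖ (P z).submatrix f f) := by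
    rw [q3, q2, ← q1]
    ext ⟨x, k⟩ ⟨y, l⟩
    simp only [Matrix.add_apply, Matrix.smul_apply, Matrix.kronecker_apply, Matrix.sum_apply,
      smul_eq_mul, Finset.mul_sum, ← Finset.sum_add_distrib]
    refine Finset.sum_congr rfl fun z _ => ?_
    ring
  rw [this]
  exact sum_mem fun z hz => SC_mem (psd_two i j a b z (hs z hz)) ((hP z).submatrix f)

lemma SC_block {ι κ : Type*} [Fintype ι] [DecidableEq ι] [Fintype κ] [DecidableEq κ]
    (X : Matrix κ κ ℂ) (i j : ι) (a b : ℝ) (ha : 0 ≤ a) (hb : 0 ≤ b)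
    (hX : ∑ k, ∑ l, ‖X k l‖ ^ 2 ≤ a * b) :
    (a : ℂ) • (Matrix.single i i (1 : ℂ) ⊗ₖ (1 : Matrix κ κ ℂ))
      + (b : ℂ) • (Matrix.single j j (1 : ℂ) ⊗ₖ (1 : Matrix κ κ ℂ))
      + (Matrix.single i j (1 : ℂ) ⊗ₖ X)
      + (Matrix.single j i (1 : ℂ) ⊗ₖ Xᴴ) ∈ SC ι κ := by
  rcases (mul_nonneg ha hb).eq_or_lt with h0 | h0
  · have hX0 : X = 0 := by
      ext k l
      have h1 : ‖X k l‖ ^ 2 ≤ ∑ k, ∑ l, ‖X k l‖ ^ 2 := by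
        refine le_trans ?_ (Finset.single_le_sum (f := fun k => ∑ l, ‖X k l‖ ^ 2)
          (fun _ _ => by positivity) (Finset.mem_univ k))
        exact Finset.single_le_sum (f := fun l => ‖X k l‖ ^ 2)
          (fun _ _ => by positivity) (Finset.mem_univ l)
      have h2 : ‖X k l‖ ^ 2 = 0 := le_antisymm (by linarith) (by positivity)
      simpa using h2
    subst hX0
    simp only [Matrix.conjTranspose_zero, Matrix.kronecker_zero, add_zero]
    exact add_mem (SC_smul (SC_mem (psd_single i) Matrix.PosSemidef.one) a ha)
      (SC_smul (SC_mem (psd_single j) Matrix.PosSemidef.one) b hb)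
  · set p := √a
    set q := √b
    have hp : p ^ 2 = a := Real.sq_sqrt ha
    have hq : q ^ 2 = b := Real.sq_sqrt hb
    have hpq : 0 < p * q := by
      rw [← Real.sqrt_mul ha]; exact Real.sqrt_pos.2 h0
    have hpq' : (p * q : ℂ) ≠ 0 := by exact_mod_cast hpq.ne'
    obtain ⟨V₁, hV₁, V₂, hV₂, hV⟩ := contr_dec ((p * q : ℂ)⁻¹ • X) (by
      have : ∀ k l, ‖((p * q : ℂ)⁻¹ • X) k l‖ ^ 2 = (a * b)⁻¹ * ‖X k l‖ ^ 2 := by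
        intro k l
        rw [Matrix.smul_apply, smul_eq_mul, norm_mul, mul_pow, norm_inv, inv_pow, ← hp, ← hq]
        congr 2
        rw [← Complex.ofReal_mul, Complex.norm_real, Real.norm_eq_abs, sq_abs, mul_pow]
      simp only [this, ← Finset.mul_sum]
      rw [inv_mul_le_iff₀ h0, mul_one]
      exact hX)
    have m1 := SC_unitary (ι := ι) Sum.inl Sum.inl_injective V₁ hV₁ i j p q
    have m2 := SC_unitary (ι := ι) Sum.inl Sum.inl_injective V₂ hV₂ i j p q
    have m3 := SC_smul (add_mem m1 m2) (1 / 2) (by norm_num)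
    convert m3 using 1
    have hXX : X = (1 / 2 : ℂ) • (p * q : ℂ) • (V₁.submatrix Sum.inl Sum.inl
        + V₂.submatrix Sum.inl Sum.inl) := by
      have hV' : V₁.submatrix Sum.inl Sum.inl + V₂.submatrix Sum.inl Sum.inl
          = (2 : ℂ) • (p * q : ℂ)⁻¹ • X := by rw [← hV]; rfl
      rw [hV', smul_smul, smul_smul, smul_smul]
      rw [show (1 / 2 * ((p : ℂ) * q) * 2 * ((p : ℂ) * q)⁻¹) = 1 by
        field_simp
        exact div_self hpq', one_smul]
    have hp' : (a : ℂ) = (p : ℂ) ^ 2 := by rw [← hp]; push_cast; rfl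
    have hq' : (b : ℂ) = (q : ℂ) ^ 2 := by rw [← hq]; push_cast; rfl
    rw [hXX, hp', hq']
    ext ⟨x, k⟩ ⟨y, l⟩
    simp only [Matrix.add_apply, Matrix.smul_apply, Matrix.kronecker_apply,
      smul_eq_mul, Matrix.conjTranspose_apply, star_mul', star_add]
    simp
    ring

lemma SC_ball {ι κ : Type*} [Fintype ι] [DecidableEq ι] [Fintype κ] [DecidableEq κ]
    (D : Matrix (ι × κ) (ι × κ) ℂ) (hD : Dᴴ = D) (hF : ∑ x, ∑ y, ‖D x y‖ ^ 2 ≤ 1) :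
    1 + D ∈ SC ι κ := by
  let X : ι → ι → Matrix κ κ ℂ := fun i j => Matrix.of fun k l => D (i, k) (j, l)
  have hXs : ∀ i j, (X i j)ᴴ = X j i := by
    intro i j; ext k l
    simp only [X, Matrix.conjTranspose_apply, Matrix.of_apply]
    rw [← Matrix.conjTranspose_apply, hD]
  let M2 : ι → ι → ℝ := fun i j => ∑ k, ∑ l, ‖X i j k l‖ ^ 2
  have hM2 : ∀ i j, 0 ≤ M2 i j := fun i j => by positivity
  have hM2s : ∀ i j, M2 i j = M2 j i := by
    intro i j
    simp only [M2, ← hXs i j]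
    rw [Finset.sum_comm]
    simp [Matrix.conjTranspose_apply]
  let M : ι → ι → ℝ := fun i j => √(M2 i j)
  have hMM : ∀ i j, M i j ^ 2 = M2 i j := fun i j => Real.sq_sqrt (hM2 i j)
  have hM0 : ∀ i j, 0 ≤ M i j := fun i j => Real.sqrt_nonneg _
  have hMs : ∀ i j, M i j = M j i := fun i j => by simp only [M, hM2s i j]
  let r : ι → ℝ := fun i => √(∑ j, M2 i j)
  have hr0 : ∀ i, 0 ≤ r i := fun i => Real.sqrt_nonneg _
  have hr2 : ∀ i, r i ^ 2 = ∑ j, M2 i j :=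
    fun i => Real.sq_sqrt (Finset.sum_nonneg fun j _ => hM2 i j)
  have hrs : ∑ i, r i ^ 2 ≤ 1 := by
    refine le_trans (le_of_eq ?_) hF
    simp only [hr2, Fintype.sum_prod_type, M2, X, Matrix.of_apply]
    refine Finset.sum_congr rfl fun i _ => ?_
    rw [Finset.sum_comm]
  have hrM : ∀ i j, r i = 0 → M2 i j = 0 := by
    intro i j h
    have h1 := hr2 i
    rw [h] at h1
    have h2 := (Finset.sum_eq_zero_iff_of_nonneg (fun j _ => hM2 i j)).1 (by simpa using h1.symm)
    exact h2 j (Finset.mem_univ j)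
  let a : ι → ι → ℝ := fun i j => M i j * r j / r i
  have ha0 : ∀ i j, 0 ≤ a i j := fun i j => div_nonneg (mul_nonneg (hM0 i j) (hr0 j)) (hr0 i)
  have haa : ∀ i j, M2 i j ≤ a i j * a j i := by
    intro i j
    by_cases h1 : r i = 0
    · rw [hrM i j h1]; exact mul_nonneg (ha0 _ _) (ha0 _ _)
    by_cases h2 : r j = 0
    · rw [hM2s, hrM j i h2]; exact mul_nonneg (ha0 _ _) (ha0 _ _)
    simp only [a]
    rw [← hMM, hMs j i]
    apply le_of_eq
    field_simp
  have hsum : ∀ i, ∑ j, a i j ≤ 1 := by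
    intro i
    simp only [a]
    rw [← Finset.sum_div]
    refine div_le_one_of_le₀ ?_ (hr0 i)
    refine (sq_le_sq₀ (Finset.sum_nonneg fun j _ => mul_nonneg (hM0 i j) (hr0 j)) (hr0 i)).1 ?_
    refine (Finset.sum_mul_sq_le_sq_mul_sq _ _ _).trans ?_
    simp only [hMM]
    rw [← hr2 i]
    exact mul_le_of_le_one_right (by positivity) hrs
  have m1 : ∑ i, ∑ j, ((1 / 2 : ℝ) : ℂ) • (
      (a i j : ℂ) • (Matrix.single i i (1 : ℂ) ⊗ₖ (1 : Matrix κ κ ℂ))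
      + (a j i : ℂ) • (Matrix.single j j (1 : ℂ) ⊗ₖ (1 : Matrix κ κ ℂ))
      + (Matrix.single i j (1 : ℂ) ⊗ₖ X i j)
      + (Matrix.single j i (1 : ℂ) ⊗ₖ (X i j)ᴴ)) ∈ SC ι κ :=
    sum_mem fun i _ => sum_mem fun j _ =>
      SC_smul (SC_block (X i j) i j _ _ (ha0 i j) (ha0 j i) (haa i j)) _ (by norm_num)
  have m2 : ∑ i, ((1 - ∑ j, a i j : ℝ) : ℂ) •
      (Matrix.single i i (1 : ℂ) ⊗ₖ (1 : Matrix κ κ ℂ)) ∈ SC ι κ :=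
    sum_mem fun i _ => SC_smul (SC_mem (psd_single i) Matrix.PosSemidef.one) _
      (by linarith [hsum i])
  convert add_mem m1 m2 using 1
  have e1 : D = ∑ i, ∑ j, (Matrix.single i j (1 : ℂ) ⊗ₖ X i j) := by
    ext ⟨x, k⟩ ⟨y, l⟩
    simp only [Matrix.sum_apply, Matrix.kronecker_apply, Matrix.single_apply, X, Matrix.of_apply]
    rw [Finset.sum_eq_single x, Finset.sum_eq_single y] <;> simp +contextual
  have e2 : (1 : Matrix (ι × κ) (ι × κ) ℂ)
      = ∑ i, (Matrix.single i i (1 : ℂ) ⊗ₖ (1 : Matrix κ κ ℂ)) := by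
    ext ⟨x, k⟩ ⟨y, l⟩
    simp only [Matrix.sum_apply, Matrix.kronecker_apply, Matrix.single_apply, Matrix.one_apply]
    rw [Finset.sum_eq_single x]
    · simp; grind
    · simp +contextual
    · simp
  simp only [hXs, smul_add, Finset.sum_add_distrib]
  rw [Finset.sum_comm (f := fun i j => ((1 / 2 : ℝ) : ℂ) • (a j i : ℂ) • (Matrix.single j j (1 : ℂ) ⊗ₖ (1 : Matrix κ κ ℂ))),
    Finset.sum_comm (f := fun i j => ((1 / 2 : ℝ) : ℂ) • (Matrix.single j i (1 : ℂ) ⊗ₖ X j i))]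
  simp only [← Finset.smul_sum, ← e1]
  have e3 : ∑ i, ((1 - ∑ j, a i j : ℝ) : ℂ) • (Matrix.single i i (1 : ℂ) ⊗ₖ (1 : Matrix κ κ ℂ))
      = 1 - ∑ i, ∑ j, (a i j : ℂ) • (Matrix.single i i (1 : ℂ) ⊗ₖ (1 : Matrix κ κ ℂ)) := by
    rw [e2, ← Finset.sum_sub_distrib]
    refine Finset.sum_congr rfl fun i _ => ?_
    push_cast
    rw [sub_smul, one_smul, Finset.sum_smul]
  rw [e3]
  module

lemma psd_normalize {τ : Type*} [Fintype τ] [DecidableEq τ] [Nonempty τ] (A : Matrix τ τ ℂ)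
    (hA : A.PosSemidef) :
    ∃ (t : ℝ) (A' : Matrix τ τ ℂ), 0 ≤ t ∧ IsDM A' ∧ A = (t : ℂ) • A' := by
  by_cases h : A.trace = 0
  · obtain ⟨i⟩ := ‹Nonempty τ›
    refine ⟨0, Matrix.single i i 1, le_rfl, ⟨psd_single i, by simp⟩, ?_⟩
    rw [hA.trace_eq_zero_iff.1 h]; simp
  · have h0 := hA.trace_nonneg
    obtain ⟨h1, h2⟩ := Complex.le_def.1 h0
    have h3 : ((A.trace.re : ℝ) : ℂ) = A.trace := by
      apply Complex.ext <;> simp_all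
    refine ⟨A.trace.re, (A.trace)⁻¹ • A, by simpa using h1, ⟨hA.smul ?_, ?_⟩, ?_⟩
    · rw [← h3, ← Complex.ofReal_inv]
      exact_mod_cast inv_nonneg.2 h1
    · rw [Matrix.trace_smul, smul_eq_mul, inv_mul_cancel₀ h]
    · rw [h3, smul_smul, mul_inv_cancel₀ h, one_smul]

lemma sep_of_SC {ι κ : Type*} [Fintype ι] [DecidableEq ι] [Fintype κ] [DecidableEq κ]
    [Nonempty ι] [Nonempty κ]
    (ρ : Matrix (ι × κ) (ι × κ) ℂ) (h : ρ ∈ SC ι κ) (ht : ρ.trace = 1) : IsSep ρ := by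
  have key : ∃ (k : ℕ) (p : Fin k → ℝ) (A : Fin k → Matrix ι ι ℂ) (B : Fin k → Matrix κ κ ℂ),
      (∀ i, 0 ≤ p i) ∧ (∀ i, IsDM (A i)) ∧ (∀ i, IsDM (B i)) ∧
      ρ = ∑ i, (p i : ℂ) • (A i ⊗ₖ B i) := by
    clear ht
    induction h using AddSubmonoid.closure_induction with
    | mem x hx =>
      obtain ⟨A, B, hA, hB, rfl⟩ := hx
      obtain ⟨s, A', hs, hA', rfl⟩ := psd_normalize A hA
      obtain ⟨t, B', ht, hB', rfl⟩ := psd_normalize B hB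
      refine ⟨1, fun _ => s * t, fun _ => A', fun _ => B', fun _ => mul_nonneg hs ht,
        fun _ => hA', fun _ => hB', ?_⟩
      rw [Matrix.smul_kronecker, Matrix.kronecker_smul, smul_smul]
      simp
    | zero => exact ⟨0, Fin.elim0, Fin.elim0, Fin.elim0, by simp⟩
    | add x y _ _ hx hy =>
      obtain ⟨k, p, A, B, h1, h2, h3, rfl⟩ := hx
      obtain ⟨k', p', A', B', h1', h2', h3', rfl⟩ := hy
      refine ⟨k + k', Fin.append p p', Fin.append A A', Fin.append B B', ?_, ?_, ?_, ?_⟩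
      · intro i; induction i using Fin.addCases <;> simp [*]
      · intro i; induction i using Fin.addCases <;> simp [*]
      · intro i; induction i using Fin.addCases <;> simp [*]
      · simp [Fin.sum_univ_add]
  obtain ⟨k, p, A, B, h1, h2, h3, h4⟩ := key
  refine ⟨k, p, A, B, h1, ?_, h2, h3, h4⟩
  rw [h4, Matrix.trace_sum] at ht
  simp only [Matrix.trace_smul, Matrix.trace_kronecker, (h2 _).2, (h3 _).2] at ht
  have : ((∑ i, p i : ℝ) : ℂ) = 1 := by push_cast; simpa using ht
  exact_mod_cast this

lemma frob_eq {τ : Type*} [Fintype τ] (H : Matrix τ τ ℂ) (hH : Hᴴ = H) :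
    ∑ x, ∑ y, ‖H x y‖ ^ 2 = ((H * H).trace).re := by
  have : (H * H).trace = (H * Hᴴ).trace := by rw [hH]
  rw [this]
  simp only [Matrix.trace, Matrix.diag_apply, Matrix.mul_apply, Matrix.conjTranspose_apply,
    Complex.re_sum]
  refine Finset.sum_congr rfl fun x _ => Finset.sum_congr rfl fun y _ => ?_
  have := Complex.mul_conj' (H x y)
  have h2 : H x y * star (H x y) = ((‖H x y‖ ^ 2 : ℝ) : ℂ) := by push_cast; exact this
  rw [h2, Complex.ofReal_re]

lemma sep_of_purity (m n : ℕ) (hm : 2 ≤ m) (hn : 2 ≤ n)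
    (σ : Matrix (Fin m × Fin n) (Fin m × Fin n) ℂ) (hσ : IsDM σ)
    (hp : ((σ * σ).trace).re ≤ 1 / ((m : ℝ) * n - 1)) : IsSep σ := by
  have : NeZero m := ⟨by omega⟩
  have : NeZero n := ⟨by omega⟩
  refine sep_of_SC σ ?_ hσ.2
  have hm' : (2 : ℝ) ≤ m := by exact_mod_cast hm
  have hn' : (2 : ℝ) ≤ n := by exact_mod_cast hn
  set c : ℝ := (m : ℝ) * n - 1 with hc
  have hc0 : 0 < c := by nlinarith
  have hcc : (c : ℂ) ≠ 0 := by exact_mod_cast hc0.ne'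
  have hD : ((c : ℂ) • σ - 1)ᴴ = (c : ℂ) • σ - 1 := by
    rw [Matrix.conjTranspose_sub, Matrix.conjTranspose_smul, hσ.1.isHermitian.eq]
    simp
  have hF : ∑ x, ∑ y, ‖((c : ℂ) • σ - 1) x y‖ ^ 2 ≤ 1 := by
    rw [frob_eq _ hD]
    have e : (((c : ℂ) • σ - 1) * ((c : ℂ) • σ - 1)).trace
        = ((c ^ 2 : ℝ) : ℂ) * (σ * σ).trace + ((- 2 * c + (c + 1) : ℝ) : ℂ) := by
      simp only [sub_mul, mul_sub, Matrix.trace_sub, Matrix.smul_mul, Matrix.mul_smul,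
        Matrix.trace_smul, mul_one, one_mul, hσ.2, smul_eq_mul, Matrix.trace_one]
      simp [hc]
      ring
    rw [e, Complex.add_re, Complex.re_ofReal_mul, Complex.ofReal_re]
    have := mul_le_mul_of_nonneg_left hp (sq_nonneg c)
    have e2 : c ^ 2 * (1 / c) = c := by field_simp
    linarith
  have := SC_smul (SC_ball _ hD hF) c⁻¹ (by positivity)
  rwa [add_sub_cancel, smul_smul, Complex.ofReal_inv, inv_mul_cancel₀ hcc, one_smul] at this

theorem stmt5 (m n : ℕ) (hm : 2 ≤ m) (hn : 2 ≤ n)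
    (Φ : Matrix (Fin m × Fin n) (Fin m × Fin n) ℂ →ₗ[ℂ]
      Matrix (Fin m × Fin n) (Fin m × Fin n) ℂ)
    (hpos : ∀ X, X.PosSemidef → (Φ X).PosSemidef)
    (htr : ∀ X, (Φ X).trace = X.trace)
    (hpur : ∀ ρ, IsDM ρ → ((Φ ρ * Φ ρ).trace).re ≤ 1 / ((m : ℝ) * n - 1)) :
    ∀ ρ, IsDM ρ → IsAbsSep (Φ ρ) := by
  intro ρ hρ U hU
  have hU' : Uᴴ * U = 1 := mul_eq_one_comm.1 hU
  refine sep_of_purity m n hm hn _ ⟨(hpos ρ hρ.1).mul_mul_conjTranspose_same U, ?_⟩ ?_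
  · rw [Matrix.trace_mul_comm, ← Matrix.mul_assoc, hU', one_mul, htr, hρ.2]
  · have e : (U * Φ ρ * Uᴴ) * (U * Φ ρ * Uᴴ) = U * (Φ ρ * Φ ρ) * Uᴴ := by
      calc _ = U * Φ ρ * (Uᴴ * U) * Φ ρ * Uᴴ := by simp only [Matrix.mul_assoc]
        _ = _ := by rw [hU', mul_one]; simp only [Matrix.mul_assoc]
    rw [e, Matrix.trace_mul_comm, ← Matrix.mul_assoc, hU', one_mul]
    exact hpur ρ hρ

end
end

section
/- Let m, n ≥ 2 with mn ≥ 5, and let α, β be real numbers with 1+α ≥ 0, 1+β ≥ 0, 1+α+β ≥ 0 (so that the map below is positive). Define the trace-preserving map Φ_{αβ} on mn×mn complex matrices by Φ_{αβ}[X] = (tr(X)·I_{mn} + αX + βX^⊤)/(mn + α + β), where X^⊤ is the transpose in a fixed basis. If −1 ≤ α + β ≤ mn/(mn−2) and (α−β)² + ((mn−3)/(mn−1))·(α + β − 2/(mn−3))² ≤ 2(mn−2)/(mn−3), then Φ_{αβ} is absolutely separating with respect to the bipartition m|n. -/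
open Matrix Kronecker BigOperators
open scoped ComplexOrder

noncomputable section


/-- Transposition as a `ℂ`-linear map. -/
def transposeLM (ι : Type*) [Fintype ι] :
    Matrix ι ι ℂ →ₗ[ℂ] Matrix ι ι ℂ where
  toFun X := Xᵀ
  map_add' := by intro X Y; ext i j; simp
  map_smul' := by intro c X; ext i j; simp

/-- The map `Φ_{αβ}[X] = (tr X · I + α X + β Xᵀ)/(d + α + β)`. -/
def ctitMap {ι : Type*} [Fintype ι] [DecidableEq ι] (α β : ℝ) :
    Matrix ι ι ℂ →ₗ[ℂ] Matrix ι ι ℂ :=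
  ((((Fintype.card ι : ℝ) + α + β : ℝ) : ℂ))⁻¹ •
    ((Matrix.traceLinearMap ι ℂ ℂ).smulRight (1 : Matrix ι ι ℂ) +
      (α : ℂ) • LinearMap.id + (β : ℂ) • transposeLM ι)


theorem isCompact_convexHull_aux {E : Type*} [NormedAddCommGroup E] [NormedSpace ℝ E]
    [FiniteDimensional ℝ E] {s : Set E} (hs : IsCompact s) : IsCompact (convexHull ℝ s) := by
  classical
  rcases s.eq_empty_or_nonempty with rfl | ⟨z0, hz0⟩
  · simp
  let N := Module.finrank ℝ E + 1
  have hK : IsCompact ((stdSimplex ℝ (Fin N)) ×ˢ (Set.univ.pi fun _ : Fin N => s)) :=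
    (isCompact_stdSimplex ℝ (Fin N)).prod (isCompact_univ_pi fun _ => hs)
  have hf : Continuous fun p : (Fin N → ℝ) × (Fin N → E) => ∑ i, p.1 i • p.2 i := by fun_prop
  convert hK.image hf using 1
  ext x
  constructor
  · intro hx
    obtain ⟨ι, _, z, w, hz, haff, hw, hw1, hx⟩ := eq_pos_convex_span_of_mem_convexHull hx
    have hcard : Fintype.card ι ≤ Fintype.card (Fin N) := by
      rw [Fintype.card_fin]
      refine haff.card_le_finrank_succ.trans ?_
      exact Nat.succ_le_succ (Submodule.finrank_le _)
    obtain ⟨e⟩ := Function.Embedding.nonempty_of_card_le hcard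
    refine ⟨(Function.extend e w 0, Function.extend e z (fun _ => z0)), ⟨⟨?_, ?_⟩, ?_⟩, ?_⟩
    · intro j
      by_cases hj : j ∈ Set.range e
      · obtain ⟨i, rfl⟩ := hj
        simpa [e.injective.extend_apply] using (hw i).le
      · have : ¬ ∃ a, e a = j := hj
        simp [Function.extend_apply' _ _ _ this]
    · rw [← hw1]
      apply Fintype.sum_of_injective e e.injective w _ _ _ |>.symm
      · intro j hj
        exact Function.extend_apply' _ _ _ hj
      · intro i; simp [e.injective.extend_apply]
    · intro j _
      by_cases hj : j ∈ Set.range e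
      · obtain ⟨i, rfl⟩ := hj
        simpa [e.injective.extend_apply] using hz ⟨i, rfl⟩
      · have : ¬ ∃ a, e a = j := hj
        simpa [Function.extend_apply' _ _ _ this] using hz0
    · simp only
      rw [← hx]
      apply Fintype.sum_of_injective e e.injective _ _ _ _ |>.symm
      · intro j hj
        have : ¬ ∃ a, e a = j := hj
        simp [Function.extend_apply' _ _ _ this]
      · intro i; simp [e.injective.extend_apply]
  · rintro ⟨⟨w, z⟩, ⟨⟨h1, h2⟩, h3⟩, rfl⟩
    exact mem_convexHull_of_exists_fintype w z h1 h2 (fun i => h3 i trivial) rfl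

theorem finite_det_add_smul {n : Type*} [Fintype n] [DecidableEq n] (M : Matrix n n ℂ) :
    {z : ℂ | (M + z • (1 : Matrix n n ℂ)).det = 0}.Finite := by
  have hp : (-M).charpoly ≠ 0 := ((-M).charpoly_monic).ne_zero
  refine ((-M).charpoly.roots.toFinset.finite_toSet).subset ?_
  intro z hz
  simp only [Finset.mem_coe, Multiset.mem_toFinset, Polynomial.mem_roots hp, Polynomial.IsRoot]
  rw [Matrix.eval_charpoly]
  simp only [Set.mem_ofPred_eq] at hz
  rw [← hz]
  congr 1
  rw [sub_neg_eq_add, add_comm, Matrix.smul_one_eq_diagonal]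
  rfl

theorem exists_phase (S : Set ℂ) (hS : S.Finite) : ∃ c : ℂ, c * star c = 1 ∧ c ∉ S := by
  have hinj : Function.Injective (fun t : ℝ => (1 + t * Complex.I) / (1 - t * Complex.I)) := by
    intro s t h
    have h1 : ∀ t : ℝ, (1 - t * Complex.I) ≠ 0 := by
      intro t h; have := congrArg Complex.re h; simp at this
    simp only at h
    rw [div_eq_div_iff (h1 s) (h1 t)] at h
    have := congrArg Complex.im h
    simp at this
    linarith
  obtain ⟨c, hc⟩ := (Set.infinite_range_of_injective hinj).exists_notMem_finite hS
  obtain ⟨⟨t, rfl⟩, hc⟩ := hc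
  refine ⟨_, ?_, hc⟩
  have h1 : ∀ t : ℝ, (1 - t * Complex.I) ≠ 0 := by
    intro t h; have := congrArg Complex.re h; simp at this
  have h2 : ∀ t : ℝ, (1 + t * Complex.I) ≠ 0 := by
    intro t h; have := congrArg Complex.re h; simp at this
  simp only [star_div₀, star_add, star_sub, star_mul', star_one, RCLike.star_def,
    Complex.conj_ofReal, Complex.conj_I]
  have h1 := h1 t
  have h2 := h2 t
  rw [mul_neg, sub_neg_eq_add, ← sub_eq_add_neg]
  field_simp

theorem herm_diag {n : Type*} [Fintype n] [DecidableEq n] (K : Matrix n n ℂ)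
    (hK : K.IsHermitian) : ∃ (V : Matrix n n ℂ) (k : n → ℝ), V * Vᴴ = 1 ∧ Vᴴ * V = 1 ∧
      K = V * diagonal (fun i => (k i : ℂ)) * Vᴴ := by
  refine ⟨hK.eigenvectorUnitary, hK.eigenvalues, ?_, ?_, ?_⟩
  · exact Unitary.coe_mul_star_self _
  · exact Unitary.coe_star_mul_self _
  · conv_lhs => rw [hK.spectral_theorem]
    rw [Unitary.conjStarAlgAut_apply]
    rfl

theorem unitary_diag {n : Type*} [Fintype n] [DecidableEq n] (U : Matrix n n ℂ)
    (hU : U * Uᴴ = 1) : ∃ (V : Matrix n n ℂ) (D : n → ℂ), V * Vᴴ = 1 ∧ Vᴴ * V = 1 ∧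
      (∀ i, ‖D i‖ = 1) ∧ U = V * diagonal D * Vᴴ := by
  obtain ⟨c, hc, hcU⟩ := exists_phase _ (finite_det_add_smul U)
  simp only [Set.mem_ofPred_eq] at hcU
  have hc0 : c ≠ 0 := by rintro rfl; simp at hc
  have hcn : ‖c‖ = 1 := by
    have := congrArg norm hc
    rw [norm_mul, norm_star, norm_one] at this
    nlinarith [norm_nonneg c]
  set M := U + c • (1 : Matrix n n ℂ) with hM
  have hMu : IsUnit M.det := isUnit_iff_ne_zero.mpr hcU
  have hMh : Mᴴ = Uᴴ + star c • 1 := by simp [hM, conjTranspose_smul]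
  set T := c • M⁻¹ with hT
  have hTM : T * M = c • 1 := by rw [hT, smul_mul_assoc, nonsing_inv_mul _ hMu]
  have hMT : M * T = c • 1 := by rw [hT, mul_smul_comm, mul_nonsing_inv _ hMu]
  have hThMh : Tᴴ * Mᴴ = star c • 1 := by
    rw [← conjTranspose_mul, hMT]; simp [conjTranspose_smul]
  have hsum : T + Tᴴ = 1 := by
    have h1 : M * (T + Tᴴ) * Mᴴ = M * 1 * Mᴴ := by
      rw [mul_add, add_mul, hMT, mul_assoc M, hThMh]
      simp only [mul_one, smul_mul_assoc, mul_smul_comm, one_mul]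
      rw [hMh, hM]
      simp only [add_mul, mul_add, hU, smul_mul_assoc, mul_smul_comm, one_mul, mul_one, smul_add,
        smul_smul, hc, mul_comm (star c) c, one_smul]
      abel
    have hMhu : IsUnit Mᴴ.det := by rw [det_conjTranspose]; exact hMu.star
    have h2 := congrArg (fun X => M⁻¹ * X * (Mᴴ)⁻¹) h1
    simp only [mul_assoc] at h2
    rw [mul_nonsing_inv _ hMhu] at h2
    simpa [← mul_assoc, nonsing_inv_mul _ hMu] using h2
  set K := Complex.I • (T - (1/2 : ℂ) • (1 : Matrix n n ℂ)) with hKdef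
  have hK : K.IsHermitian := by
    have : Tᴴ = 1 - T := by rw [← hsum]; abel
    unfold Matrix.IsHermitian
    have h2 : star (1/2 : ℂ) = 1/2 := by simp
    rw [hKdef, conjTranspose_smul, conjTranspose_sub, this, conjTranspose_smul, h2,
      conjTranspose_one, RCLike.star_def, Complex.conj_I]
    module
  obtain ⟨V, k, hV1, hV2, hKV⟩ := herm_diag K hK
  have hne : ∀ i, (1/2 - Complex.I * k i : ℂ) ≠ 0 := by
    intro i h; have := congrArg Complex.re h; simp at this
  have hTV : T = V * diagonal (fun i => (1/2 - Complex.I * k i : ℂ)) * Vᴴ := by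
    have h1 : T = (1/2 : ℂ) • (1 : Matrix n n ℂ) - Complex.I • K := by
      rw [hKdef, smul_smul, Complex.I_mul_I]; simp
    have h2 : diagonal (fun i => (1/2 - Complex.I * k i : ℂ)) =
       (1/2 : ℂ) • (1 : Matrix n n ℂ) - Complex.I • diagonal (fun i => (k i : ℂ)) := by
      ext i j
      by_cases h : i = j
      · subst h; simp
      · simp [h]
    rw [h1, h2, mul_sub, sub_mul, hKV]
    simp [hV1]
  have hMV : M = V * diagonal (fun i => c * (1/2 - Complex.I * k i : ℂ)⁻¹) * Vᴴ := by
    have h1 : T * (V * diagonal (fun i => c * (1/2 - Complex.I * k i : ℂ)⁻¹) * Vᴴ) = c • 1 := by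
      have h3 : ∀ X Y : Matrix n n ℂ, V * X * Vᴴ * (V * Y * Vᴴ) = V * (X * Y) * Vᴴ := by
        intro X Y
        calc _ = V * X * (Vᴴ * V) * Y * Vᴴ := by simp only [mul_assoc]
          _ = _ := by rw [hV2]; simp only [mul_assoc, one_mul]
      rw [hTV, h3, diagonal_mul_diagonal]
      have : (fun i => (1/2 - Complex.I * k i : ℂ) * (c * (1/2 - Complex.I * k i : ℂ)⁻¹)) =
          fun _ => c := by
        funext i; have := hne i; rw [mul_left_comm, mul_inv_cancel₀ this, mul_one]
      rw [this, ← smul_one_eq_diagonal]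
      simp [hV1]
    have h2 := congrArg (fun X => M * X) h1
    simp only [← mul_assoc, hMT] at h2
    simp only [smul_mul_assoc, one_mul, mul_smul_comm, mul_one] at h2
    exact (smul_right_injective _ hc0 h2).symm
  refine ⟨V, fun i => c * (1/2 - Complex.I * k i : ℂ)⁻¹ - c, hV1, hV2, ?_, ?_⟩
  · intro i
    have : c * (1/2 - Complex.I * k i : ℂ)⁻¹ - c =
      c * ((1/2 + Complex.I * k i : ℂ) / (1/2 - Complex.I * k i : ℂ)) := by
      have := hne i
      generalize Complex.I * (k i : ℂ) = x at *
      rw [← sub_eq_zero]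
      have e : c * (1/2 - x)⁻¹ - c - c * ((1/2 + x) / (1/2 - x)) =
        c * ((1 - (1/2 - x) - (1/2 + x)) * (1/2 - x)⁻¹) +
          c * ((1/2 - x) * (1/2 - x)⁻¹ - 1) := by ring
      rw [e, mul_inv_cancel₀ this]
      ring
    beta_reduce
    rw [this, norm_mul, hcn, norm_div, one_mul]
    have h4 : (1/2 + Complex.I * k i : ℂ) = star (1/2 - Complex.I * k i : ℂ) := by
      simp
    rw [h4, norm_star, div_self (norm_ne_zero_iff.mpr (hne i))]
  · have h1 : U = M - c • 1 := by rw [hM]; simp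
    have h2 : diagonal (fun i => c * (1/2 - Complex.I * k i : ℂ)⁻¹ - c) =
       diagonal (fun i => c * (1/2 - Complex.I * k i : ℂ)⁻¹) - c • (1 : Matrix n n ℂ) := by
      rw [smul_one_eq_diagonal, diagonal_sub]
    rw [h2, mul_sub, sub_mul, ← hMV, h1]
    simp [hV1]

theorem psd_entry {n : Type*} [Fintype n] [DecidableEq n] {Q : Matrix n n ℂ}
    (hQ : Q.PosSemidef) (i j : n) : ‖Q i j‖ ^ 2 ≤ (Q i i).re * (Q j j).re := by
  have h := (hQ.submatrix ![i, j]).det_nonneg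
  rw [det_fin_two] at h
  simp only [submatrix_apply, cons_val_zero, cons_val_one] at h
  have hji : Q j i = star (Q i j) := (hQ.1.apply i j).symm ▸ (by simp)
  have hii : (Q i i).im = 0 := by
    have := hQ.1.apply i i
    exact Complex.conj_eq_iff_im.mp this
  rw [hji, RCLike.star_def, Complex.mul_conj] at h
  have h2 := (Complex.le_def.mp h).1
  rw [Complex.sub_re, Complex.mul_re, hii, Complex.ofReal_re, Complex.normSq_eq_norm_sq] at h2
  simp at h2
  linarith

theorem psd_diag_nonneg {n : Type*} [Fintype n] [DecidableEq n] {Q : Matrix n n ℂ}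
    (hQ : Q.PosSemidef) (i : n) : 0 ≤ (Q i i).re := by
  exact (Complex.le_def.mp (hQ.diag_nonneg (i := i))).1

theorem psd_hs {n : Type*} [Fintype n] [DecidableEq n] {Q : Matrix n n ℂ}
    (hQ : Q.PosSemidef) : ∑ i, ∑ j, ‖Q i j‖ ^ 2 ≤ Q.trace.re ^ 2 := by
  have : Q.trace.re = ∑ i, (Q i i).re := by simp [Matrix.trace]
  rw [this, sq, Finset.sum_mul_sum]
  exact Finset.sum_le_sum fun i _ => Finset.sum_le_sum fun j _ => psd_entry hQ i j

theorem trace_conjTranspose_mul_self_re {m n : Type*} [Fintype m] [Fintype n] 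
    (C : Matrix m n ℂ) : (Cᴴ * C).trace.re = ∑ i, ∑ j, ‖C i j‖ ^ 2 := by
  simp only [Matrix.trace, Matrix.diag, Matrix.mul_apply, conjTranspose_apply, Complex.re_sum]
  rw [Finset.sum_comm]
  refine Finset.sum_congr rfl fun i _ => Finset.sum_congr rfl fun j _ => ?_
  rw [mul_comm, RCLike.star_def, Complex.mul_conj, Complex.ofReal_re, Complex.normSq_eq_norm_sq]

theorem trace_unitary_bound {n : Type*} [Fintype n] [DecidableEq n] (A B C U : Matrix n n ℂ)
    (hA : ∀ v, 0 ≤ (star v ⬝ᵥ A *ᵥ v).re) (hB : ∀ v, 0 ≤ (star v ⬝ᵥ B *ᵥ v).re)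
    (hC : ∀ v, ‖star v ⬝ᵥ C *ᵥ v‖ ^ 2 ≤ (star v ⬝ᵥ A *ᵥ v).re * (star v ⬝ᵥ B *ᵥ v).re)
    (hU : U * Uᴴ = 1) : ‖(U * C).trace‖ ≤ √A.trace.re * √B.trace.re := by
  obtain ⟨V, D, hV1, hV2, hD, rfl⟩ := unitary_diag U hU
  have hent : ∀ (X : Matrix n n ℂ) k, (Vᴴ * X * V) k k = star (V.col k) ⬝ᵥ X *ᵥ (V.col k) := by
    intro X k
    rw [mul_assoc, Matrix.mul_apply]
    simp [dotProduct, Matrix.mul_apply, mulVec, Matrix.col]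
  have htr : ∀ X : Matrix n n ℂ, X.trace = ∑ k, star (V.col k) ⬝ᵥ X *ᵥ (V.col k) := by
    intro X
    have : X.trace = (Vᴴ * X * V).trace := by
      rw [mul_assoc, trace_mul_comm, mul_assoc, hV1, mul_one]
    rw [this]
    exact Finset.sum_congr rfl fun k _ => hent X k
  have h1 : (V * diagonal D * Vᴴ * C).trace = ∑ k, D k * (star (V.col k) ⬝ᵥ C *ᵥ (V.col k)) := by
    rw [mul_assoc, mul_assoc, trace_mul_comm, mul_assoc]
    simp only [Matrix.trace, Matrix.diag, diagonal_mul, hent]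
  rw [h1]
  have h2 := Real.sum_sqrt_mul_sqrt_le Finset.univ (fun k => hA (V.col k)) (fun k => hB (V.col k))
  rw [htr A, htr B, Complex.re_sum, Complex.re_sum]
  refine le_trans ?_ h2
  refine (norm_sum_le _ _).trans (Finset.sum_le_sum fun k _ => ?_)
  rw [norm_mul, hD, one_mul, ← Real.sqrt_mul (hA _)]
  exact Real.le_sqrt_of_sq_le (hC _)

theorem exists_polar {n : Type*} [Fintype n] [DecidableEq n] (C : Matrix n n ℂ)
    (hC : C.det ≠ 0) : ∃ U : Matrix n n ℂ, U * Uᴴ = 1 ∧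
      ∑ i, ∑ j, ‖C i j‖ ^ 2 ≤ ‖(U * C).trace‖ ^ 2 := by
  have hpsd : (Cᴴ * C).PosSemidef := posSemidef_conjTranspose_mul_self C
  obtain ⟨V, k, hV1, hV2, hk⟩ := herm_diag _ hpsd.1
  -- P = V √k Vᴴ
  have hk2 : Vᴴ * (Cᴴ * C) * V = diagonal (fun i => (k i : ℂ)) := by
    rw [hk]
    calc _ = (Vᴴ * V) * diagonal (fun i => (k i : ℂ)) * (Vᴴ * V) := by simp only [mul_assoc]
      _ = _ := by rw [hV2]; simp
  have hk0 : ∀ i, 0 ≤ k i := by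
    intro i
    have h := psd_diag_nonneg (hpsd.conjTranspose_mul_mul_same V) i
    rw [hk2] at h
    simpa using h
  have h3 : ∀ X Y : Matrix n n ℂ, V * X * Vᴴ * (V * Y * Vᴴ) = V * (X * Y) * Vᴴ := by
    intro X Y
    calc _ = V * X * (Vᴴ * V) * Y * Vᴴ := by simp only [mul_assoc]
      _ = _ := by rw [hV2]; simp only [mul_assoc, one_mul]
  set P := V * diagonal (fun i => ((√(k i) : ℝ) : ℂ)) * Vᴴ with hP
  have hPsd : P.PosSemidef := by
    refine PosSemidef.mul_mul_conjTranspose_same ?_ V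
    rw [posSemidef_diagonal_iff]
    intro i
    exact_mod_cast Real.sqrt_nonneg _
  have hPP : P * P = Cᴴ * C := by
    rw [hP, h3, diagonal_mul_diagonal, hk]
    congr 3
    funext i
    rw [← Complex.ofReal_mul, Real.mul_self_sqrt (hk0 i)]
  have hPdet : IsUnit P.det := by
    rw [isUnit_iff_ne_zero]
    intro h
    have := congrArg det hPP
    rw [det_mul P P, h, det_mul Cᴴ C, det_conjTranspose] at this
    simp [hC] at this
  have hPh : Pᴴ = P := hPsd.1
  have hUC : P⁻¹ * Cᴴ * C = P := by
    rw [mul_assoc, ← hPP, ← mul_assoc, nonsing_inv_mul _ hPdet, one_mul]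
  refine ⟨P⁻¹ * Cᴴ, ?_, ?_⟩
  · rw [conjTranspose_mul, conjTranspose_conjTranspose, ← mul_assoc, hUC, conjTranspose_nonsing_inv,
      hPh, mul_nonsing_inv _ hPdet]
  · rw [hUC, ← trace_conjTranspose_mul_self_re, ← hPP]
    have := psd_hs hPsd
    rw [← trace_conjTranspose_mul_self_re, hPh] at this
    refine this.trans ?_
    rw [← sq_abs]
    exact pow_le_pow_left₀ (abs_nonneg _) (Complex.abs_re_le_norm _) 2

open Filter Topology in
theorem block_bound {n : Type*} [Fintype n] [DecidableEq n] (A B C : Matrix n n ℂ)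
    (hA : ∀ v, 0 ≤ (star v ⬝ᵥ A *ᵥ v).re) (hB : ∀ v, 0 ≤ (star v ⬝ᵥ B *ᵥ v).re)
    (hC : ∀ v, ‖star v ⬝ᵥ C *ᵥ v‖ ^ 2 ≤ (star v ⬝ᵥ A *ᵥ v).re * (star v ⬝ᵥ B *ᵥ v).re) :
    ∑ i, ∑ j, ‖C i j‖ ^ 2 ≤ A.trace.re * B.trace.re := by
  have htr : ∀ X : Matrix n n ℂ, (∀ v, 0 ≤ (star v ⬝ᵥ X *ᵥ v).re) → 0 ≤ X.trace.re := by
    intro X hX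
    rw [Matrix.trace, Complex.re_sum]
    refine Finset.sum_nonneg fun i _ => ?_
    have := hX (Pi.single i 1)
    simpa [Pi.star_single] using this
  set R := √A.trace.re * √B.trace.re with hR
  have hR2 : A.trace.re * B.trace.re = R ^ 2 := by
    rw [hR, mul_pow, Real.sq_sqrt (htr A hA), Real.sq_sqrt (htr B hB)]
  have hev : ∀ᶠ e : ℝ in 𝓝[>] 0, (C + (e : ℂ) • (1 : Matrix n n ℂ)).det ≠ 0 := by
    have hfin := (finite_det_add_smul C).preimage (f := ((↑) : ℝ → ℂ))
      (Complex.ofReal_injective.injOn)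
    have h1 : ∀ᶠ e : ℝ in 𝓝[≠] 0, e ∉ (Set.preimage ((↑) : ℝ → ℂ)
        {z | (C + z • (1 : Matrix n n ℂ)).det = 0}) := by
      have := (hfin.subset (Set.sdiff_subset (t := {0}))).isClosed.isOpen_compl.mem_nhds
        (x := (0:ℝ)) (by simp)
      filter_upwards [nhdsWithin_le_nhds this, self_mem_nhdsWithin] with e h1 h2 h3
      exact h1 ⟨h3, h2⟩
    exact (nhdsGT_le_nhdsNE 0) h1
  have hineq : ∀ᶠ e : ℝ in 𝓝[>] 0,
      ∑ i, ∑ j, ‖(C + (e : ℂ) • (1 : Matrix n n ℂ)) i j‖ ^ 2 ≤ (R + e * Fintype.card n) ^ 2 := by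
    filter_upwards [hev, self_mem_nhdsWithin] with e he hpos
    have hpos : 0 < e := hpos
    obtain ⟨U, hU, hle⟩ := exists_polar _ he
    refine hle.trans (pow_le_pow_left₀ (norm_nonneg _) ?_ 2)
    have h1 := trace_unitary_bound A B C U hA hB hC hU
    have h2 := trace_unitary_bound 1 1 1 U (fun v => ?_) (fun v => ?_) (fun v => ?_) hU
    · rw [mul_add, trace_add, mul_smul_comm, trace_smul]
      refine (norm_add_le _ _).trans (add_le_add h1 ?_)
      rw [norm_smul, Complex.norm_real, Real.norm_of_nonneg hpos.le]
      refine mul_le_mul_of_nonneg_left (h2.trans ?_) hpos.le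
      simp
    · simpa using (Complex.le_def.mp (dotProduct_star_self_nonneg v)).1
    · simpa using (Complex.le_def.mp (dotProduct_star_self_nonneg v)).1
    · have h0 := (Complex.le_def.mp (dotProduct_star_self_nonneg v))
      have : ‖star v ⬝ᵥ v‖ = (star v ⬝ᵥ v).re := by
        rw [← Complex.re_eq_norm.mpr (Complex.le_def.mpr h0)]
      rw [one_mulVec, this, sq]
  rw [hR2]
  have t1 : Tendsto (fun e : ℝ => ∑ i, ∑ j, ‖(C + (e : ℂ) • (1 : Matrix n n ℂ)) i j‖ ^ 2)
      (𝓝[>] 0) (𝓝 (∑ i, ∑ j, ‖C i j‖ ^ 2)) := by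
    have : Continuous (fun e : ℝ => ∑ i, ∑ j, ‖(C + (e : ℂ) • (1 : Matrix n n ℂ)) i j‖ ^ 2) := by
      simp only [Matrix.add_apply, Matrix.smul_apply]
      fun_prop
    have h := (this.tendsto 0).mono_left (nhdsWithin_le_nhds (s := Set.Ioi 0))
    simpa using h
  have t2 : Tendsto (fun e : ℝ => (R + e * Fintype.card n) ^ 2) (𝓝[>] 0) (𝓝 (R ^ 2)) := by
    have : Continuous (fun e : ℝ => (R + e * Fintype.card n) ^ 2) := by fun_prop
    have h := (this.tendsto 0).mono_left (nhdsWithin_le_nhds (s := Set.Ioi 0))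
    simpa using h
  exact le_of_tendsto_of_tendsto t1 t2 hineq

theorem witness_bound {ι κ : Type*} [Fintype ι] [Fintype κ] [DecidableEq ι] [DecidableEq κ]
    (W : Matrix (ι × κ) (ι × κ) ℂ) (hW : W.IsHermitian)
    (hpos : ∀ (x : ι → ℂ) (v : κ → ℂ),
      0 ≤ (∑ i, ∑ j, ∑ k, ∑ l, star (x i) * star (v k) * W (i, k) (j, l) * x j * v l).re) :
    ∑ p, ∑ q, ‖W p q‖ ^ 2 ≤ W.trace.re ^ 2 ∧ 0 ≤ W.trace.re := by
  let Bl : ι → ι → Matrix κ κ ℂ := fun i j => Matrix.of fun k l => W (i, k) (j, l)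
  let Q : (κ → ℂ) → Matrix ι ι ℂ := fun v => Matrix.of fun i j => star v ⬝ᵥ Bl i j *ᵥ v
  have hQ : ∀ v, (Q v).PosSemidef := by
    intro v
    have hH : (Q v).IsHermitian := by
      ext i j
      simp only [Q, Bl, conjTranspose_apply, of_apply, dotProduct, mulVec, Finset.mul_sum, star_sum,
        Pi.star_apply]
      rw [Finset.sum_comm]
      refine Finset.sum_congr rfl fun k _ => Finset.sum_congr rfl fun l _ => ?_
      rw [star_mul', star_mul', star_star, hW.apply]
      ring
    refine .of_dotProduct_mulVec_nonneg hH fun x => ?_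
    have him : (star x ⬝ᵥ Q v *ᵥ x).im = 0 := hH.im_star_dotProduct_mulVec_self x
    rw [Complex.le_def]
    refine ⟨?_, by rw [him]; rfl⟩
    have e : star x ⬝ᵥ Q v *ᵥ x =
        ∑ i, ∑ j, ∑ k, ∑ l, star (x i) * star (v k) * W (i, k) (j, l) * x j * v l := by
      simp only [Q, Bl, of_apply, dotProduct, mulVec, Finset.mul_sum, Pi.star_apply, Finset.sum_mul]
      refine Finset.sum_congr rfl fun i _ => Finset.sum_congr rfl fun j _ => 
        Finset.sum_congr rfl fun k _ => Finset.sum_congr rfl fun l _ => ?_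
      ring
    rw [e]
    exact hpos x v
  have htr : W.trace.re = ∑ i, (Bl i i).trace.re := by
    simp [Matrix.trace, Fintype.sum_prod_type, Bl]
  have hd : ∀ i v, 0 ≤ (star v ⬝ᵥ Bl i i *ᵥ v).re := fun i v => psd_diag_nonneg (hQ v) i
  constructor
  · calc ∑ p, ∑ q, ‖W p q‖ ^ 2 = ∑ i, ∑ j, ∑ k, ∑ l, ‖Bl i j k l‖ ^ 2 := by
          simp only [Fintype.sum_prod_type, Bl, of_apply]
          refine Finset.sum_congr rfl fun i _ => ?_
          rw [Finset.sum_comm]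
      _ ≤ ∑ i, ∑ j, (Bl i i).trace.re * (Bl j j).trace.re := by
          refine Finset.sum_le_sum fun i _ => Finset.sum_le_sum fun j _ => ?_
          exact block_bound _ _ _ (hd i) (hd j) fun v => psd_entry (hQ v) i j
      _ = _ := by rw [htr, sq, Finset.sum_mul_sum]
  · rw [htr]
    refine Finset.sum_nonneg fun i _ => ?_
    rw [Matrix.trace, Complex.re_sum]
    refine Finset.sum_nonneg fun k _ => ?_
    simpa [Pi.star_single] using hd i (Pi.single k 1)

theorem functional_repr {p : Type*} [Fintype p] [DecidableEq p] (f : Matrix p p ℂ →ₗ[ℝ] ℝ) :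
    ∃ W : Matrix p p ℂ, W.IsHermitian ∧ ∀ X : Matrix p p ℂ, X.IsHermitian →
      f X = (W * X).trace.re := by
  let W0 : Matrix p p ℂ := Matrix.of fun i j =>
    (f (Matrix.single j i 1) : ℂ) - Complex.I * (f (Matrix.single j i Complex.I) : ℂ)
  have h0 : ∀ X, f X = (W0 * X).trace.re := by
    intro X
    have hX : X = ∑ i, ∑ j, ((X i j).re • Matrix.single i j (1 : ℂ) +
        (X i j).im • Matrix.single i j Complex.I) := by
      conv_lhs => rw [matrix_eq_sum_single X]
      refine Finset.sum_congr rfl fun i _ => Finset.sum_congr rfl fun j _ => ?_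
      rw [smul_single, smul_single, ← single_add]
      congr 1
      simp [Complex.re_add_im]
    conv_lhs => rw [hX]
    simp only [map_sum, map_add, map_smul, smul_eq_mul]
    rw [Finset.sum_comm]
    simp only [Matrix.trace, Matrix.diag, Matrix.mul_apply, Complex.re_sum]
    refine Finset.sum_congr rfl fun i _ => Finset.sum_congr rfl fun j _ => ?_
    simp [W0]
    ring
  refine ⟨(1/2 : ℂ) • (W0 + W0ᴴ), ?_, ?_⟩
  · unfold Matrix.IsHermitian
    rw [conjTranspose_smul, conjTranspose_add, conjTranspose_conjTranspose, add_comm W0ᴴ]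
    simp
  · intro X hX
    have h1 : (W0ᴴ * X).trace = star (W0 * X).trace := by
      rw [← trace_conjTranspose, conjTranspose_mul, hX.eq, trace_mul_comm]
    rw [smul_mul_assoc, trace_smul, add_mul, trace_add, h1, h0]
    simp [← two_mul]

def prodPure {ι κ : Type*} (x : ι → ℂ) (v : κ → ℂ) : Matrix (ι × κ) (ι × κ) ℂ :=
  vecMulVec x (star x) ⊗ₖ vecMulVec v (star v)

theorem prodPure_herm {ι κ : Type*} (x : ι → ℂ) (v : κ → ℂ) : (prodPure x v).IsHermitian := by
  ext p q
  simp [prodPure, vecMulVec_apply]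
  ring

theorem prodPure_trace {ι κ : Type*} [Fintype ι] [Fintype κ] (x : ι → ℂ) (v : κ → ℂ) :
    (prodPure x v).trace = (x ⬝ᵥ star x) * (v ⬝ᵥ star v) := by
  rw [prodPure, trace_kronecker, trace_vecMulVec, trace_vecMulVec]

theorem sphere_dot {ι : Type*} [Fintype ι] (x : EuclideanSpace ℂ ι)
    (hx : x ∈ Metric.sphere (0 : EuclideanSpace ℂ ι) 1) : x.ofLp ⬝ᵥ star x.ofLp = 1 := by
  have h := inner_self_eq_norm_sq_to_K (𝕜 := ℂ) x
  rw [EuclideanSpace.inner_eq_star_dotProduct] at h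
  rw [h, mem_sphere_zero_iff_norm.mp hx]
  simp

theorem isDM_pure {ι : Type*} [Fintype ι] [DecidableEq ι] (x : EuclideanSpace ℂ ι)
    (hx : x ∈ Metric.sphere (0 : EuclideanSpace ℂ ι) 1) :
    IsDM (vecMulVec x.ofLp (star x.ofLp)) :=
  ⟨posSemidef_vecMulVec_self_star _, by rw [trace_vecMulVec, sphere_dot x hx]⟩

def pureSet (ι κ : Type*) [Fintype ι] [Fintype κ] : Set (Matrix (ι × κ) (ι × κ) ℂ) :=
  Set.image (fun p : EuclideanSpace ℂ ι × EuclideanSpace ℂ κ => prodPure p.1.ofLp p.2.ofLp)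
    (Metric.sphere 0 1 ×ˢ Metric.sphere 0 1)

theorem pureSet_compact (ι κ : Type*) [Fintype ι] [Fintype κ] : IsCompact (pureSet ι κ) := by
  refine ((isCompact_sphere _ _).prod (isCompact_sphere _ _)).image ?_
  refine continuous_matrix fun p q => ?_
  simp only [prodPure, kroneckerMap_apply, vecMulVec_apply, Pi.star_apply]
  fun_prop

theorem isSep_of_mem_hull {ι κ : Type*} [Fintype ι] [Fintype κ] [DecidableEq ι] [DecidableEq κ]
    {σ : Matrix (ι × κ) (ι × κ) ℂ} (h : σ ∈ convexHull ℝ (pureSet ι κ)) : IsSep σ := by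
  obtain ⟨T, _, w, z, hw, hw1, hz, rfl⟩ := mem_convexHull_iff_exists_fintype.mp h
  choose y hy hyz using hz
  let e := (Fintype.equivFin T).symm
  refine ⟨Fintype.card T, fun i => w (e i), fun i => vecMulVec (y (e i)).1.ofLp (star (y (e i)).1.ofLp),
    fun i => vecMulVec (y (e i)).2.ofLp (star (y (e i)).2.ofLp), fun i => hw _, ?_,
    fun i => isDM_pure _ (hy _).1, fun i => isDM_pure _ (hy _).2, ?_⟩
  · rw [← hw1]; exact Equiv.sum_comp e w
  · rw [← Equiv.sum_comp e]
    refine Finset.sum_congr rfl fun i _ => ?_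
    rw [← hyz]
    ext p q
    simp [prodPure]

theorem trace_mul_prodPure {ι κ : Type*} [Fintype ι] [Fintype κ]
    (W : Matrix (ι × κ) (ι × κ) ℂ) (x : ι → ℂ) (v : κ → ℂ) :
    (W * prodPure x v).trace =
      ∑ i, ∑ j, ∑ k, ∑ l, star (x i) * star (v k) * W (i, k) (j, l) * x j * v l := by
  simp only [Matrix.trace, Matrix.diag, Matrix.mul_apply, Fintype.sum_prod_type]
  refine Finset.sum_congr rfl fun i _ => ?_
  rw [Finset.sum_comm]
  refine Finset.sum_congr rfl fun j _ => Finset.sum_congr rfl fun k _ =>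
    Finset.sum_congr rfl fun l _ => ?_
  simp only [prodPure, kroneckerMap_apply, vecMulVec_apply, Pi.star_apply]
  ring

theorem exists_unit {ι : Type*} [Fintype ι] (x : ι → ℂ) (hx : x ≠ 0) :
    ∃ (r : ℝ) (y : EuclideanSpace ℂ ι), y ∈ Metric.sphere (0 : EuclideanSpace ℂ ι) 1 ∧
      x = (r : ℂ) • y.ofLp := by
  have h0 : WithLp.toLp 2 x ≠ 0 := by simpa using hx
  have h1 : ‖WithLp.toLp 2 x‖ ≠ 0 := norm_ne_zero_iff.mpr h0
  refine ⟨‖WithLp.toLp 2 x‖, ((‖WithLp.toLp 2 x‖ : ℂ)⁻¹) • WithLp.toLp 2 x, ?_, ?_⟩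
  · rw [mem_sphere_zero_iff_norm, norm_smul, norm_inv, Complex.norm_real, norm_norm,
      inv_mul_cancel₀ h1]
  · have h2 : (‖WithLp.toLp 2 x‖ : ℂ) ≠ 0 := by exact_mod_cast h1
    simp [smul_smul, h2]

theorem separate_hull {E : Type*} [NormedAddCommGroup E] [NormedSpace ℝ E]
    [FiniteDimensional ℝ E] {s : Set E} (hs : IsCompact s) (x : E) (hx : x ∉ convexHull ℝ s) :
    ∃ (f : E →ₗ[ℝ] ℝ) (u : ℝ), f x < u ∧ ∀ y ∈ s, u < f y := by
  have hcl : IsClosed (convexHull ℝ s) := (isCompact_convexHull_aux hs).isClosed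
  obtain ⟨f, u, h1, h2⟩ := geometric_hahn_banach_point_closed (convex_convexHull ℝ _) hcl hx
  exact ⟨f.toLinearMap, u, h1, fun y hy => h2 y (subset_convexHull ℝ _ hy)⟩

theorem gurvits_barnum {ι κ : Type*} [Fintype ι] [Fintype κ] [DecidableEq ι] [DecidableEq κ]
    (σ : Matrix (ι × κ) (ι × κ) ℂ) (hσ : σ.IsHermitian) (htr : σ.trace = 1)
    (hd : 1 < (Fintype.card (ι × κ) : ℝ))
    (hp : ∑ p, ∑ q, ‖σ p q‖ ^ 2 ≤ 1 / ((Fintype.card (ι × κ) : ℝ) - 1)) : IsSep σ := by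
  by_contra hns
  have hmem : σ ∉ convexHull ℝ (pureSet ι κ) := fun h => hns (isSep_of_mem_hull h)
  have hsep : ∃ (f : Matrix (ι × κ) (ι × κ) ℂ →ₗ[ℝ] ℝ) (u : ℝ), f σ < u ∧
      ∀ s ∈ pureSet ι κ, u < f s := by
    exact @separate_hull _ Matrix.normedAddCommGroup Matrix.normedSpace _ _
      (pureSet_compact ι κ) σ hmem
  obtain ⟨f, u, h1, h2⟩ := hsep
  let g : Matrix (ι × κ) (ι × κ) ℂ →ₗ[ℝ] ℝ :=
    f - u • (Complex.reLm ∘ₗ Matrix.traceLinearMap (ι × κ) ℝ ℂ)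
  have hg : ∀ X, g X = f X - u * X.trace.re := by
    intro X; simp [g]
  obtain ⟨W, hW, hWg⟩ := functional_repr g
  have hneg : (W * σ).trace.re < 0 := by
    rw [← hWg σ hσ, hg, htr]; simp; linarith
  have hpos : ∀ (x : ι → ℂ) (v : κ → ℂ), 0 ≤ (W * prodPure x v).trace.re := by
    intro x v
    by_cases hx : x = 0
    · subst hx; rw [trace_mul_prodPure]; simp
    by_cases hv : v = 0
    · subst hv; rw [trace_mul_prodPure]; simp
    obtain ⟨r, y, hy, rfl⟩ := exists_unit x hx
    obtain ⟨t, z, hz, rfl⟩ := exists_unit v hv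
    have e : prodPure ((r : ℂ) • y.ofLp) ((t : ℂ) • z.ofLp) =
        ((r ^ 2 * t ^ 2 : ℝ) : ℂ) • prodPure y.ofLp z.ofLp := by
      ext p q
      simp [prodPure, vecMulVec_apply]
      ring
    rw [e, mul_smul_comm, trace_smul, smul_eq_mul, Complex.re_ofReal_mul]
    refine mul_nonneg (by positivity) ?_
    rw [← hWg _ (prodPure_herm _ _), hg, prodPure_trace, sphere_dot y hy, sphere_dot z hz]
    have := h2 _ ⟨(y, z), ⟨hy, hz⟩, rfl⟩
    simp only at this
    simp
    exact this.le
  obtain ⟨hb1, hb2⟩ := witness_bound W hW (fun x v => by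
    rw [← trace_mul_prodPure]; exact hpos x v)
  set d : ℝ := (Fintype.card (ι × κ) : ℝ) with hd_def
  set c : ℝ := 1 / (d - 1) with hc
  have hc0 : 0 < c := by rw [hc]; apply one_div_pos.mpr; linarith
  set Y := σ - (c : ℂ) • (1 : Matrix (ι × κ) (ι × κ) ℂ) with hY
  have hYh : Yᴴ = Y := by
    rw [hY, conjTranspose_sub, conjTranspose_smul, hσ.eq]; simp
  have hYn : ∑ p, ∑ q, ‖Y p q‖ ^ 2 ≤ c ^ 2 := by
    rw [← trace_conjTranspose_mul_self_re, hYh]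
    have e1 : Y * Y = σᴴ * σ - (2 * c : ℂ) • σ + (c ^ 2 : ℂ) • 1 := by
      rw [hY, hσ.eq]
      simp only [sub_mul, mul_sub, smul_mul_assoc, mul_smul_comm, one_mul, mul_one, smul_sub,
        smul_smul]
      module
    rw [e1, trace_add, trace_sub, trace_smul, trace_smul, htr, Complex.add_re, Complex.sub_re,
      trace_conjTranspose_mul_self_re, trace_one]
    have e2 : ((2 * c : ℂ) • (1 : ℂ)).re = 2 * c := by simp
    have e3 : ((c ^ 2 : ℂ) • ((Fintype.card (ι × κ) : ℕ) : ℂ)).re = c ^ 2 * d := by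
      rw [hd_def, smul_eq_mul, ← Complex.ofReal_pow, Complex.re_ofReal_mul, Complex.natCast_re]
    rw [e2, e3]
    have e4 : c * (d - 1) = 1 := by rw [hc]; field_simp [show d - 1 ≠ 0 by linarith]
    nlinarith
  have hlow : -(W.trace.re * c) ≤ (W * Y).trace.re := by
    have h3 : (W * Y).trace.re ^ 2 ≤ (W.trace.re * c) ^ 2 := by
      have e : ‖(W * Y).trace‖ ≤ ∑ z : (ι × κ) × (ι × κ), ‖W z.1 z.2‖ * ‖Y z.2 z.1‖ := by
        rw [Fintype.sum_prod_type]
        simp only [Matrix.trace, Matrix.diag, Matrix.mul_apply]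
        refine (norm_sum_le _ _).trans (Finset.sum_le_sum fun i _ => ?_)
        refine (norm_sum_le _ _).trans (Finset.sum_le_sum fun j _ => ?_)
        rw [norm_mul]
      have cs := Finset.sum_mul_sq_le_sq_mul_sq (Finset.univ : Finset ((ι × κ) × (ι × κ)))
        (fun z => ‖W z.1 z.2‖) (fun z => ‖Y z.2 z.1‖)
      have s1 : ∑ z : (ι × κ) × (ι × κ), ‖W z.1 z.2‖ ^ 2 ≤ W.trace.re ^ 2 := by
        rw [Fintype.sum_prod_type]; exact hb1
      have s2 : ∑ z : (ι × κ) × (ι × κ), ‖Y z.2 z.1‖ ^ 2 ≤ c ^ 2 := by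
        rw [Fintype.sum_prod_type, Finset.sum_comm]; exact hYn
      calc (W * Y).trace.re ^ 2 = |(W * Y).trace.re| ^ 2 := (sq_abs _).symm
        _ ≤ ‖(W * Y).trace‖ ^ 2 := pow_le_pow_left₀ (abs_nonneg _) (Complex.abs_re_le_norm _) 2
        _ ≤ _ := pow_le_pow_left₀ (norm_nonneg _) e 2
        _ ≤ _ := cs
        _ ≤ W.trace.re ^ 2 * c ^ 2 := by gcongr
        _ = _ := by ring
    exact (abs_le.mp (abs_le_of_sq_le_sq h3 (by positivity))).1
  have hfin : (W * σ).trace.re = c * W.trace.re + (W * Y).trace.re := by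
    rw [hY, mul_sub, trace_sub, mul_smul_comm, mul_one, trace_smul, smul_eq_mul, Complex.sub_re,
      Complex.re_ofReal_mul]
    ring
  linarith

theorem purity_ineq (d α β P T : ℝ) (hd : 5 ≤ d)
    (h1 : -1 ≤ α + β) (h2 : α + β ≤ d / (d - 2))
    (h3 : (α - β) ^ 2 + ((d - 3) / (d - 1)) * (α + β - 2 / (d - 3)) ^ 2 ≤ 2 * (d - 2) / (d - 3))
    (hT : 0 ≤ T) (hTP : T ≤ P) (hP : P ≤ 1) :
    (d + 2 * (α + β) + (α ^ 2 + β ^ 2) * P + 2 * α * β * T) * (d - 1) ≤ (d + α + β) ^ 2 := by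
  have f00 : (d + 2 * (α + β)) * (d - 1) ≤ (d + α + β) ^ 2 := by
    nlinarith [sq_nonneg (α + β + 1)]
  have f11 : (d + 2 * (α + β) + (α + β) ^ 2) * (d - 1) ≤ (d + α + β) ^ 2 := by
    rw [le_div_iff₀ (by linarith)] at h2
    nlinarith [mul_nonneg (show 0 ≤ α + β + 1 by linarith)
      (show 0 ≤ d - (α + β) * (d - 2) by linarith)]
  have f10 : (d + 2 * (α + β) + (α ^ 2 + β ^ 2)) * (d - 1) ≤ (d + α + β) ^ 2 := by
    have d1 : 0 < d - 1 := by linarith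
    have d3 : 0 < d - 3 := by linarith
    have e : ((d - 1) * ((α - β) ^ 2 + ((d - 3) / (d - 1)) * (α + β - 2 / (d - 3)) ^ 2
        - 2 * (d - 2) / (d - 3))) =
      2 * ((d + 2 * (α + β) + (α ^ 2 + β ^ 2)) * (d - 1) - (d + α + β) ^ 2) := by
      field_simp
      ring
    have : (d - 1) * ((α - β) ^ 2 + ((d - 3) / (d - 1)) * (α + β - 2 / (d - 3)) ^ 2
        - 2 * (d - 2) / (d - 3)) ≤ 0 :=
      mul_nonpos_of_nonneg_of_nonpos d1.le (by linarith)
    linarith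
  have g00 := mul_le_mul_of_nonneg_left f00 (show 0 ≤ 1 - P by linarith)
  have g10 := mul_le_mul_of_nonneg_left f10 (show 0 ≤ P - T by linarith)
  have g11 := mul_le_mul_of_nonneg_left f11 hT
  nlinarith

theorem stmt16 (m n : ℕ) (hm : 2 ≤ m) (hn : 2 ≤ n) (h5 : 5 ≤ m * n) (α β : ℝ)
    (hα : 0 ≤ 1 + α) (hβ : 0 ≤ 1 + β) (hαβ : 0 ≤ 1 + α + β)
    (h1 : -1 ≤ α + β) (h2 : α + β ≤ (m : ℝ) * n / ((m : ℝ) * n - 2))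
    (h3 : (α - β) ^ 2 +
        (((m : ℝ) * n - 3) / ((m : ℝ) * n - 1)) * (α + β - 2 / ((m : ℝ) * n - 3)) ^ 2 ≤
      2 * ((m : ℝ) * n - 2) / ((m : ℝ) * n - 3)) :
    ∀ ρ : Matrix (Fin m × Fin n) (Fin m × Fin n) ℂ, IsDM ρ →
      IsAbsSep (ctitMap α β ρ) := by
  intro ρ hρ U hU
  obtain ⟨hρ, htr⟩ := hρ
  have hU2 : Uᴴ * U = 1 := mul_eq_one_comm.mp hU
  have hcard : (Fintype.card (Fin m × Fin n) : ℝ) = (m : ℝ) * n := by simp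
  have hd : (5 : ℝ) ≤ (m : ℝ) * n := by exact_mod_cast h5
  set d : ℝ := (m : ℝ) * n with hd_def
  have hN : 0 < d + α + β := by linarith
  set N : ℝ := d + α + β with hN_def
  have hNc : (N : ℂ) ≠ 0 := by exact_mod_cast hN.ne'
  set X := (1 : Matrix (Fin m × Fin n) (Fin m × Fin n) ℂ) + (α : ℂ) • ρ + (β : ℂ) • ρᵀ with hX
  have hΦ : ctitMap α β ρ = ((N : ℂ)⁻¹) • X := by
    simp only [ctitMap, hcard]
    simp [transposeLM, htr, hX, hN_def]
  have hρT : ρᵀ.PosSemidef := hρ.transpose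
  have hXh : Xᴴ = X := by
    rw [hX]
    simp [conjTranspose_add, conjTranspose_smul, hρ.1.eq, hρT.1.eq]
  have hXtr : X.trace = N := by
    rw [hX, trace_add, trace_add, trace_smul, trace_smul, trace_transpose, htr, trace_one]
    rw [hN_def, ← hcard]
    push_cast
    simp
  rw [hΦ]
  have hσh : (U * ((N : ℂ)⁻¹ • X) * Uᴴ).IsHermitian := by
    refine isHermitian_mul_mul_conjTranspose U ?_
    unfold Matrix.IsHermitian
    rw [conjTranspose_smul, hXh]
    simp
  refine gurvits_barnum _ hσh ?_ (by rw [hcard]; linarith) ?_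
  · rw [mul_assoc, trace_mul_comm, mul_assoc, hU2, mul_one, trace_smul, hXtr, smul_eq_mul,
      inv_mul_cancel₀ hNc]
  rw [hcard, ← trace_conjTranspose_mul_self_re, hσh.eq]
  have hsq : (U * ((N : ℂ)⁻¹ • X) * Uᴴ * (U * ((N : ℂ)⁻¹ • X) * Uᴴ)).trace =
      (((N ^ 2)⁻¹ : ℝ) : ℂ) * (X * X).trace := by
    have : U * ((N : ℂ)⁻¹ • X) * Uᴴ * (U * ((N : ℂ)⁻¹ • X) * Uᴴ) =
        U * (((N : ℂ)⁻¹ • X) * ((N : ℂ)⁻¹ • X) * Uᴴ) := by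
      calc _ = U * ((N : ℂ)⁻¹ • X) * (Uᴴ * U) * (((N : ℂ)⁻¹ • X) * Uᴴ) := by
            simp only [mul_assoc]
        _ = _ := by rw [hU2]; simp only [mul_assoc, one_mul, mul_one]
    rw [this, trace_mul_comm, mul_assoc, hU2, mul_one, smul_mul_smul_comm, trace_smul, smul_eq_mul]
    push_cast
    rw [sq, mul_inv]
  rw [hsq, Complex.re_ofReal_mul]
  set P := (ρ * ρ).trace.re with hP
  set T := (ρ * ρᵀ).trace.re with hT
  have hXX : (X * X).trace.re = d + 2 * (α + β) + (α ^ 2 + β ^ 2) * P + 2 * α * β * T := by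
    have e : X * X = 1 + (2 * α : ℂ) • ρ + (2 * β : ℂ) • ρᵀ + ((α ^ 2 : ℝ) : ℂ) • (ρ * ρ)
        + ((β ^ 2 : ℝ) : ℂ) • (ρᵀ * ρᵀ) + ((α * β : ℝ) : ℂ) • (ρ * ρᵀ)
        + ((α * β : ℝ) : ℂ) • (ρᵀ * ρ) := by
      rw [hX]
      simp only [add_mul, mul_add, smul_mul_assoc, mul_smul_comm, one_mul, mul_one, smul_add,
        smul_smul]
      push_cast
      module
    have e2 : (ρᵀ * ρᵀ).trace = (ρ * ρ).trace := by
      rw [← transpose_mul, trace_transpose]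
    have e1 : ((Fintype.card (Fin m × Fin n) : ℕ) : ℂ).re = d := by
      rw [Complex.natCast_re, hcard]
    have e3 : (2 * α : ℂ).re = 2 * α := by simp
    have e4 : (2 * β : ℂ).re = 2 * β := by simp
    rw [e]
    simp only [trace_add, trace_smul, smul_eq_mul, Complex.add_re, Complex.re_ofReal_mul, e2,
      trace_mul_comm ρᵀ ρ, trace_transpose, htr, trace_one, mul_one, e1, e3, e4]
    rw [← hP, ← hT]
    ring
  have hPs : P = ∑ i, ∑ j, ‖ρ i j‖ ^ 2 := by
    rw [← trace_conjTranspose_mul_self_re, hρ.1.eq]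
  have hP1 : P ≤ 1 := by
    have := psd_hs hρ
    rw [← hPs, htr] at this
    simpa using this
  have hTP : T ≤ P := by
    rw [hPs, hT]
    refine (Complex.re_le_norm _).trans ?_
    simp only [Matrix.trace, Matrix.diag, Matrix.mul_apply, transpose_apply]
    refine (norm_sum_le _ _).trans (Finset.sum_le_sum fun i _ => ?_)
    refine (norm_sum_le _ _).trans (Finset.sum_le_sum fun j _ => ?_)
    rw [norm_mul, sq]
  have hT0 : 0 ≤ T := by
    obtain ⟨V, k, hV1, hV2, hk⟩ := herm_diag ρ hρ.1
    have hk2 : Vᴴ * ρ * V = diagonal (fun i => (k i : ℂ)) := by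
      rw [hk]
      calc _ = (Vᴴ * V) * diagonal (fun i => (k i : ℂ)) * (Vᴴ * V) := by simp only [mul_assoc]
        _ = _ := by rw [hV2]; simp
    have hk0 : ∀ i, 0 ≤ k i := by
      intro i
      have h := psd_diag_nonneg (hρ.conjTranspose_mul_mul_same V) i
      rw [hk2] at h
      simpa using h
    have e : (ρ * ρᵀ).trace = (diagonal (fun i => (k i : ℂ)) * (Vᴴ * ρᵀ * V)).trace := by
      conv_lhs => rw [show ρ * ρᵀ = V * diagonal (fun i => (k i : ℂ)) * Vᴴ * ρᵀ by rw [← hk]]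
      rw [mul_assoc, mul_assoc, trace_mul_comm]
      simp only [mul_assoc]
    rw [hT, e]
    simp only [Matrix.trace, Matrix.diag, diagonal_mul, Complex.re_sum, Complex.re_ofReal_mul]
    exact Finset.sum_nonneg fun i _ =>
      mul_nonneg (hk0 i) (psd_diag_nonneg (hρT.conjTranspose_mul_mul_same V) i)
  have key := purity_ineq d α β P T hd h1 h2 h3 hT0 hTP hP1
  rw [hXX, inv_mul_eq_div, div_le_div_iff₀ (by positivity) (by linarith), one_mul]
  exact key

end
end

section
/- Let n ≥ 2 and let α, β be real numbers with 1+α ≥ 0, 1+β ≥ 0, 1+α+β ≥ 0, and define the trace-preserving map Φ_{αβ} on 2n×2n complex matrices by Φ_{αβ}[X] = (tr(X)·I_{2n} + αX + βX^⊤)/(2n + α + β). Then Φ_{αβ} is absolutely separating with respect to the bipartition 2|n if and only if one of the following holds: (i) α ≥ 0, β ≥ 0, and α + β ≤ 2; (ii) α ≥ 0 and α² − 4 ≤ 4β < 0; (iii) β ≥ 0 and β² − 4 ≤ 4α < 0; (iv) α < 0, β < 0, and α + β ≥ −1. -/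
open Matrix Kronecker BigOperators
open scoped ComplexOrder

noncomputable section


lemma h_lower (p q p' q' : ℂ) (c d t : ℝ) (hd : 0 ≤ d) (ht : 0 ≤ t) :
    -(t * d) * (Complex.normSq p + Complex.normSq q + Complex.normSq p' + Complex.normSq q')
      ≤ Complex.normSq p + t ^ 2 * Complex.normSq (c * p' + d * q')
        + 2 * t * ((c * p + d * q) * star p').re := by
  have h1 := Complex.normSq_nonneg (p + t * (c * p' + d * q'))
  have h2 := mul_nonneg (mul_nonneg ht hd) (Complex.normSq_nonneg (q + p'))
  have h3 := mul_nonneg (mul_nonneg ht hd) (Complex.normSq_nonneg (p - q'))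
  simp [Complex.normSq_apply] at *
  nlinarith

lemma h_upper (p q p' q' : ℂ) (c d t C : ℝ) (hcd : c ^ 2 + d ^ 2 = 1)
    (h1 : 1 ≤ C) (h2 : t ^ 2 ≤ C) (h3 : (C - 1) * (C - t ^ 2) = t ^ 2 * c ^ 2) :
    Complex.normSq p + t ^ 2 * Complex.normSq (c * p' + d * q')
        + 2 * t * ((c * p + d * q) * star p').re
     ≤ C * (Complex.normSq p + Complex.normSq q + Complex.normSq p' + Complex.normSq q') := by
  have key : ∀ a b : ℝ, 2 * t * c * a * b ≤ (C - 1) * a ^ 2 + (C - t ^ 2) * b ^ 2 := by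
    intro a b
    rcases eq_or_lt_of_le h1 with h | h
    · have : t * c = 0 := by
        have : (t * c) ^ 2 = 0 := by rw [mul_pow, ← h3, ← h]; ring
        exact pow_eq_zero_iff (two_ne_zero) |>.1 this
      have e : 2 * t * c * a * b = 2 * (t * c) * a * b := by ring
      rw [e, this, ← h]
      nlinarith [mul_nonneg (sub_nonneg.2 h2) (sq_nonneg b)]
    · have hpos : 0 < C - 1 := by linarith
      have : 0 ≤ (C - 1) * ((C - 1) * a ^ 2 + (C - t ^ 2) * b ^ 2 - 2 * t * c * a * b) := by
        have : (C - 1) * ((C - 1) * a ^ 2 + (C - t ^ 2) * b ^ 2 - 2 * t * c * a * b)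
          = ((C - 1) * a - t * c * b) ^ 2 := by linear_combination b ^ 2 * h3
        rw [this]; positivity
      have := nonneg_of_mul_nonneg_right this hpos
      linarith
  have n := Complex.normSq_nonneg (t * d * p' - (q + t * c * q'))
  have k1 := key p.re p'.re
  have k2 := key p.im p'.im
  have k3 := key q.re q'.re
  have k4 := key q.im q'.im
  have hd : d ^ 2 = 1 - c ^ 2 := by linarith
  simp [Complex.normSq_apply] at *
  have e : ∀ z : ℝ, t ^ 2 * d ^ 2 * z = t ^ 2 * z - t ^ 2 * c ^ 2 * z := by
    intro z; rw [hd]; ring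
  have e1 := e (p'.re ^ 2)
  have e2 := e (p'.im ^ 2)
  have e3 := e (q'.re ^ 2)
  have e4 := e (q'.im ^ 2)
  nlinarith

lemma exists_C (c d t : ℝ) (hcd : c ^ 2 + d ^ 2 = 1) :
    ∃ C : ℝ, 1 ≤ C ∧ t ^ 2 ≤ C ∧ (C - 1) * (C - t ^ 2) = t ^ 2 * c ^ 2 ∧ C ≤ 1 + t ^ 2 ∧
      C * (1 + t ^ 2 - C) = (t * d) ^ 2 := by
  set D := √((1 - t ^ 2) ^ 2 + 4 * t ^ 2 * c ^ 2) with hD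
  have hD2 : D ^ 2 = (1 - t ^ 2) ^ 2 + 4 * t ^ 2 * c ^ 2 := Real.sq_sqrt (by positivity)
  have hD0 : 0 ≤ D := Real.sqrt_nonneg _
  have hDabs : |1 - t ^ 2| ≤ D := by
    apply abs_le_of_sq_le_sq _ hD0
    rw [hD2]; nlinarith [mul_nonneg (sq_nonneg t) (sq_nonneg c)]
  have hDu : D ≤ 1 + t ^ 2 := by
    apply abs_le_of_sq_le_sq' _ (by positivity) |>.2
    rw [hD2]; nlinarith [mul_nonneg (sq_nonneg t) (sq_nonneg d)]
  have := abs_le.1 hDabs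
  refine ⟨(1 + t ^ 2 + D) / 2, by linarith, by linarith, ?_, by linarith, ?_⟩
  · nlinarith
  · have hd : d ^ 2 = 1 - c ^ 2 := by linarith
    rw [mul_pow, hd]; nlinarith

lemma scalar_final (α γ k C N : ℝ) (hαγ : α ^ 2 ≤ 4 * (1 - γ))
   (hC : 0 ≤ C) (hCN : C ≤ N) (hkC : C * (N - C) = k ^ 2) :
    0 ≤ N - α * k - γ * C := by
  have h1 : 0 ≤ 1 - γ := by nlinarith
  have : α * k ≤ (N - C) + (1 - γ) * C := by
    apply abs_le_of_sq_le_sq' _ (by nlinarith [mul_nonneg h1 hC]) |>.2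
    have : (α * k) ^ 2 ≤ 4 * (1 - γ) * (C * (N - C)) := by
      rw [mul_pow, hkC]; nlinarith [sq_nonneg k]
    nlinarith [sq_nonneg ((N - C) - (1 - γ) * C)]
  linarith



section key
variable {E : Type*} [NormedAddCommGroup E] [InnerProductSpace ℂ E]

def qf (α γ : ℝ) (a b x : E) : ℝ :=
  ‖x‖ ^ 2 + α * ‖inner ℂ a x‖ ^ 2 - γ * ‖inner ℂ b x‖ ^ 2

def sf (α γ : ℝ) (a1 a2 b1 b2 v w : E) : ℂ :=
  α * (inner ℂ v a1 * inner ℂ a2 w) - γ * (inner ℂ v b1 * inner ℂ b2 w)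

lemma perp_exists (x v : E) (c d : ℝ) (hx : ‖x‖ = 1) (hv : ‖v‖ = 1) (h : inner ℂ x v = (c : ℂ))
    (hcd : c ^ 2 + d ^ 2 = 1) :
    ∃ z : E, ‖z‖ ≤ 1 ∧ inner ℂ x z = 0 ∧ v = (c : ℂ) • x + (d : ℂ) • z := by
  have hxx : inner ℂ x x = (1 : ℂ) := by rw [inner_self_eq_norm_sq_to_K, hx]; simp
  have hn : ‖v - (c : ℂ) • x‖ ^ 2 = d ^ 2 := by
    rw [@norm_sub_sq ℂ, inner_smul_right, ← inner_conj_symm v x, h, norm_smul, hx, hv]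
    simp
    linear_combination -hcd
  refine ⟨(d : ℂ)⁻¹ • (v - (c : ℂ) • x), ?_, ?_, ?_⟩
  · rw [norm_smul]
    have : ‖v - (c : ℂ) • x‖ = |d| := by
      rw [← abs_of_nonneg (norm_nonneg (v - (c : ℂ) • x))]
      exact (sq_eq_sq_iff_abs_eq_abs _ _).1 hn
    rw [this]; simp
    exact inv_mul_le_one
  · simp [h, hx]
  · by_cases hd : d = 0
    · subst hd
      have : v - (c : ℂ) • x = 0 := by simpa using hn
      simp; exact sub_eq_zero.1 this
    · have : (d : ℂ) ≠ 0 := by exact_mod_cast hd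
      rw [smul_smul, mul_inv_cancel₀ this]; simp

lemma bessel2 (x z a : E) (hx : ‖x‖ = 1) (hz : ‖z‖ ≤ 1) (h : inner ℂ x z = (0 : ℂ)) :
    Complex.normSq (inner ℂ x a) + Complex.normSq (inner ℂ z a) ≤ ‖a‖ ^ 2 := by
  have hxx : inner ℂ x x = (1 : ℂ) := by rw [inner_self_eq_norm_sq_to_K, hx]; simp
  have hzx : inner ℂ z x = (0 : ℂ) := by rw [← inner_conj_symm, h]; simp
  set p : ℂ := inner ℂ x a with hp
  set q : ℂ := inner ℂ z a with hq
  have hax : inner ℂ a x = (starRingEnd ℂ) p := by rw [hp, inner_conj_symm]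
  have haz : inner ℂ a z = (starRingEnd ℂ) q := by rw [hq, inner_conj_symm]
  have h0 : 0 ≤ ‖a - p • x - q • z‖ ^ 2 := by positivity
  have e1 : ‖a - p • x‖ ^ 2 = ‖a‖ ^ 2 - Complex.normSq p := by
    rw [@norm_sub_sq ℂ, inner_smul_right, hax, norm_smul, hx, Complex.mul_conj,
      Complex.normSq_eq_norm_sq]
    simp [← Complex.ofReal_pow]; ring
  rw [@norm_sub_sq ℂ, e1, inner_smul_right, inner_sub_left, haz, inner_smul_left, h, norm_smul,
    mul_zero, sub_zero, Complex.mul_conj, mul_pow, ← Complex.normSq_eq_norm_sq] at h0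
  simp at h0
  have : Complex.normSq q * ‖z‖ ^ 2 ≤ Complex.normSq q * 1 := by
    apply mul_le_mul_of_nonneg_left _ (Complex.normSq_nonneg _)
    exact pow_le_one₀ (norm_nonneg _) hz
  linarith

lemma key0 (α γ : ℝ) (hα : 0 ≤ α) (hγ : 0 ≤ γ) (hαγ : α ^ 2 ≤ 4 * (1 - γ))
    (a1 a2 b1 b2 x y v w : E) (ha : ‖a1‖ ^ 2 + ‖a2‖ ^ 2 ≤ 1) (hb : ‖b1‖ ^ 2 + ‖b2‖ ^ 2 ≤ 1)
    (hx : ‖x‖ = 1) (hy : ‖y‖ = 1) (hv : ‖v‖ = 1) (hw : ‖w‖ = 1)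
    (c : ℝ) (hxv : inner ℂ x v = (c : ℂ)) (hwy : inner ℂ w y = (c : ℂ)) (t : ℝ) (ht : 0 ≤ t) :
    0 ≤ qf α γ a1 b1 x + t ^ 2 * qf α γ a2 b2 y + 2 * t * (sf α γ a1 a2 b1 b2 v w).re := by
  have hc1 : c ^ 2 ≤ 1 := by
    have := norm_inner_le_norm (𝕜 := ℂ) x v
    rw [hxv, hx, hv] at this
    simp at this
    exact (sq_le_one_iff_abs_le_one c).2 this
  set d := √(1 - c ^ 2) with hd
  have hd0 : 0 ≤ d := Real.sqrt_nonneg _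
  have hcd : c ^ 2 + d ^ 2 = 1 := by rw [hd, Real.sq_sqrt (by linarith)]; ring
  obtain ⟨x', hx'1, hx'0, hx'⟩ := perp_exists x v c d hx hv hxv hcd
  obtain ⟨w', hw'1, hw'0, hw'⟩ := perp_exists w y c d hw hy hwy hcd
  obtain ⟨C, hC1, hC2, hC3, hC4, hC5⟩ := exists_C c d t hcd
  have hfin := scalar_final α γ (t * d) C (1 + t ^ 2) hαγ (by linarith) hC4 hC5
  have form : ∀ a1 a2 : E, ‖a1‖ ^ 2 + ‖a2‖ ^ 2 ≤ 1 →
      - (t * d) ≤ ‖inner ℂ a1 x‖ ^ 2 + t ^ 2 * ‖inner ℂ a2 y‖ ^ 2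
          + 2 * t * (inner ℂ v a1 * inner ℂ a2 w).re ∧
      ‖inner ℂ a1 x‖ ^ 2 + t ^ 2 * ‖inner ℂ a2 y‖ ^ 2
          + 2 * t * (inner ℂ v a1 * inner ℂ a2 w).re ≤ C := by
    intro a1 a2 ha
    have r1 : ‖inner ℂ a1 x‖ ^ 2 = Complex.normSq (inner ℂ x a1) := by
      rw [norm_inner_symm, Complex.normSq_eq_norm_sq]
    have r2 : ‖inner ℂ a2 y‖ ^ 2 = Complex.normSq (c * inner ℂ w a2 + d * inner ℂ w' a2) := by
      rw [norm_inner_symm, Complex.normSq_eq_norm_sq, hw', inner_add_left, inner_smul_left,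
        inner_smul_left]
      simp
    have r3 : (inner ℂ v a1 : ℂ) = c * inner ℂ x a1 + d * inner ℂ x' a1 := by
      rw [hx', inner_add_left, inner_smul_left, inner_smul_left]
      simp
    have r4 : (inner ℂ a2 w : ℂ) = star (inner ℂ w a2) := (inner_conj_symm a2 w).symm
    rw [r1, r2, r3, r4]
    have hB1 := bessel2 x x' a1 hx hx'1 hx'0
    have hB2 := bessel2 w w' a2 hw hw'1 hw'0
    set p : ℂ := inner ℂ x a1
    set q : ℂ := inner ℂ x' a1
    set p' : ℂ := inner ℂ w a2
    set q' : ℂ := inner ℂ w' a2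
    have S : Complex.normSq p + Complex.normSq q + Complex.normSq p' + Complex.normSq q' ≤ 1 := by
      linarith
    constructor
    · refine le_trans ?_ (h_lower p q p' q' c d t hd0 ht)
      nlinarith [mul_nonneg ht hd0]
    · refine le_trans (h_upper p q p' q' c d t C hcd hC1 hC2 hC3) ?_
      nlinarith
  have fa := (form a1 a2 ha).1
  have fb := (form b1 b2 hb).2
  have e : qf α γ a1 b1 x + t ^ 2 * qf α γ a2 b2 y + 2 * t * (sf α γ a1 a2 b1 b2 v w).re
     = 1 + t ^ 2 + α * (‖inner ℂ a1 x‖ ^ 2 + t ^ 2 * ‖inner ℂ a2 y‖ ^ 2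
          + 2 * t * (inner ℂ v a1 * inner ℂ a2 w).re) - γ * (‖inner ℂ b1 x‖ ^ 2
          + t ^ 2 * ‖inner ℂ b2 y‖ ^ 2 + 2 * t * (inner ℂ v b1 * inner ℂ b2 w).re) := by
    have : (sf α γ a1 a2 b1 b2 v w).re = α * (inner ℂ v a1 * inner ℂ a2 w).re
        - γ * (inner ℂ v b1 * inner ℂ b2 w).re := by
      unfold sf
      rw [Complex.sub_re, Complex.re_ofReal_mul, Complex.re_ofReal_mul]
    rw [this]; unfold qf; rw [hx, hy]; ring
  rw [e]
  have g1 := mul_le_mul_of_nonneg_left fa hα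
  have g2 := mul_le_mul_of_nonneg_left fb hγ
  linarith

lemma qf_nonneg (α γ : ℝ) (hα : 0 ≤ α) (hαγ : α ^ 2 ≤ 4 * (1 - γ))
    (a b x : E) (hb : ‖b‖ ^ 2 ≤ 1) : 0 ≤ qf α γ a b x := by
  have h1 : γ ≤ 1 := by nlinarith
  have := norm_inner_le_norm (𝕜 := ℂ) b x
  have h2 : ‖inner ℂ b x‖ ^ 2 ≤ ‖x‖ ^ 2 := by
    calc ‖inner ℂ b x‖ ^ 2 ≤ (‖b‖ * ‖x‖) ^ 2 := by gcongr
      _ = ‖b‖ ^ 2 * ‖x‖ ^ 2 := by ring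
      _ ≤ 1 * ‖x‖ ^ 2 := by gcongr
      _ = _ := one_mul _
  unfold qf
  have : 0 ≤ α * ‖inner ℂ a x‖ ^ 2 := by positivity
  have : γ * ‖inner ℂ b x‖ ^ 2 ≤ 1 * ‖x‖ ^ 2 := by gcongr
  linarith

lemma qf_smul (α γ : ℝ) (a b x : E) (z : ℂ) : qf α γ a b (z • x) = ‖z‖ ^ 2 * qf α γ a b x := by
  unfold qf; simp only [inner_smul_right, norm_smul, norm_mul]; ring

lemma phase_exists (z : ℂ) : ∃ u : ℂ, ‖u‖ = 1 ∧ u * z = (‖z‖ : ℂ) := by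
  by_cases h : z = 0
  · exact ⟨1, by simp, by simp [h]⟩
  · have hz : (‖z‖ : ℂ) ≠ 0 := by simpa using h
    refine ⟨(starRingEnd ℂ) z / ‖z‖, ?_, ?_⟩
    · have : ‖z‖ ≠ 0 := by simpa using h
      simp [this]
    · rw [div_mul_eq_mul_div, mul_comm, Complex.mul_conj, Complex.normSq_eq_norm_sq]
      field_simp
      push_cast; ring

lemma key1 (α γ : ℝ) (hα : 0 ≤ α) (hγ : 0 ≤ γ) (hαγ : α ^ 2 ≤ 4 * (1 - γ))
    (a1 a2 b1 b2 x y v w : E) (ha : ‖a1‖ ^ 2 + ‖a2‖ ^ 2 ≤ 1) (hb : ‖b1‖ ^ 2 + ‖b2‖ ^ 2 ≤ 1)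
    (hx : ‖x‖ = 1) (hy : ‖y‖ = 1) (hv : ‖v‖ = 1) (hw : ‖w‖ = 1)
    (h : ‖inner ℂ x v‖ = ‖inner ℂ w y‖) :
    ‖sf α γ a1 a2 b1 b2 v w‖ ^ 2 ≤ qf α γ a1 b1 x * qf α γ a2 b2 y := by
  have q1 := qf_nonneg α γ hα hαγ a1 b1 x (by nlinarith [sq_nonneg ‖b2‖])
  have q2 := qf_nonneg α γ hα hαγ a2 b2 y (by nlinarith [sq_nonneg ‖b1‖])
  obtain ⟨u, hu, hus⟩ := phase_exists (sf α γ a1 a2 b1 b2 v w)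
  have es : sf α γ a1 a2 b1 b2 ((-(starRingEnd ℂ) u) • v) w
      = - (‖sf α γ a1 a2 b1 b2 v w‖ : ℂ) := by
    rw [← hus]; unfold sf; simp only [inner_smul_left, map_neg, Complex.conj_conj]; ring
  set v' := (-(starRingEnd ℂ) u) • v with hv'd
  have hv' : ‖v'‖ = 1 := by rw [hv'd, norm_smul, hv]; simp [hu]
  obtain ⟨ux, hux, huxs⟩ := phase_exists (inner ℂ x v')
  obtain ⟨uy, huy, huys⟩ := phase_exists (inner ℂ w y)
  have hc : ‖inner ℂ x v'‖ = ‖inner ℂ w y‖ := by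
    rw [← h, hv'd, inner_smul_right, norm_mul]; simp [hu]
  have main : ∀ t : ℝ, 0 ≤ t → 0 ≤ qf α γ a1 b1 x + t ^ 2 * qf α γ a2 b2 y
      - 2 * t * ‖sf α γ a1 a2 b1 b2 v w‖ := by
    intro t ht
    have := key0 α γ hα hγ hαγ a1 a2 b1 b2 (((starRingEnd ℂ) ux) • x) (uy • y) v' w ha hb
      (by rw [norm_smul, hx]; simp [hux]) (by rw [norm_smul, hy, huy]; simp) hv' hw
      ‖inner ℂ w y‖ (by rw [inner_smul_left, Complex.conj_conj, huxs, hc])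
      (by rw [inner_smul_right, huys]) t ht
    rw [es, qf_smul, qf_smul, huy] at this
    simp [hux] at this
    linarith
  have main2 : ∀ t : ℝ, 0 ≤ qf α γ a2 b2 y * (t * t)
      + (- 2 * ‖sf α γ a1 a2 b1 b2 v w‖) * t + qf α γ a1 b1 x := by
    intro t
    rcases le_total 0 t with ht | ht
    · have := main t ht; nlinarith
    · have := mul_nonneg q2 (mul_self_nonneg t)
      have := mul_nonneg (neg_nonneg.2 ht) (norm_nonneg (sf α γ a1 a2 b1 b2 v w))
      nlinarith
  have := discrim_le_zero main2
  unfold discrim at this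
  nlinarith
end key



section topo
variable {E : Type*} [NormedAddCommGroup E] [InnerProductSpace ℂ E]

lemma zero_comb {V : Type*} [AddCommGroup V] [Module ℂ V] (F : V → ℝ) (h0 : ∀ x, 0 ≤ F x)
    (hp : ∀ x y, F (x + y) + F (x - y) = 2 * F x + 2 * F y)
    (hs : ∀ (s : ℝ) x, F ((s : ℂ) • x) = s ^ 2 * F x) (x y : V) (hx : F x = 0) (hy : F y = 0)
    (s t : ℝ) : F ((s : ℂ) • x + (t : ℂ) • y) = 0 := by
  have h1 := hp ((s : ℂ) • x) ((t : ℂ) • y)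
  rw [hs, hs, hx, hy] at h1
  have h2 := h0 ((s : ℂ) • x + (t : ℂ) • y)
  have h3 := h0 ((s : ℂ) • x - (t : ℂ) • y)
  linarith

lemma qf_para (α γ : ℝ) (a b x y : E) :
    qf α γ a b (x + y) + qf α γ a b (x - y) = 2 * qf α γ a b x + 2 * qf α γ a b y := by
  unfold qf
  have h1 := parallelogram_law_with_norm ℂ x y
  have h2 := parallelogram_law_with_norm ℂ (inner ℂ a x) (inner ℂ a y)
  have h3 := parallelogram_law_with_norm ℂ (inner ℂ b x) (inner ℂ b y)
  simp only [inner_add_right, inner_sub_right]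
  linear_combination h1 + α * h2 - γ * h3

lemma sf_para (α γ : ℝ) (a1 a2 b1 b2 v w v' w' : E) :
    sf α γ a1 a2 b1 b2 (v + v') (w + w') + sf α γ a1 a2 b1 b2 (v - v') (w - w')
     = 2 * sf α γ a1 a2 b1 b2 v w + 2 * sf α γ a1 a2 b1 b2 v' w' := by
  unfold sf
  simp only [inner_add_right, inner_sub_right, inner_add_left, inner_sub_left]
  ring

lemma sf_smul (α γ : ℝ) (a1 a2 b1 b2 v w : E) (s t : ℂ) :
    sf α γ a1 a2 b1 b2 (s • v) (t • w) = (starRingEnd ℂ) s * t * sf α γ a1 a2 b1 b2 v w := by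
  unfold sf
  simp only [inner_smul_left, inner_smul_right]
  ring

lemma unit_of (x : E) (hx : x ≠ 0) : ‖((‖x‖⁻¹ : ℝ) : ℂ) • x‖ = 1 := by
  have : ‖x‖ ≠ 0 := by simpa using hx
  rw [norm_smul]; simp [this]

lemma qf_min_ext (α γ : ℝ) (a b : E) (m : ℝ) (h : ∀ x, ‖x‖ = 1 → m ≤ qf α γ a b x) (x : E) :
    m * ‖x‖ ^ 2 ≤ qf α γ a b x := by
  by_cases hx : x = 0
  · simp [hx, qf]
  · have h1 := h _ (unit_of x hx)
    have hn : 0 < ‖x‖ := by simpa using hx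
    rw [qf_smul] at h1
    simp at h1
    have := mul_le_mul_of_nonneg_left h1 (sq_nonneg ‖x‖)
    field_simp at this
    linarith

lemma sf_max_ext (α γ : ℝ) (a1 a2 b1 b2 : E) (r : ℝ)
    (h : ∀ v w, ‖v‖ = 1 → ‖w‖ = 1 → (sf α γ a1 a2 b1 b2 v w).re ≤ r) (v w : E) :
    (sf α γ a1 a2 b1 b2 v w).re ≤ r * (‖v‖ * ‖w‖) := by
  by_cases hv : v = 0
  · simp [hv, sf]
  by_cases hw : w = 0
  · simp [hw, sf]
  have h1 := h _ _ (unit_of v hv) (unit_of w hw)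
  have hnv : 0 < ‖v‖ := by simpa using hv
  have hnw : 0 < ‖w‖ := by simpa using hw
  rw [sf_smul, Complex.conj_ofReal, ← Complex.ofReal_mul, Complex.re_ofReal_mul] at h1
  have := mul_le_mul_of_nonneg_left h1 (mul_pos hnv hnw).le
  field_simp at this
  linarith

lemma sf_norm_ext (α γ : ℝ) (a1 a2 b1 b2 : E) (r : ℝ)
    (h : ∀ v w, ‖v‖ = 1 → ‖w‖ = 1 → (sf α γ a1 a2 b1 b2 v w).re ≤ r) (v w : E) :
    ‖sf α γ a1 a2 b1 b2 v w‖ ≤ r * (‖v‖ * ‖w‖) := by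
  obtain ⟨u, hu, hus⟩ := phase_exists (sf α γ a1 a2 b1 b2 v w)
  have := sf_max_ext α γ a1 a2 b1 b2 r h (((starRingEnd ℂ) u) • v) ((1 : ℂ) • w)
  rw [sf_smul, Complex.conj_conj, mul_one, hus, norm_smul, norm_smul] at this
  simpa [hu] using this

lemma sign_exists (r : ℝ) : ∃ e : ℝ, e ^ 2 = 1 ∧ 0 ≤ e * r := by
  rcases le_total 0 r with h | h
  · exact ⟨1, by norm_num, by linarith⟩
  · exact ⟨-1, by norm_num, by linarith⟩

lemma path_norm (x0 x1 : E) (e s : ℝ) :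
    ‖((1 - s : ℝ) : ℂ) • x0 + ((s * e : ℝ) : ℂ) • x1‖ ^ 2 = (1 - s) ^ 2 * ‖x0‖ ^ 2
      + s ^ 2 * e ^ 2 * ‖x1‖ ^ 2 + 2 * (s * (1 - s)) * (e * (inner ℂ x0 x1 : ℂ).re) := by
  rw [@norm_add_sq ℂ, inner_smul_left, inner_smul_right, norm_smul, norm_smul,
    Complex.conj_ofReal, ← mul_assoc, ← Complex.ofReal_mul]
  simp only [Complex.norm_real, RCLike.re_eq_complex_re, Complex.re_ofReal_mul, mul_pow,
    Real.norm_eq_abs, sq_abs, abs_mul]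
  ring

/-- The set of extremal choices. -/
def Ch (α γ : ℝ) (a1 a2 b1 b2 x y v w : E) : Prop :=
  (‖x‖ = 1 ∧ ‖y‖ = 1 ∧ ‖v‖ = 1 ∧ ‖w‖ = 1) ∧
  (∀ x', ‖x'‖ = 1 → qf α γ a1 b1 x ≤ qf α γ a1 b1 x') ∧
  (∀ y', ‖y'‖ = 1 → qf α γ a2 b2 y ≤ qf α γ a2 b2 y') ∧
  (∀ v' w', ‖v'‖ = 1 → ‖w'‖ = 1 →
    (sf α γ a1 a2 b1 b2 v' w').re ≤ (sf α γ a1 a2 b1 b2 v w).re)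

set_option maxHeartbeats 1000000 in
lemma conn (α γ : ℝ) (a1 a2 b1 b2 x0 y0 v0 w0 x1 y1 v1 w1 : E)
    (h0 : Ch α γ a1 a2 b1 b2 x0 y0 v0 w0) (h1 : Ch α γ a1 a2 b1 b2 x1 y1 v1 w1)
    (hr : 0 < (sf α γ a1 a2 b1 b2 v0 w0).re)
    (g0 : ‖inner ℂ w0 y0‖ ≤ ‖inner ℂ x0 v0‖) (g1 : ‖inner ℂ x1 v1‖ ≤ ‖inner ℂ w1 y1‖) :
    ∃ x y v w : E, ‖x‖ = 1 ∧ ‖y‖ = 1 ∧ ‖v‖ = 1 ∧ ‖w‖ = 1 ∧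
      qf α γ a1 b1 x = qf α γ a1 b1 x0 ∧ qf α γ a2 b2 y = qf α γ a2 b2 y0 ∧
      (sf α γ a1 a2 b1 b2 v w).re = (sf α γ a1 a2 b1 b2 v0 w0).re ∧
      ‖inner ℂ x v‖ = ‖inner ℂ w y‖ := by
  obtain ⟨⟨nx0, ny0, nv0, nw0⟩, mx0, my0, mv0⟩ := h0
  obtain ⟨⟨nx1, ny1, nv1, nw1⟩, mx1, my1, mv1⟩ := h1
  obtain ⟨ex, ex2, exr⟩ := sign_exists (inner ℂ x0 x1 : ℂ).re
  obtain ⟨ey, ey2, eyr⟩ := sign_exists (inner ℂ y0 y1 : ℂ).re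
  obtain ⟨ev, ev2, evr⟩ := sign_exists ((inner ℂ v0 v1 : ℂ).re + (inner ℂ w0 w1 : ℂ).re)
  set r := (sf α γ a1 a2 b1 b2 v0 w0).re with hrdef
  have hr1 : (sf α γ a1 a2 b1 b2 v1 w1).re = r :=
    le_antisymm (mv0 _ _ nv1 nw1) (mv1 _ _ nv0 nw0)
  -- quadratic forms vanish along the path
  have qpath : ∀ (a b z0 z1 : E) (e : ℝ), ‖z0‖ = 1 → ‖z1‖ = 1 →
      (∀ x', ‖x'‖ = 1 → qf α γ a b z0 ≤ qf α γ a b x') →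
      (∀ x', ‖x'‖ = 1 → qf α γ a b z1 ≤ qf α γ a b x') → ∀ s : ℝ,
      qf α γ a b (((1 - s : ℝ) : ℂ) • z0 + ((s * e : ℝ) : ℂ) • z1)
       = qf α γ a b z0 * ‖((1 - s : ℝ) : ℂ) • z0 + ((s * e : ℝ) : ℂ) • z1‖ ^ 2 := by
    intro a b z0 z1 e n0 n1 m0 m1 s
    have heq : qf α γ a b z1 = qf α γ a b z0 := le_antisymm (m1 _ n0) (m0 _ n1)
    have := zero_comb (fun z : E => qf α γ a b z - qf α γ a b z0 * ‖z‖ ^ 2)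
      (fun z => sub_nonneg.2 (qf_min_ext α γ a b _ m0 z))
      (fun z z' => by
        have h1 := qf_para α γ a b z z'
        have h2 := parallelogram_law_with_norm ℂ z z'
        linear_combination h1 - qf α γ a b z0 * h2)
      (fun s z => by
        simp only [qf_smul, norm_smul, Complex.norm_real, Real.norm_eq_abs, sq_abs, mul_pow]
        ring)
      z0 z1 (by simp [n0]) (by simp [n1, heq]) (1 - s) (s * e)
    exact sub_eq_zero.1 this
  have spath : ∀ s : ℝ, r * (‖((1 - s : ℝ) : ℂ) • v0 + ((s * ev : ℝ) : ℂ) • v1‖ ^ 2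
      + ‖((1 - s : ℝ) : ℂ) • w0 + ((s * ev : ℝ) : ℂ) • w1‖ ^ 2)
      = 2 * (sf α γ a1 a2 b1 b2 (((1 - s : ℝ) : ℂ) • v0 + ((s * ev : ℝ) : ℂ) • v1)
        (((1 - s : ℝ) : ℂ) • w0 + ((s * ev : ℝ) : ℂ) • w1)).re := by
    intro s
    have := zero_comb (fun z : E × E => r * (‖z.1‖ ^ 2 + ‖z.2‖ ^ 2)
        - 2 * (sf α γ a1 a2 b1 b2 z.1 z.2).re)
      (fun z => by
        have := sf_max_ext α γ a1 a2 b1 b2 r mv0 z.1 z.2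
        have h2 := mul_nonneg hr.le (sq_nonneg (‖z.1‖ - ‖z.2‖))
        nlinarith)
      (fun z z' => by
        have h1 := congrArg Complex.re (sf_para α γ a1 a2 b1 b2 z.1 z.2 z'.1 z'.2)
        have h2 := parallelogram_law_with_norm ℂ z.1 z'.1
        have h3 := parallelogram_law_with_norm ℂ z.2 z'.2
        simp at h1
        simp only [Prod.fst_add, Prod.snd_add, Prod.fst_sub, Prod.snd_sub]
        linear_combination -2 * h1 + r * h2 + r * h3)
      (fun s z => by
        simp only [Prod.smul_fst, Prod.smul_snd, sf_smul, norm_smul, Complex.norm_real,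
          Real.norm_eq_abs, sq_abs, mul_pow, Complex.conj_ofReal, ← Complex.ofReal_mul,
          Complex.re_ofReal_mul]
        ring)
      (v0, w0) (v1, w1) (by simp [nv0, nw0, ← hrdef]; ring) (by simp [nv1, nw1, hr1]; ring)
      (1 - s) (s * ev)
    exact sub_eq_zero.1 this
  let X : ℝ → E := fun s => ((1 - s : ℝ) : ℂ) • x0 + ((s * ex : ℝ) : ℂ) • x1
  let Y : ℝ → E := fun s => ((1 - s : ℝ) : ℂ) • y0 + ((s * ey : ℝ) : ℂ) • y1
  let V : ℝ → E := fun s => ((1 - s : ℝ) : ℂ) • v0 + ((s * ev : ℝ) : ℂ) • v1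
  let W : ℝ → E := fun s => ((1 - s : ℝ) : ℂ) • w0 + ((s * ev : ℝ) : ℂ) • w1
  have cX : Continuous X := by fun_prop
  have cY : Continuous Y := by fun_prop
  have cV : Continuous V := by fun_prop
  have cW : Continuous W := by fun_prop
  let g : ℝ → ℝ := fun s => ‖inner ℂ (X s) (V s)‖ * ‖W s‖ * ‖Y s‖
    - ‖inner ℂ (W s) (Y s)‖ * ‖X s‖ * ‖V s‖
  have cg : Continuous g := by fun_prop
  have aex : |ex| = 1 := by rw [← sq_abs] at ex2; nlinarith [abs_nonneg ex]
  have aey : |ey| = 1 := by rw [← sq_abs] at ey2; nlinarith [abs_nonneg ey]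
  have aev : |ev| = 1 := by rw [← sq_abs] at ev2; nlinarith [abs_nonneg ev]
  have hg0 : 0 ≤ g 0 := by simp [g, X, Y, V, W, nx0, ny0, nv0, nw0, g0]
  have hg1 : g 1 ≤ 0 := by
    simp [g, X, Y, V, W, nx1, ny1, nv1, nw1, norm_smul,
      aex, aey, aev, g1]
  obtain ⟨s, ⟨hs0, hs1⟩, hs⟩ := intermediate_value_Icc' (zero_le_one' ℝ) cg.continuousOn
    ⟨hg1, hg0⟩
  have hss : 0 ≤ s * (1 - s) := mul_nonneg hs0 (by linarith)
  have hpos : 0 < (1 - s) ^ 2 + s ^ 2 := by nlinarith [sq_nonneg (1 - 2 * s)]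
  have pX : X s ≠ 0 := by
    intro h
    have := path_norm x0 x1 ex s
    change ‖X s‖ ^ 2 = _ at this
    rw [h, nx0, nx1, ex2] at this
    have m := mul_nonneg hss exr
    rw [norm_zero] at this
    linarith
  have pY : Y s ≠ 0 := by
    intro h
    have := path_norm y0 y1 ey s
    change ‖Y s‖ ^ 2 = _ at this
    rw [h, ny0, ny1, ey2] at this
    have m := mul_nonneg hss eyr
    rw [norm_zero] at this
    linarith
  have pVW : 0 < ‖V s‖ ^ 2 + ‖W s‖ ^ 2 := by
    have h1 := path_norm v0 v1 ev s
    have h2 := path_norm w0 w1 ev s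
    change ‖V s‖ ^ 2 = _ at h1
    change ‖W s‖ ^ 2 = _ at h2
    rw [nv0, nv1, ev2] at h1
    rw [nw0, nw1, ev2] at h2
    have m := mul_nonneg hss evr
    linarith
  have eVW : r * (‖V s‖ ^ 2 + ‖W s‖ ^ 2) = 2 * (sf α γ a1 a2 b1 b2 (V s) (W s)).re := spath s
  have nVW : ‖V s‖ = ‖W s‖ := by
    have := sf_max_ext α γ a1 a2 b1 b2 r mv0 (V s) (W s)
    have h2 : r * (‖V s‖ - ‖W s‖) ^ 2 ≤ 0 := by nlinarith
    have h3 : (‖V s‖ - ‖W s‖) ^ 2 ≤ 0 := by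
      by_contra hc
      push Not at hc
      have := mul_pos hr hc
      linarith
    have h4 : ‖V s‖ - ‖W s‖ = 0 := by
      have := le_antisymm h3 (sq_nonneg _)
      exact pow_eq_zero_iff two_ne_zero |>.1 this
    linarith
  have pV' : 0 < ‖V s‖ := by
    rcases (norm_nonneg (V s)).eq_or_lt with h | h
    · rw [← nVW, ← h] at pVW; simp at pVW
    · exact h
  have pW' : 0 < ‖W s‖ := nVW ▸ pV'
  have pV : V s ≠ 0 := norm_pos_iff.1 pV'
  have pW : W s ≠ 0 := norm_pos_iff.1 pW'
  have pX' : 0 < ‖X s‖ := norm_pos_iff.2 pX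
  have pY' : 0 < ‖Y s‖ := norm_pos_iff.2 pY
  refine ⟨_, _, _, _, unit_of _ pX, unit_of _ pY, unit_of _ pV, unit_of _ pW, ?_, ?_, ?_, ?_⟩
  · have : qf α γ a1 b1 (X s) = qf α γ a1 b1 x0 * ‖X s‖ ^ 2 := qpath a1 b1 x0 x1 ex nx0 nx1 mx0 mx1 s
    rw [qf_smul, this]; simp; field_simp
  · have : qf α γ a2 b2 (Y s) = qf α γ a2 b2 y0 * ‖Y s‖ ^ 2 := qpath a2 b2 y0 y1 ey ny0 ny1 my0 my1 s
    rw [qf_smul, this]; simp; field_simp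
  · rw [sf_smul, Complex.conj_ofReal, ← Complex.ofReal_mul, Complex.re_ofReal_mul]
    rw [← nVW] at eVW ⊢
    field_simp
    linarith
  · rw [inner_smul_left, inner_smul_left, inner_smul_right, inner_smul_right]
    have hs' : ‖inner ℂ (X s) (V s)‖ * ‖W s‖ * ‖Y s‖ = ‖inner ℂ (W s) (Y s)‖ * ‖X s‖ * ‖V s‖ :=
      sub_eq_zero.1 hs
    simp
    field_simp
    linarith
end topo



section topo2
variable {E : Type*} [NormedAddCommGroup E] [InnerProductSpace ℂ E]

lemma Ch_exists [FiniteDimensional ℂ E] [Nontrivial E] (α γ : ℝ) (a1 a2 b1 b2 : E) :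
    ∃ x y v w, Ch α γ a1 a2 b1 b2 x y v w := by
  have : ProperSpace E := FiniteDimensional.proper ℂ E
  have hc : IsCompact (Metric.sphere (0 : E) 1) := isCompact_sphere _ _
  have hne : (Metric.sphere (0 : E) 1).Nonempty := by
    obtain ⟨x, hx⟩ := exists_ne (0 : E)
    exact ⟨_, by simpa using unit_of x hx⟩
  obtain ⟨x, hx, hx'⟩ := hc.exists_isMinOn hne
    (f := qf α γ a1 b1) (by unfold qf; fun_prop)
  obtain ⟨y, hy, hy'⟩ := hc.exists_isMinOn hne
    (f := qf α γ a2 b2) (by unfold qf; fun_prop)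
  obtain ⟨z, hz, hz'⟩ := (hc.prod hc).exists_isMaxOn (hne.prod hne)
    (f := fun z : E × E => (sf α γ a1 a2 b1 b2 z.1 z.2).re)
    (Continuous.continuousOn (by unfold sf; fun_prop))
  refine ⟨x, y, z.1, z.2, ⟨by simpa using hx, by simpa using hy, by simpa using hz.1,
    by simpa using hz.2⟩, ?_, ?_, ?_⟩
  · intro x' h; exact hx' (by simpa using h)
  · intro x' h; exact hy' (by simpa using h)
  · intro v' w' h1 h2
    exact hz' (a := (v', w')) ⟨by simpa using h1, by simpa using h2⟩

lemma Ch_closed (α γ : ℝ) (A1 A2 B1 B2 : ℝ → E) (h1 : Continuous A1) (h2 : Continuous A2)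
    (h3 : Continuous B1) (h4 : Continuous B2) :
    IsClosed {p : ℝ × E × E × E × E | Ch α γ (A1 p.1) (A2 p.1) (B1 p.1) (B2 p.1)
      p.2.1 p.2.2.1 p.2.2.2.1 p.2.2.2.2} := by
  unfold Ch qf sf
  simp only [Set.ofPred_and, Set.ofPred_forall]
  refine IsClosed.inter (IsClosed.inter ?_ (IsClosed.inter ?_ (IsClosed.inter ?_ ?_)))
    (IsClosed.inter ?_ (IsClosed.inter ?_ ?_))
  · exact isClosed_eq (by fun_prop) (by fun_prop)
  · exact isClosed_eq (by fun_prop) (by fun_prop)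
  · exact isClosed_eq (by fun_prop) (by fun_prop)
  · exact isClosed_eq (by fun_prop) (by fun_prop)
  · refine isClosed_iInter fun x' => isClosed_iInter fun _ => ?_
    exact isClosed_le (by fun_prop) (by fun_prop)
  · refine isClosed_iInter fun x' => isClosed_iInter fun _ => ?_
    exact isClosed_le (by fun_prop) (by fun_prop)
  · refine isClosed_iInter fun v' => isClosed_iInter fun w' => isClosed_iInter fun _ =>
      isClosed_iInter fun _ => ?_
    exact isClosed_le (by fun_prop) (by fun_prop)

lemma Ch_swap (α γ : ℝ) (a1 a2 b1 b2 x y v w : E) (h : Ch α γ a1 a2 b1 b2 x y v w) :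
    Ch α γ a2 (-a1) b2 (-b1) y x (-w) v := by
  obtain ⟨⟨nx0, ny0, nv0, nw0⟩, mx0, my0, mv0⟩ := h
  have e : ∀ v w : E, (sf α γ a2 (-a1) b2 (-b1) w v).re = - (sf α γ a1 a2 b1 b2 v w).re := by
    intro v w
    have : sf α γ a2 (-a1) b2 (-b1) w v = - (starRingEnd ℂ) (sf α γ a1 a2 b1 b2 v w) := by
      unfold sf
      simp only [inner_neg_left, map_sub, map_mul, Complex.conj_ofReal, inner_conj_symm]
      ring
    rw [this]; simp
  have e2 : ∀ v w : E, (sf α γ a1 a2 b1 b2 v (-w)).re = - (sf α γ a1 a2 b1 b2 v w).re := by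
    intro v w; unfold sf; simp only [inner_neg_right]; rw [← Complex.neg_re]; congr 1; ring
  have eq : ∀ z : E, qf α γ (-a1) (-b1) z = qf α γ a1 b1 z := by
    intro z; unfold qf; simp only [inner_neg_left, norm_neg]
  refine ⟨⟨ny0, nx0, by simpa using nw0, nv0⟩, my0, ?_, ?_⟩
  · intro x' hx'; rw [eq, eq]; exact mx0 x' hx'
  · intro v' w' hv' hw'
    rw [e, e, e2, neg_neg, ← e2]
    exact mv0 _ _ hw' (by simpa using hv')

lemma topo_main [FiniteDimensional ℂ E] [Nontrivial E] (α γ : ℝ)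
    (hα : 0 ≤ α) (hγ : 0 ≤ γ) (hαγ : α ^ 2 ≤ 4 * (1 - γ))
    (A1 A2 B1 B2 : ℝ → E) (h1 : Continuous A1) (h2 : Continuous A2)
    (h3 : Continuous B1) (h4 : Continuous B2) (T : ℝ) (hT : 0 ≤ T)
    (e1 : A1 T = A2 0) (e2 : A2 T = - A1 0) (e3 : B1 T = B2 0) (e4 : B2 T = - B1 0)
    (ha : ∀ s, ‖A1 s‖ ^ 2 + ‖A2 s‖ ^ 2 ≤ 1) (hb : ∀ s, ‖B1 s‖ ^ 2 + ‖B2 s‖ ^ 2 ≤ 1) :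
    ∃ s mA mC r : ℝ, 0 ≤ mA ∧ 0 ≤ mC ∧ 0 ≤ r ∧ r ^ 2 ≤ mA * mC ∧
      (∀ x, mA * ‖x‖ ^ 2 ≤ qf α γ (A1 s) (B1 s) x) ∧
      (∀ x, mC * ‖x‖ ^ 2 ≤ qf α γ (A2 s) (B2 s) x) ∧
      (∀ v w, ‖sf α γ (A1 s) (A2 s) (B1 s) (B2 s) v w‖ ≤ r * (‖v‖ * ‖w‖)) := by
  have : ProperSpace E := FiniteDimensional.proper ℂ E
  have hc : IsCompact (Metric.sphere (0 : E) 1) := isCompact_sphere _ _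
  have hK : IsCompact (Set.Icc 0 T ×ˢ (Metric.sphere (0 : E) 1 ×ˢ (Metric.sphere (0 : E) 1 ×ˢ
    (Metric.sphere (0 : E) 1 ×ˢ Metric.sphere (0 : E) 1)))) :=
    isCompact_Icc.prod (hc.prod (hc.prod (hc.prod hc)))
  have clo := Ch_closed α γ A1 A2 B1 B2 h1 h2 h3 h4
  have cl : ∀ P : Set (ℝ × E × E × E × E), IsClosed P →
      IsClosed {s : ℝ | s ∈ Set.Icc 0 T ∧ ∃ x y v w, Ch α γ (A1 s) (A2 s) (B1 s) (B2 s) x y v w ∧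
        (s, x, y, v, w) ∈ P} := by
    intro P hP
    have := ((hK.inter_right (clo.inter hP)).image continuous_fst).isClosed
    convert this using 1
    ext s
    constructor
    · rintro ⟨hs, x, y, v, w, hch, hp⟩
      refine ⟨(s, x, y, v, w), ⟨⟨hs, ?_⟩, hch, hp⟩, rfl⟩
      obtain ⟨⟨q1, q2, q3, q4⟩, -⟩ := hch
      exact ⟨by simpa using q1, by simpa using q2, by simpa using q3, by simpa using q4⟩
    · rintro ⟨⟨s', x, y, v, w⟩, ⟨⟨hs, -⟩, hch, hp⟩, rfl⟩
      exact ⟨hs, x, y, v, w, hch, hp⟩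
  obtain ⟨F1, c1, hF1⟩ : ∃ F : Set ℝ, IsClosed F ∧ ∀ s, s ∈ F ↔ (s ∈ Set.Icc 0 T ∧
      ∃ x y v w, Ch α γ (A1 s) (A2 s) (B1 s) (B2 s) x y v w ∧
        ‖inner ℂ w y‖ ≤ ‖inner ℂ x v‖) :=
    ⟨_, cl {p | ‖inner ℂ p.2.2.2.2 p.2.2.1‖ ≤ ‖inner ℂ p.2.1 p.2.2.2.1‖}
      (isClosed_le (by fun_prop) (by fun_prop)), fun s => Iff.rfl⟩
  obtain ⟨F2, c2, hF2⟩ : ∃ F : Set ℝ, IsClosed F ∧ ∀ s, s ∈ F ↔ (s ∈ Set.Icc 0 T ∧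
      ∃ x y v w, Ch α γ (A1 s) (A2 s) (B1 s) (B2 s) x y v w ∧
        ‖inner ℂ x v‖ ≤ ‖inner ℂ w y‖) :=
    ⟨_, cl {p | ‖inner ℂ p.2.1 p.2.2.2.1‖ ≤ ‖inner ℂ p.2.2.2.2 p.2.2.1‖}
      (isClosed_le (by fun_prop) (by fun_prop)), fun s => Iff.rfl⟩
  have cov : Set.Icc 0 T ⊆ F1 ∪ F2 := by
    intro s hs
    obtain ⟨x, y, v, w, hch⟩ := Ch_exists α γ (A1 s) (A2 s) (B1 s) (B2 s)
    rcases le_total ‖inner ℂ w y‖ ‖inner ℂ x v‖ with h | h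
    · left; exact (hF1 s).2 ⟨hs, x, y, v, w, hch, h⟩
    · right; exact (hF2 s).2 ⟨hs, x, y, v, w, hch, h⟩
  have m0 : (0 : ℝ) ∈ Set.Icc 0 T := ⟨le_rfl, hT⟩
  have mT : T ∈ Set.Icc 0 T := ⟨hT, le_rfl⟩
  obtain ⟨x, y, v, w, hch⟩ := Ch_exists α γ (A1 0) (A2 0) (B1 0) (B2 0)
  have hsw := Ch_swap α γ _ _ _ _ _ _ _ _ hch
  rw [← e1, ← e2, ← e3, ← e4] at hsw
  have conc := isPreconnected_closed_iff.1 (isPreconnected_Icc (a := (0 : ℝ)) (b := T)) _ _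
    c1 c2 cov
  have ne : (Set.Icc 0 T ∩ (F1 ∩ F2)).Nonempty := by
    rcases le_total ‖inner ℂ w y‖ ‖inner ℂ x v‖ with h | h
    · refine conc ⟨0, m0, (hF1 0).2 ⟨m0, x, y, v, w, hch, h⟩⟩
        ⟨T, mT, (hF2 T).2 ⟨mT, _, _, _, _, hsw, ?_⟩⟩
      rw [inner_neg_right, norm_neg]
      rwa [norm_inner_symm, norm_inner_symm v x]
    · refine conc ⟨T, mT, (hF1 T).2 ⟨mT, _, _, _, _, hsw, ?_⟩⟩
        ⟨0, m0, (hF2 0).2 ⟨m0, x, y, v, w, hch, h⟩⟩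
      rw [inner_neg_right, norm_neg]
      rwa [norm_inner_symm, norm_inner_symm y w]
  obtain ⟨s, hs, hs1, hs2⟩ := ne
  obtain ⟨-, x0, y0, v0, w0, hch0, g0⟩ := (hF1 s).1 hs1
  obtain ⟨-, x1, y1, v1, w1, hch1, g1⟩ := (hF2 s).1 hs2
  have hch0' := hch0
  obtain ⟨⟨nx0, ny0, nv0, nw0⟩, mx0, my0, mv0⟩ := hch0'
  have q1 := qf_nonneg α γ hα hαγ (A1 s) (B1 s) x0
    (by nlinarith [hb s, sq_nonneg ‖B2 s‖])
  have q2 := qf_nonneg α γ hα hαγ (A2 s) (B2 s) y0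
    (by nlinarith [hb s, sq_nonneg ‖B1 s‖])
  have hr0 : 0 ≤ (sf α γ (A1 s) (A2 s) (B1 s) (B2 s) v0 w0).re := by
    have k1 := mv0 v0 (-w0) nv0 (by simpa using nw0)
    have : (sf α γ (A1 s) (A2 s) (B1 s) (B2 s) v0 (-w0)).re
        = - (sf α γ (A1 s) (A2 s) (B1 s) (B2 s) v0 w0).re := by
      unfold sf; simp only [inner_neg_right]; rw [← Complex.neg_re]; congr 1; ring
    linarith
  refine ⟨s, qf α γ (A1 s) (B1 s) x0, qf α γ (A2 s) (B2 s) y0,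
    (sf α γ (A1 s) (A2 s) (B1 s) (B2 s) v0 w0).re, q1, q2, hr0, ?_, qf_min_ext _ _ _ _ _ mx0,
    qf_min_ext _ _ _ _ _ my0, sf_norm_ext _ _ _ _ _ _ _ mv0⟩
  rcases hr0.eq_or_lt with h | h
  · rw [← h]; simpa using mul_nonneg q1 q2
  · obtain ⟨x, y, v, w, nx, ny, nv, nw, ex, ey, es, hxy⟩ :=
      conn α γ _ _ _ _ _ _ _ _ _ _ _ _ hch0 hch1 h g0 g1
    have := key1 α γ hα hγ hαγ (A1 s) (A2 s) (B1 s) (B2 s) x y v w (ha s) (hb s) nx ny nv nw hxy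
    rw [ex, ey] at this
    refine le_trans ?_ this
    rw [← es]
    have := Complex.abs_re_le_norm (sf α γ (A1 s) (A2 s) (B1 s) (B2 s) v w)
    exact sq_le_sq' (by linarith [neg_abs_le (sf α γ (A1 s) (A2 s) (B1 s) (B2 s) v w).re])
      ((le_abs_self _).trans this)
end topo2



section sepcone
variable {κ : Type*} [Fintype κ] [DecidableEq κ]

def SepC (κ : Type*) [Fintype κ] [DecidableEq κ] :
    AddSubmonoid (Matrix (Fin 2 × κ) (Fin 2 × κ) ℂ) :=
  AddSubmonoid.closure {X | ∃ (P : Matrix (Fin 2) (Fin 2) ℂ) (Q : Matrix κ κ ℂ),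
    P.PosSemidef ∧ Q.PosSemidef ∧ X = P ⊗ₖ Q}

lemma SepC_kron {P : Matrix (Fin 2) (Fin 2) ℂ} {Q : Matrix κ κ ℂ}
    (hP : P.PosSemidef) (hQ : Q.PosSemidef) : P ⊗ₖ Q ∈ SepC κ :=
  AddSubmonoid.subset_closure ⟨P, Q, hP, hQ, rfl⟩

lemma SepC_one : (1 : Matrix (Fin 2 × κ) (Fin 2 × κ) ℂ) ∈ SepC κ := by
  rw [← one_kronecker_one]
  exact SepC_kron PosSemidef.one PosSemidef.one

lemma SepC_smul {c : ℝ} (hc : 0 ≤ c) {M : Matrix (Fin 2 × κ) (Fin 2 × κ) ℂ} (hM : M ∈ SepC κ) :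
    (c : ℂ) • M ∈ SepC κ := by
  induction hM using AddSubmonoid.closure_induction with
  | mem x hx =>
    obtain ⟨P, Q, hP, hQ, rfl⟩ := hx
    rw [← smul_kronecker]
    exact SepC_kron (hP.smul (by exact_mod_cast hc)) hQ
  | zero => simp [zero_mem]
  | add x y _ _ hx hy => rw [smul_add]; exact add_mem hx hy

lemma SepC_conj (V : Matrix (Fin 2) (Fin 2) ℂ) {M : Matrix (Fin 2 × κ) (Fin 2 × κ) ℂ}
    (hM : M ∈ SepC κ) : (V ⊗ₖ (1 : Matrix κ κ ℂ)) * M * (V ⊗ₖ (1 : Matrix κ κ ℂ))ᴴ ∈ SepC κ := by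
  induction hM using AddSubmonoid.closure_induction with
  | mem x hx =>
    obtain ⟨P, Q, hP, hQ, rfl⟩ := hx
    rw [conjTranspose_kronecker, ← mul_kronecker_mul, ← mul_kronecker_mul]
    simp only [conjTranspose_one, one_mul, mul_one]
    exact SepC_kron (hP.mul_mul_conjTranspose_same V) hQ
  | zero => simp [zero_mem]
  | add x y _ _ hx hy => rw [mul_add, add_mul]; exact add_mem hx hy

lemma dm_normalise {ι : Type*} [Fintype ι] [DecidableEq ι] {P : Matrix ι ι ℂ} (hP : P.PosSemidef)
    (h0 : P ≠ 0) : ∃ t : ℝ, 0 ≤ t ∧ ∃ A, IsDM A ∧ P = (t : ℂ) • A := by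
  have h1 : 0 ≤ P.trace := hP.trace_nonneg
  have h2 : P.trace ≠ 0 := fun h => h0 (hP.trace_eq_zero_iff.1 h)
  have h3 : ((P.trace.re : ℝ) : ℂ) = P.trace := by
    rw [Complex.le_def] at h1
    apply Complex.ext <;> simp [h1.2.symm] 
  refine ⟨P.trace.re, (Complex.le_def.1 h1).1, (P.trace)⁻¹ • P, ⟨hP.smul ?_, ?_⟩, ?_⟩
  · rw [← h3, ← Complex.ofReal_inv]
    exact_mod_cast inv_nonneg.2 (Complex.le_def.1 h1).1
  · rw [trace_smul, smul_eq_mul, inv_mul_cancel₀ h2]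
  · rw [h3, smul_smul, mul_inv_cancel₀ h2, one_smul]

lemma SepC_decomp {M : Matrix (Fin 2 × κ) (Fin 2 × κ) ℂ} (hM : M ∈ SepC κ) :
    ∃ (k : ℕ) (p : Fin k → ℝ) (A : Fin k → Matrix (Fin 2) (Fin 2) ℂ) (B : Fin k → Matrix κ κ ℂ),
    (∀ i, 0 ≤ p i) ∧ (∀ i, IsDM (A i)) ∧ (∀ i, IsDM (B i)) ∧
    M = ∑ i, (p i : ℂ) • (A i ⊗ₖ B i) := by
  induction hM using AddSubmonoid.closure_induction with
  | mem x hx =>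
    obtain ⟨P, Q, hP, hQ, rfl⟩ := hx
    by_cases h1 : P = 0
    · exact ⟨0, Fin.elim0, Fin.elim0, Fin.elim0, nofun, nofun, nofun, by simp [h1]⟩
    by_cases h2 : Q = 0
    · exact ⟨0, Fin.elim0, Fin.elim0, Fin.elim0, nofun, nofun, nofun, by simp [h2]⟩
    obtain ⟨t, ht, A, hA, rfl⟩ := dm_normalise hP h1
    obtain ⟨s, hs, B, hB, rfl⟩ := dm_normalise hQ h2
    refine ⟨1, fun _ => t * s, fun _ => A, fun _ => B, fun _ => by positivity, fun _ => hA,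
      fun _ => hB, ?_⟩
    ext ⟨i, j⟩ ⟨k, l⟩
    simp [kroneckerMap_apply]
    ring
  | zero => exact ⟨0, Fin.elim0, Fin.elim0, Fin.elim0, nofun, nofun, nofun, by simp⟩
  | add x y _ _ hx hy =>
    obtain ⟨k, p, A, B, h1, h2, h3, rfl⟩ := hx
    obtain ⟨k', p', A', B', h1', h2', h3', rfl⟩ := hy
    refine ⟨k + k', Fin.append p p', Fin.append A A', Fin.append B B', ?_, ?_, ?_, ?_⟩
    · intro i; refine Fin.addCases (fun i => ?_) (fun i => ?_) i <;> simp [h1, h1']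
    · intro i; refine Fin.addCases (fun i => ?_) (fun i => ?_) i <;> simp [h2, h2']
    · intro i; refine Fin.addCases (fun i => ?_) (fun i => ?_) i <;> simp [h3, h3']
    · simp [Fin.sum_univ_add]

lemma SepC_isSep {M : Matrix (Fin 2 × κ) (Fin 2 × κ) ℂ} (hM : M ∈ SepC κ) (ht : M.trace = 1) :
    IsSep M := by
  obtain ⟨k, p, A, B, h1, h2, h3, h4⟩ := SepC_decomp hM
  refine ⟨k, p, A, B, h1, ?_, h2, h3, h4⟩
  have : M.trace = ∑ i, (p i : ℂ) := by
    rw [h4, trace_sum]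
    refine Finset.sum_congr rfl fun i _ => ?_
    rw [trace_smul, trace_kronecker, (h2 i).2, (h3 i).2]; simp
  rw [ht] at this
  exact_mod_cast this.symm

end sepcone



section contr
variable {κ : Type*} [Fintype κ] [DecidableEq κ]

open scoped Matrix.Norms.L2Operator in
lemma unitary_spectral (U : Matrix κ κ ℂ) (h : U ∈ unitary (Matrix κ κ ℂ)) :
    ∃ (S : Finset ℂ) (P : ℂ → Matrix κ κ ℂ), (∀ z ∈ S, ‖z‖ = 1) ∧ (∀ z, (P z).PosSemidef) ∧
      (∑ z ∈ S, P z = 1) ∧ (∑ z ∈ S, z • P z = U) := by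
  have hU : IsStarNormal U :=
    ⟨by rw [Commute, SemiconjBy, (Unitary.mem_iff.1 h).1, (Unitary.mem_iff.1 h).2]⟩
  have hfin := Matrix.finite_spectrum U
  have hc : ∀ f : ℂ → ℂ, ContinuousOn f (spectrum ℂ U) := fun f => hfin.continuousOn f
  classical
  let f : ℂ → ℂ → ℂ := fun z w => if w = z then 1 else 0
  refine ⟨hfin.toFinset, fun z => cfc (f z) U, ?_, ?_, ?_, ?_⟩
  · intro z hz
    have := spectrum.subset_circle_of_unitary h (hfin.mem_toFinset.1 hz)
    simpa using this
  · intro z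
    have : cfc (f z) U = (cfc (f z) U)ᴴ * cfc (f z) U := by
      rw [← star_eq_conjTranspose, ← cfc_star, ← cfc_mul _ _ _ (hc _) (hc _)]
      congr 1; ext w; simp [f]
    change (cfc (f z) U).PosSemidef
    rw [this]
    exact posSemidef_conjTranspose_mul_self _
  · rw [← cfc_sum f U _ (fun i _ => hc _), ← cfc_const_one ℂ U]
    apply cfc_congr
    intro w hw
    simp [f, hw]
  · have : ∀ z, z • cfc (f z) U = cfc (fun w => z * f z w) U := fun z =>
      (cfc_const_mul z (f z) U (hc _)).symm
    simp only [this]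
    rw [← cfc_sum (fun z w => z * f z w) U _ (fun i _ => hc _)]
    conv_rhs => rw [← cfc_id' ℂ U]
    apply cfc_congr
    intro w hw
    simp [f, hw]

def blk (A B C : Matrix κ κ ℂ) : Matrix (Fin 2 × κ) (Fin 2 × κ) ℂ :=
  fun i j => (if i.1 = 0 then (if j.1 = 0 then A i.2 j.2 else B i.2 j.2)
    else (if j.1 = 0 then Bᴴ i.2 j.2 else C i.2 j.2))

lemma psd22 {a c : ℝ} {z : ℂ} (ha : 0 ≤ a) (hc : 0 ≤ c) (hz : ‖z‖ ^ 2 ≤ a * c) :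
    (!![(a : ℂ), z; star z, (c : ℂ)]).PosSemidef := by
  refine PosSemidef.of_dotProduct_mulVec_nonneg ?_ ?_
  · ext i j; fin_cases i <;> fin_cases j <;> simp
  · intro x
    have key : (star x ⬝ᵥ (!![(a : ℂ), z; star z, (c : ℂ)] *ᵥ x)) =
        ((a * ‖x 0‖ ^ 2 + c * ‖x 1‖ ^ 2 + 2 * (star (x 0) * z * x 1).re : ℝ) : ℂ) := by
      rw [Complex.sq_norm, Complex.sq_norm, Complex.normSq_apply, Complex.normSq_apply]
      apply Complex.ext
      · simp [dotProduct, Matrix.mulVec, Fin.sum_univ_two]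
        ring
      · simp [dotProduct, Matrix.mulVec, Fin.sum_univ_two]
        ring
    rw [key]
    have h1 : -(‖x 0‖ * ‖z‖ * ‖x 1‖) ≤ (star (x 0) * z * x 1).re := by
      have := (abs_le.1 (Complex.abs_re_le_norm (star (x 0) * z * x 1))).1
      simpa using this
    have h2 : 2 * (‖x 0‖ * ‖z‖ * ‖x 1‖) ≤ a * ‖x 0‖ ^ 2 + c * ‖x 1‖ ^ 2 := by
      have h3 : ‖z‖ ≤ √a * √c := by
        rw [← Real.sqrt_mul ha]; exact Real.le_sqrt_of_sq_le hz
      have h4 := sq_nonneg (√a * ‖x 0‖ - √c * ‖x 1‖)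
      have h5 := Real.sq_sqrt ha
      have h6 := Real.sq_sqrt hc
      have h7 : ‖x 0‖ * ‖x 1‖ * ‖z‖ ≤ ‖x 0‖ * ‖x 1‖ * (√a * √c) := by gcongr
      nlinarith
    have : (0 : ℝ) ≤ a * ‖x 0‖ ^ 2 + c * ‖x 1‖ ^ 2 + 2 * (star (x 0) * z * x 1).re := by linarith
    exact_mod_cast this

lemma blk_unitary (U : Matrix κ κ ℂ) (h : U ∈ unitary (Matrix κ κ ℂ)) {a c g : ℝ} 
    (ha : 0 ≤ a) (hc : 0 ≤ c) (hg : g ^ 2 ≤ a * c) :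
    blk ((a : ℂ) • (1 : Matrix κ κ ℂ)) ((g : ℂ) • U) ((c : ℂ) • 1) ∈ SepC κ := by
  obtain ⟨S, P, h1, h2, h3, h4⟩ := unitary_spectral U h
  have : blk ((a : ℂ) • (1 : Matrix κ κ ℂ)) ((g : ℂ) • U) ((c : ℂ) • 1) =
      ∑ z ∈ S, !![(a : ℂ), g * z; star (g * z), (c : ℂ)] ⊗ₖ P z := by
    rw [← h3, ← h4]
    have hH : ∀ z, (P z)ᴴ = P z := fun z => (h2 z).1
    ext ⟨i, j⟩ ⟨k, l⟩
    fin_cases i <;> fin_cases k <;>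
      simp [blk, Matrix.sum_apply, Finset.mul_sum, kroneckerMap_apply, mul_assoc]
    refine Finset.sum_congr rfl fun z _ => ?_
    conv_rhs => rw [← hH]
    simp
  rw [this]
  refine sum_mem fun z hz => SepC_kron (psd22 ha hc ?_) (h2 z)
  rw [norm_mul, h1 z hz]
  simpa using hg

lemma onb_unitary (b : OrthonormalBasis κ ℂ (EuclideanSpace ℂ κ)) :
    (Matrix.of fun i j => b j i) ∈ unitary (Matrix κ κ ℂ) := by
  have h : star (Matrix.of fun i j => b j i) * (Matrix.of fun i j => b j i) =
      (1 : Matrix κ κ ℂ) := by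
    ext i j
    have := orthonormal_iff_ite.1 b.orthonormal i j
    rw [Matrix.one_apply, ← this, Matrix.mul_apply]
    simp [PiLp.inner_apply, star_eq_conjTranspose, mul_comm]
  exact Unitary.mem_iff.2 ⟨h, mul_eq_one_comm.1 h⟩

lemma svd_contr (B : Matrix κ κ ℂ) (hB : ∀ v w : EuclideanSpace ℂ κ,
    ‖star v.ofLp ⬝ᵥ (B *ᵥ w.ofLp)‖ ≤ ‖v‖ * ‖w‖) :
    ∃ (U W : Matrix κ κ ℂ) (σ : κ → ℝ), U ∈ unitary (Matrix κ κ ℂ) ∧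
      W ∈ unitary (Matrix κ κ ℂ) ∧ (∀ i, 0 ≤ σ i ∧ σ i ≤ 1) ∧
      B = U * diagonal (fun i => (σ i : ℂ)) * star W := by
  have hH : (Bᴴ * B).IsHermitian := isHermitian_conjTranspose_mul_self B
  set w := hH.eigenvectorBasis with hw
  let T : κ → EuclideanSpace ℂ κ := fun i => WithLp.toLp 2 (B *ᵥ (w i).ofLp)
  have hin : ∀ x y : EuclideanSpace ℂ κ, inner ℂ x y = star x.ofLp ⬝ᵥ y.ofLp := by
    intro x y
    rw [PiLp.inner_apply]
    simp [dotProduct, mul_comm]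
  have hT : ∀ i j, i ≠ j → inner ℂ (T i) (T j) = (0 : ℂ) := by
    intro i j hij
    have h1 := hH.mulVec_eigenvectorBasis j
    have h2 : inner ℂ (T i) (T j) = star (w i).ofLp ⬝ᵥ ((Bᴴ * B) *ᵥ (w j).ofLp) := by
      rw [hin]
      simp only [T]
      rw [star_mulVec, ← dotProduct_mulVec, mulVec_mulVec]
    rw [h2, h1]
    have h3 := orthonormal_iff_ite.1 w.orthonormal i j
    rw [if_neg hij, hin] at h3
    rw [dotProduct_smul, ← hw, h3, smul_zero]
  have hT1 : ∀ i, ‖T i‖ ≤ 1 := by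
    intro i
    have h1 := hB (T i) (w i)
    have h2 : star (T i).ofLp ⬝ᵥ (B *ᵥ (w i).ofLp) = inner ℂ (T i) (T i) := (hin (T i) (T i)).symm
    rw [h2, inner_self_eq_norm_sq_to_K, w.orthonormal.1 i, mul_one] at h1
    simp at h1
    by_contra h
    push Not at h
    nlinarith
  let v : κ → EuclideanSpace ℂ κ := fun i => ((‖T i‖ : ℂ))⁻¹ • T i
  let s : Set κ := {i | T i ≠ 0}
  have hv : Orthonormal ℂ (s.domRestrict v) := by
    constructor
    · rintro ⟨i, hi⟩
      have : ‖T i‖ ≠ 0 := norm_ne_zero_iff.2 hi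
      simp [v, norm_smul, this]
    · rintro ⟨i, hi⟩ ⟨j, hj⟩ hij
      have hij' : i ≠ j := fun h => hij (Subtype.ext h)
      simp [v, inner_smul_left, inner_smul_right, hT i j hij']
  obtain ⟨b, hb⟩ := hv.exists_orthonormalBasis_extension_of_card_eq (by simp)
  have hTb : ∀ i, T i = (‖T i‖ : ℂ) • b i := by
    intro i
    by_cases h : T i = 0
    · simp [h]
    · rw [hb i h]
      have : (‖T i‖ : ℂ) ≠ 0 := by exact_mod_cast norm_ne_zero_iff.2 h
      simp only [v, smul_smul]
      rw [mul_inv_cancel₀ this, one_smul]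
  refine ⟨Matrix.of fun i j => b j i, Matrix.of fun i j => w j i, fun i => ‖T i‖, onb_unitary b,
    onb_unitary w, fun i => ⟨norm_nonneg _, hT1 i⟩, ?_⟩
  have hBW : B * (Matrix.of fun i j => w j i) =
      (Matrix.of fun i j => b j i) * diagonal (fun i => ((‖T i‖ : ℝ) : ℂ)) := by
    ext i j
    rw [mul_diagonal]
    have := congrArg (fun x : EuclideanSpace ℂ κ => x i) (hTb j)
    simp only [PiLp.smul_apply, smul_eq_mul] at this
    rw [Matrix.of_apply, mul_comm, ← this]
    simp [T, Matrix.mul_apply, Matrix.mulVec, dotProduct]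
  rw [← hBW, mul_assoc, (Unitary.mem_iff.1 (onb_unitary w)).2, mul_one]

lemma contr_avg (B : Matrix κ κ ℂ) (hB : ∀ v w : EuclideanSpace ℂ κ,
    ‖star v.ofLp ⬝ᵥ (B *ᵥ w.ofLp)‖ ≤ ‖v‖ * ‖w‖) :
    ∃ (U V : Matrix κ κ ℂ), U ∈ unitary (Matrix κ κ ℂ) ∧
      V ∈ unitary (Matrix κ κ ℂ) ∧ B = (1/2 : ℂ) • (U + V) := by
  obtain ⟨U, W, σ, hU, hW, hσ, rfl⟩ := svd_contr B hB
  let z : κ → ℂ := fun i => ⟨σ i, √(1 - σ i ^ 2)⟩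
  have hz : ∀ i, star (z i) * z i = 1 := by
    intro i
    have h1 : 0 ≤ 1 - σ i ^ 2 := by nlinarith [hσ i]
    have h2 := Real.sq_sqrt h1
    apply Complex.ext
    · simp [z]; nlinarith
    · simp [z]; ring
  have hD : diagonal z ∈ unitary (Matrix κ κ ℂ) := by
    have h : star (diagonal z) * diagonal z = 1 := by
      rw [star_eq_conjTranspose, diagonal_conjTranspose, diagonal_mul_diagonal, ← diagonal_one]
      congr 1; ext i; exact hz i
    exact Unitary.mem_iff.2 ⟨h, mul_eq_one_comm.1 h⟩
  refine ⟨U * diagonal z * star W, U * star (diagonal z) * star W, ?_, ?_, ?_⟩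
  · exact mul_mem (mul_mem hU hD) (Unitary.star_mem hW)
  · exact mul_mem (mul_mem hU (Unitary.star_mem hD)) (Unitary.star_mem hW)
  · rw [← add_mul, ← mul_add, ← smul_mul_assoc, ← mul_smul_comm]
    congr 2
    rw [star_eq_conjTranspose, diagonal_conjTranspose, diagonal_add, ← diagonal_smul]
    congr 1; ext i
    apply Complex.ext <;> simp [z] <;> ring

lemma blk_contr (A B C : Matrix κ κ ℂ) {a c r : ℝ} (ha : 0 ≤ a) (hc : 0 ≤ c) (hr : 0 ≤ r)
    (hrac : r ^ 2 ≤ a * c) (hA : (A - (a : ℂ) • 1).PosSemidef) (hC : (C - (c : ℂ) • 1).PosSemidef)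
    (hB : ∀ v w : EuclideanSpace ℂ κ, ‖star v.ofLp ⬝ᵥ (B *ᵥ w.ofLp)‖ ≤ r * (‖v‖ * ‖w‖)) :
    blk A B C ∈ SepC κ := by
  have hmid : blk ((a : ℂ) • 1) B ((c : ℂ) • 1) ∈ SepC κ := by
    obtain ⟨U, V, hU, hV, hBe⟩ : ∃ (U V : Matrix κ κ ℂ), U ∈ unitary (Matrix κ κ ℂ) ∧
      V ∈ unitary (Matrix κ κ ℂ) ∧ B = (r : ℂ) • ((1/2 : ℂ) • (U + V)) := by
      rcases hr.eq_or_lt with h0 | h0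
      · refine ⟨1, 1, one_mem _, one_mem _, ?_⟩
        rw [← h0]
        simp only [Complex.ofReal_zero, zero_smul]
        ext i j
        have h1 := hB (EuclideanSpace.single i 1) (EuclideanSpace.single j 1)
        rw [← h0, zero_mul] at h1
        have h2 := norm_le_zero_iff.1 h1
        simpa [← Pi.single_star] using h2
      · have hr0 : (r : ℂ) ≠ 0 := by exact_mod_cast h0.ne'
        obtain ⟨U, V, hU, hV, h⟩ := contr_avg ((r : ℂ)⁻¹ • B) (by
          intro v w
          rw [smul_mulVec, dotProduct_smul, norm_smul, norm_inv, Complex.norm_real,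
            Real.norm_of_nonneg hr, inv_mul_le_iff₀ h0]
          exact hB v w)
        refine ⟨U, V, hU, hV, ?_⟩
        rw [← h, smul_smul, mul_inv_cancel₀ hr0, one_smul]
    have : blk ((a : ℂ) • 1) B ((c : ℂ) • 1) =
      ((1/2 : ℝ) : ℂ) • blk ((a : ℂ) • 1) ((r : ℂ) • U) ((c : ℂ) • 1) +
      ((1/2 : ℝ) : ℂ) • blk ((a : ℂ) • 1) ((r : ℂ) • V) ((c : ℂ) • 1) := by
      rw [hBe]
      ext ⟨i, j⟩ ⟨k, l⟩
      fin_cases i <;> fin_cases k <;> simp [blk] <;> ring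
    rw [this]
    exact add_mem (SepC_smul (by norm_num) (blk_unitary U hU ha hc hrac))
      (SepC_smul (by norm_num) (blk_unitary V hV ha hc hrac))
  have h1 : (!![1, 0; 0, 0] : Matrix (Fin 2) (Fin 2) ℂ).PosSemidef := by
    have := psd22 (a := 1) (c := 0) (z := 0) (by norm_num) le_rfl (by simp)
    simpa using this
  have h2 : (!![0, 0; 0, 1] : Matrix (Fin 2) (Fin 2) ℂ).PosSemidef := by
    have := psd22 (a := 0) (c := 1) (z := 0) le_rfl (by norm_num) (by simp)
    simpa using this
  have : blk A B C = blk ((a : ℂ) • 1) B ((c : ℂ) • 1) + !![1, 0; 0, 0] ⊗ₖ (A - (a : ℂ) • 1) +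
      !![0, 0; 0, 1] ⊗ₖ (C - (c : ℂ) • 1) := by
    ext ⟨i, j⟩ ⟨k, l⟩
    fin_cases i <;> fin_cases k <;> simp [blk, kroneckerMap_apply]
  rw [this]
  exact add_mem (add_mem hmid (SepC_kron h1 hA)) (SepC_kron h2 hC)

end contr



section mainl
variable {κ : Type*} [Fintype κ] [DecidableEq κ]

lemma eucl_inner (x y : EuclideanSpace ℂ κ) : inner ℂ x y = star x.ofLp ⬝ᵥ y.ofLp := by
  rw [PiLp.inner_apply]
  simp [dotProduct, mul_comm]

def mat (α γ : ℝ) (a b : EuclideanSpace ℂ κ) (c d : EuclideanSpace ℂ κ) : Matrix κ κ ℂ :=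
  (α : ℂ) • vecMulVec a.ofLp (star c.ofLp) - (γ : ℂ) • vecMulVec b.ofLp (star d.ofLp)

lemma mat_form (α γ : ℝ) (a b c d v w : EuclideanSpace ℂ κ) :
    star v.ofLp ⬝ᵥ (mat α γ a b c d *ᵥ w.ofLp) = sf α γ a c b d v w := by
  simp only [mat, sf, sub_mulVec, smul_mulVec, dotProduct_sub, dotProduct_smul, vecMulVec_mulVec,
    eucl_inner, smul_eq_mul, op_smul_eq_smul]
  ring

lemma mat_psd (α γ m : ℝ) (a b : EuclideanSpace ℂ κ)
    (h : ∀ x, m * ‖x‖ ^ 2 ≤ qf α γ a b x) :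
    (1 + mat α γ a b a b - (m : ℂ) • (1 : Matrix κ κ ℂ)).PosSemidef := by
  refine PosSemidef.of_dotProduct_mulVec_nonneg ?_ ?_
  · ext i j; simp [mat, Matrix.vecMulVec_apply, Matrix.one_apply, mul_comm, eq_comm]
    split_ifs <;> simp
  · intro x
    have h1 := h (WithLp.toLp 2 x)
    have h2 := mat_form α γ a b a b (WithLp.toLp 2 x) (WithLp.toLp 2 x)
    have h3 : star x ⬝ᵥ x = ((‖WithLp.toLp 2 x‖ ^ 2 : ℝ) : ℂ) := by
      have := inner_self_eq_norm_sq_to_K (𝕜 := ℂ) (WithLp.toLp 2 x)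
      rw [eucl_inner] at this
      simpa using this
    have h4 : ∀ u : EuclideanSpace ℂ κ, inner ℂ (WithLp.toLp 2 x) u * inner ℂ u (WithLp.toLp 2 x) =
      ((‖inner ℂ u (WithLp.toLp 2 x)‖ ^ 2 : ℝ) : ℂ) := by
      intro u
      rw [← inner_conj_symm, Complex.conj_mul']
      simp
    have : star x ⬝ᵥ ((1 + mat α γ a b a b - (m : ℂ) • (1 : Matrix κ κ ℂ)) *ᵥ x) =
        ((qf α γ a b (WithLp.toLp 2 x) - m * ‖WithLp.toLp 2 x‖ ^ 2 : ℝ) : ℂ) := by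
      simp only at h2
      rw [sub_mulVec, add_mulVec, dotProduct_sub, dotProduct_add, h2, smul_mulVec, dotProduct_smul,
        one_mulVec, h3, sf, h4, h4, qf, smul_eq_mul]
      push_cast
      ring
    rw [this]
    exact_mod_cast sub_nonneg.2 h1

lemma rot_norm (x y : EuclideanSpace ℂ κ) (θ : ℝ) :
    ‖(Real.cos θ : ℂ) • x + (Real.sin θ : ℂ) • y‖ ^ 2 +
      ‖(Real.cos θ : ℂ) • y - (Real.sin θ : ℂ) • x‖ ^ 2 = ‖x‖ ^ 2 + ‖y‖ ^ 2 := by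
  simp only [EuclideanSpace.norm_sq_eq, ← Finset.sum_add_distrib]
  refine Finset.sum_congr rfl fun i _ => ?_
  simp only [PiLp.add_apply, PiLp.sub_apply, PiLp.smul_apply, smul_eq_mul, Complex.sq_norm,
    Complex.normSq_apply, Complex.add_re, Complex.add_im, Complex.sub_re, Complex.sub_im,
    Complex.re_ofReal_mul, Complex.im_ofReal_mul]
  linear_combination ((x i).re ^ 2 + (x i).im ^ 2 + (y i).re ^ 2 + (y i).im ^ 2) *
    Real.sin_sq_add_cos_sq θ

lemma main_sep [Nonempty κ] (α γ : ℝ) (hα : 0 ≤ α) (hγ : 0 ≤ γ) (hαγ : α ^ 2 ≤ 4 * (1 - γ))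
    (a b : Fin 2 × κ → ℂ) (ha : star a ⬝ᵥ a = 1) (hb : star b ⬝ᵥ b = 1) :
    1 + (α : ℂ) • vecMulVec a (star a) - (γ : ℂ) • vecMulVec b (star b) ∈ SepC κ := by
  have nrm : ∀ a : Fin 2 × κ → ℂ, star a ⬝ᵥ a = 1 →
      ‖WithLp.toLp 2 (fun j => a (0, j))‖ ^ 2 + ‖WithLp.toLp 2 (fun j => a (1, j))‖ ^ 2 = 1 := by
    intro a ha
    have : ((‖WithLp.toLp 2 (fun j => a (0, j))‖ ^ 2 + ‖WithLp.toLp 2 (fun j => a (1, j))‖ ^ 2 : ℝ)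
      : ℂ) = 1 := by
      rw [← ha, dotProduct, Fintype.sum_prod_type, Fin.sum_univ_two, EuclideanSpace.norm_sq_eq,
        EuclideanSpace.norm_sq_eq]
      push_cast
      simp [← Complex.conj_mul']
    exact_mod_cast this
  set a1 : EuclideanSpace ℂ κ := WithLp.toLp 2 (fun j => a (0, j)) with ha1
  set a2 : EuclideanSpace ℂ κ := WithLp.toLp 2 (fun j => a (1, j)) with ha2
  set b1 : EuclideanSpace ℂ κ := WithLp.toLp 2 (fun j => b (0, j)) with hb1
  set b2 : EuclideanSpace ℂ κ := WithLp.toLp 2 (fun j => b (1, j)) with hb2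
  obtain ⟨θ, mA, mC, r, h1, h2, h3, h4, h5, h6, h7⟩ := topo_main α γ hα hγ hαγ
    (fun θ => (Real.cos θ : ℂ) • a1 + (Real.sin θ : ℂ) • a2)
    (fun θ => (Real.cos θ : ℂ) • a2 - (Real.sin θ : ℂ) • a1)
    (fun θ => (Real.cos θ : ℂ) • b1 + (Real.sin θ : ℂ) • b2)
    (fun θ => (Real.cos θ : ℂ) • b2 - (Real.sin θ : ℂ) • b1)
    (by fun_prop) (by fun_prop) (by fun_prop) (by fun_prop) (Real.pi / 2) (by positivity)
    (by simp) (by simp) (by simp) (by simp)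
    (fun s => by rw [rot_norm]; exact (nrm a ha).le) (fun s => by rw [rot_norm]; exact (nrm b hb).le)
  have hblk := blk_contr (1 + mat α γ ((Real.cos θ : ℂ) • a1 + (Real.sin θ : ℂ) • a2)
    ((Real.cos θ : ℂ) • b1 + (Real.sin θ : ℂ) • b2) ((Real.cos θ : ℂ) • a1 + (Real.sin θ : ℂ) • a2)
    ((Real.cos θ : ℂ) • b1 + (Real.sin θ : ℂ) • b2))
    (mat α γ ((Real.cos θ : ℂ) • a1 + (Real.sin θ : ℂ) • a2)
    ((Real.cos θ : ℂ) • b1 + (Real.sin θ : ℂ) • b2) ((Real.cos θ : ℂ) • a2 - (Real.sin θ : ℂ) • a1)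
    ((Real.cos θ : ℂ) • b2 - (Real.sin θ : ℂ) • b1))
    (1 + mat α γ ((Real.cos θ : ℂ) • a2 - (Real.sin θ : ℂ) • a1)
    ((Real.cos θ : ℂ) • b2 - (Real.sin θ : ℂ) • b1) ((Real.cos θ : ℂ) • a2 - (Real.sin θ : ℂ) • a1)
    ((Real.cos θ : ℂ) • b2 - (Real.sin θ : ℂ) • b1)) h1 h2 h3 h4 (mat_psd _ _ _ _ _ h5)
    (mat_psd _ _ _ _ _ h6) (fun v w => by rw [mat_form]; exact h7 v w)
  have hconj := SepC_conj !![(Real.cos θ : ℂ), -(Real.sin θ : ℂ); (Real.sin θ : ℂ), (Real.cos θ : ℂ)]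
    hblk
  let rot : (Fin 2 × κ → ℂ) → (Fin 2 × κ → ℂ) := fun a p => if p.1 = 0 then
    (Real.cos θ : ℂ) * a (0, p.2) + (Real.sin θ : ℂ) * a (1, p.2) else
    (Real.cos θ : ℂ) * a (1, p.2) - (Real.sin θ : ℂ) * a (0, p.2)
  set W : Matrix (Fin 2 × κ) (Fin 2 × κ) ℂ :=
    !![(Real.cos θ : ℂ), -(Real.sin θ : ℂ); (Real.sin θ : ℂ), (Real.cos θ : ℂ)] ⊗ₖ
    (1 : Matrix κ κ ℂ) with hW
  have hcs : (Real.cos θ : ℂ) * Real.cos θ + (Real.sin θ : ℂ) * Real.sin θ = 1 := by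
    have := Real.cos_sq_add_sin_sq θ
    rw [sq, sq] at this
    exact_mod_cast this
  have hrot : ∀ u, W *ᵥ (rot u) = u := by
    intro u
    ext ⟨i, j⟩
    fin_cases i
    · simp only [W, mulVec, dotProduct, Fintype.sum_prod_type, Fin.sum_univ_two,
        kroneckerMap_apply, Matrix.one_apply]
      simp [rot, -Complex.ofReal_cos, -Complex.ofReal_sin]
      linear_combination u (0, j) * hcs
    · simp only [W, mulVec, dotProduct, Fintype.sum_prod_type, Fin.sum_univ_two,
        kroneckerMap_apply, Matrix.one_apply]
      simp [rot, -Complex.ofReal_cos, -Complex.ofReal_sin]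
      linear_combination u (1, j) * hcs
  have hWW : W * Wᴴ = 1 := by
    rw [hW, conjTranspose_kronecker, ← mul_kronecker_mul, conjTranspose_one, one_mul,
      ← one_kronecker_one]
    congr 1
    ext i j
    fin_cases i <;> fin_cases j <;> simp [Matrix.mul_apply, Fin.sum_univ_two,
      -Complex.ofReal_cos, -Complex.ofReal_sin, Complex.conj_ofReal] <;>
      first | linear_combination hcs | ring
  have hvm : ∀ u, W * vecMulVec (rot u) (star (rot u)) * Wᴴ = vecMulVec u (star u) := by
    intro u
    rw [mul_vecMulVec, vecMulVec_mul, ← star_mulVec, hrot]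
  have hbe : blk (1 + mat α γ ((Real.cos θ : ℂ) • a1 + (Real.sin θ : ℂ) • a2)
    ((Real.cos θ : ℂ) • b1 + (Real.sin θ : ℂ) • b2) ((Real.cos θ : ℂ) • a1 + (Real.sin θ : ℂ) • a2)
    ((Real.cos θ : ℂ) • b1 + (Real.sin θ : ℂ) • b2))
    (mat α γ ((Real.cos θ : ℂ) • a1 + (Real.sin θ : ℂ) • a2)
    ((Real.cos θ : ℂ) • b1 + (Real.sin θ : ℂ) • b2) ((Real.cos θ : ℂ) • a2 - (Real.sin θ : ℂ) • a1)
    ((Real.cos θ : ℂ) • b2 - (Real.sin θ : ℂ) • b1))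
    (1 + mat α γ ((Real.cos θ : ℂ) • a2 - (Real.sin θ : ℂ) • a1)
    ((Real.cos θ : ℂ) • b2 - (Real.sin θ : ℂ) • b1) ((Real.cos θ : ℂ) • a2 - (Real.sin θ : ℂ) • a1)
    ((Real.cos θ : ℂ) • b2 - (Real.sin θ : ℂ) • b1)) =
    1 + (α : ℂ) • vecMulVec (rot a) (star (rot a)) -
      (γ : ℂ) • vecMulVec (rot b) (star (rot b)) := by
    ext ⟨i, j⟩ ⟨k, l⟩
    fin_cases i <;> fin_cases k <;> simp [blk, mat, rot, vecMulVec_apply, Matrix.one_apply, a1, a2,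
      b1, b2, -Complex.ofReal_cos, -Complex.ofReal_sin] <;> ring
  rw [hbe, mul_sub, mul_add, sub_mul, add_mul, mul_one, hWW, mul_smul_comm, mul_smul_comm,
    smul_mul_assoc, smul_mul_assoc, hvm, hvm] at hconj
  exact hconj

end mainl



section finalpart
variable {κ : Type*} [Fintype κ] [DecidableEq κ]

lemma pure_case [Nonempty κ] (α β : ℝ) (hαβ : 0 ≤ 1 + α + β)
    (h : ((0 ≤ α ∧ 0 ≤ β ∧ α + β ≤ 2) ∨
        (0 ≤ α ∧ α ^ 2 - 4 ≤ 4 * β ∧ 4 * β < 0) ∨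
        (0 ≤ β ∧ β ^ 2 - 4 ≤ 4 * α ∧ 4 * α < 0) ∨
        (α < 0 ∧ β < 0 ∧ -1 ≤ α + β)))
    (a b : Fin 2 × κ → ℂ) (ha : star a ⬝ᵥ a = 1) (hb : star b ⬝ᵥ b = 1) :
    1 + (α : ℂ) • vecMulVec a (star a) + (β : ℂ) • vecMulVec b (star b) ∈ SepC κ := by
  rcases h with ⟨h1, h2, h3⟩ | ⟨h1, h2, h3⟩ | ⟨h1, h2, h3⟩ | ⟨h1, h2, h3⟩
  · have e1 := main_sep 2 0 (by norm_num) le_rfl (by norm_num) a b ha hb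
    have e2 := main_sep 2 0 (by norm_num) le_rfl (by norm_num) b a hb ha
    have := add_mem (add_mem (SepC_smul (c := α / 2) (by linarith) e1)
      (SepC_smul (c := β / 2) (by linarith) e2))
      (SepC_smul (c := 1 - (α + β) / 2) (by linarith) (SepC_one (κ := κ)))
    convert this using 1
    push_cast
    module
  · have e1 := main_sep α (-β) h1 (by linarith) (by linarith) a b ha hb
    convert e1 using 1
    push_cast
    module
  · have e1 := main_sep β (-α) h1 (by linarith) (by linarith) b a hb ha
    convert e1 using 1
    push_cast
    module
  · have e1 := main_sep 0 1 le_rfl (by norm_num) (by norm_num) b a hb ha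
    have e2 := main_sep 0 1 le_rfl (by norm_num) (by norm_num) a b ha hb
    have := add_mem (add_mem (SepC_smul (c := -α) (by linarith) e1)
      (SepC_smul (c := -β) (by linarith) e2))
      (SepC_smul (c := 1 + α + β) hαβ (SepC_one (κ := κ)))
    convert this using 1
    push_cast
    module

lemma pure_hom (α β : ℝ)
    (h : ∀ a b : Fin 2 × κ → ℂ, star a ⬝ᵥ a = 1 → star b ⬝ᵥ b = 1 →
    1 + (α : ℂ) • vecMulVec a (star a) + (β : ℂ) • vecMulVec b (star b) ∈ SepC κ)
    (a b : Fin 2 × κ → ℂ) (hab : star a ⬝ᵥ a = star b ⬝ᵥ b) :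
    (star a ⬝ᵥ a) • 1 + (α : ℂ) • vecMulVec a (star a) + (β : ℂ) • vecMulVec b (star b)
      ∈ SepC κ := by
  have h0 : 0 ≤ star a ⬝ᵥ a := dotProduct_star_self_nonneg a
  by_cases ha : a = 0
  · have hb : b = 0 := by
      rw [ha] at hab
      simp only [dotProduct_zero] at hab
      exact dotProduct_star_self_eq_zero.1 hab.symm
    rw [ha, hb]
    simp [zero_mem]
  · obtain ⟨t, ht⟩ : ∃ t : ℝ, star a ⬝ᵥ a = t := by
      refine ⟨(star a ⬝ᵥ a).re, ?_⟩
      apply Complex.ext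
      · simp
      · simpa using (Complex.le_def.1 h0).2.symm
    have ht0 : 0 < t := by
      rw [ht] at h0
      have h0' : 0 ≤ t := by exact_mod_cast h0
      refine lt_of_le_of_ne h0' fun h' => ha ?_
      apply dotProduct_star_self_eq_zero.1
      rw [ht, ← h']; simp
    have hs : ((√t : ℝ) : ℂ) * ((√t : ℝ) : ℂ) = t := by
      exact_mod_cast Real.mul_self_sqrt ht0.le
    have hs0 : ((√t : ℝ) : ℂ) ≠ 0 := by exact_mod_cast (Real.sqrt_pos.2 ht0).ne'
    have ht1 : (t : ℂ) ≠ 0 := by exact_mod_cast ht0.ne'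
    have hst : star (((√t : ℝ) : ℂ)⁻¹) = (((√t : ℝ) : ℂ)⁻¹) := by
      rw [← Complex.ofReal_inv]; exact Complex.conj_ofReal _
    have hc : (((√t : ℝ) : ℂ)⁻¹) * (((√t : ℝ) : ℂ)⁻¹) = (t : ℂ)⁻¹ := by rw [← mul_inv, hs]
    have key : ∀ c : Fin 2 × κ → ℂ, star c ⬝ᵥ c = t →
        star ((((√t : ℝ) : ℂ)⁻¹) • c) ⬝ᵥ ((((√t : ℝ) : ℂ)⁻¹) • c) = 1 := by
      intro c hct
      rw [star_smul, hst, smul_dotProduct, dotProduct_smul, smul_smul, hc, hct, smul_eq_mul,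
        inv_mul_cancel₀ ht1]
    have key2 : ∀ c : Fin 2 × κ → ℂ,
        vecMulVec ((((√t : ℝ) : ℂ)⁻¹) • c) (star ((((√t : ℝ) : ℂ)⁻¹) • c)) =
        (t : ℂ)⁻¹ • vecMulVec c (star c) := by
      intro c
      rw [star_smul, hst, smul_vecMulVec, vecMulVec_smul, smul_smul, hc]
    have := SepC_smul ht0.le (h _ _ (key a ht) (key b (hab ▸ ht)))
    rw [key2, key2, smul_add, smul_add, smul_comm (t : ℂ) (α : ℂ), smul_comm (t : ℂ) (β : ℂ),
      smul_smul (t : ℂ) (t : ℂ)⁻¹, smul_smul (t : ℂ) (t : ℂ)⁻¹, mul_inv_cancel₀ ht1, one_smul,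
      one_smul, ← ht] at this
    exact this

lemma ctit_apply {ι : Type*} [Fintype ι] [DecidableEq ι] (α β : ℝ) (ρ : Matrix ι ι ℂ) :
    ctitMap α β ρ = ((((Fintype.card ι : ℝ) + α + β : ℝ) : ℂ))⁻¹ •
      (ρ.trace • (1 : Matrix ι ι ℂ) + (α : ℂ) • ρ + (β : ℂ) • ρᵀ) := by
  simp [ctitMap, transposeLM]

lemma conj_pure {ι : Type*} [Fintype ι] [DecidableEq ι] (α β : ℝ) (U : Matrix ι ι ℂ)
    (hU : U * Uᴴ = 1) (x : ι → ℂ) :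
    U * ((vecMulVec x (star x)).trace • (1 : Matrix ι ι ℂ) + (α : ℂ) • vecMulVec x (star x) +
      (β : ℂ) • (vecMulVec x (star x))ᵀ) * Uᴴ =
    (star (U *ᵥ x) ⬝ᵥ (U *ᵥ x)) • 1 + (α : ℂ) • vecMulVec (U *ᵥ x) (star (U *ᵥ x)) +
      (β : ℂ) • vecMulVec (U *ᵥ star x) (star (U *ᵥ star x)) := by
  have hU' : Uᴴ * U = 1 := mul_eq_one_comm.1 hU
  have h1 : star (U *ᵥ x) ⬝ᵥ (U *ᵥ x) = star x ⬝ᵥ x := by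
    rw [star_mulVec, ← dotProduct_mulVec, mulVec_mulVec, hU', one_mulVec]
  have h2 : (vecMulVec x (star x)).trace = star x ⬝ᵥ x := by
    rw [trace_vecMulVec, dotProduct_comm]
  have h3 : (vecMulVec x (star x))ᵀ = vecMulVec (star x) (star (star x)) := by
    rw [star_star]; ext i j; simp [vecMulVec_apply, mul_comm]
  rw [h1, h2, h3, mul_add, mul_add, add_mul, add_mul]
  simp only [mul_smul_comm, smul_mul_assoc, mul_one, hU, mul_vecMulVec, vecMulVec_mul,
    ← star_mulVec]

open scoped MatrixOrder Matrix.Norms.L2Operator in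
lemma psd_factor {ι : Type*} [Fintype ι] [DecidableEq ι] {ρ : Matrix ι ι ℂ} (h : ρ.PosSemidef) :
    ∃ X : Matrix ι ι ℂ, ρ = Xᴴ * X :=
  CStarAlgebra.nonneg_iff_eq_star_mul_self.mp h.nonneg

lemma suff [Nonempty κ] (α β : ℝ) (hD : 0 < (Fintype.card (Fin 2 × κ) : ℝ) + α + β)
    (h : ∀ a b : Fin 2 × κ → ℂ, star a ⬝ᵥ a = 1 → star b ⬝ᵥ b = 1 →
    1 + (α : ℂ) • vecMulVec a (star a) + (β : ℂ) • vecMulVec b (star b) ∈ SepC κ)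
    (ρ : Matrix (Fin 2 × κ) (Fin 2 × κ) ℂ) (hρ : IsDM ρ) : IsAbsSep (ctitMap α β ρ) := by
  intro U hU
  have hU' : Uᴴ * U = 1 := mul_eq_one_comm.1 hU
  apply SepC_isSep
  · obtain ⟨X, hX⟩ := psd_factor hρ.1
    have hsum : ρ = ∑ k, vecMulVec (star (X k)) (star (star (X k))) := by
      rw [hX]
      ext i j
      simp [Matrix.mul_apply, Matrix.sum_apply, vecMulVec_apply]
    rw [ctit_apply, mul_smul_comm, smul_mul_assoc, ← Complex.ofReal_inv]
    apply SepC_smul (inv_nonneg.2 hD.le)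
    have : U * (ρ.trace • 1 + (α : ℂ) • ρ + (β : ℂ) • ρᵀ) * Uᴴ =
      ∑ k, U * ((vecMulVec (star (X k)) (star (star (X k)))).trace • 1 +
        (α : ℂ) • (vecMulVec (star (X k)) (star (star (X k)))) +
        (β : ℂ) • (vecMulVec (star (X k)) (star (star (X k))))ᵀ) * Uᴴ := by
      rw [← Finset.sum_mul, ← Finset.mul_sum, Finset.sum_add_distrib, Finset.sum_add_distrib,
        ← Finset.sum_smul, ← Finset.smul_sum, ← Finset.smul_sum, ← trace_sum, ← transpose_sum,
        ← hsum]
    rw [this]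
    refine sum_mem fun k _ => ?_
    rw [conj_pure α β U hU]
    apply pure_hom α β h
    simp only [star_mulVec, ← dotProduct_mulVec, mulVec_mulVec, hU', one_mulVec]
    rw [dotProduct_comm, star_star]
  · rw [trace_mul_comm, ← mul_assoc, hU', one_mul, ctit_apply, trace_smul, trace_add, trace_add,
      trace_smul, trace_smul, trace_smul, trace_transpose, hρ.2, trace_one]
    have : (((Fintype.card (Fin 2 × κ) : ℝ) + α + β : ℝ) : ℂ) ≠ 0 := by exact_mod_cast hD.ne'
    rw [smul_eq_mul, inv_mul_eq_one₀ this]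
    push_cast
    simp

lemma sep_ineq {M : Matrix (Fin 2 × κ) (Fin 2 × κ) ℂ} (hM : IsSep M) (s t : ℝ) (j0 j1 : κ) :
    0 ≤ (s : ℂ) ^ 2 * M (0, j0) (0, j0) + (t : ℂ) ^ 2 * M (1, j1) (1, j1) +
      s * t * (M (0, j1) (1, j0) + M (1, j0) (0, j1)) := by
  obtain ⟨k, p, A, B, h1, -, h2, h3, rfl⟩ := hM
  have key : ∀ i, 0 ≤ (p i : ℂ) * ((s : ℂ) ^ 2 * (A i 0 0 * B i j0 j0) +
      (t : ℂ) ^ 2 * (A i 1 1 * B i j1 j1) +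
      s * t * ((A i 0 1 * B i j1 j0) + (A i 1 0 * B i j0 j1))) := by
    intro i
    have hN := ((h2 i).1.kronecker (h3 i).1.transpose).dotProduct_mulVec_nonneg
      (Pi.single (0, j0) (s : ℂ) + Pi.single (1, j1) (t : ℂ))
    refine mul_nonneg (by exact_mod_cast h1 i) ?_
    convert hN using 1
    simp [mulVec_add, add_dotProduct, ← Pi.single_star, kroneckerMap_apply]
    ring
  have := Finset.sum_nonneg (s := Finset.univ) fun i _ => key i
  convert this using 1
  simp only [Matrix.sum_apply, Matrix.smul_apply, kroneckerMap_apply, smul_eq_mul, Finset.mul_sum,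
    ← Finset.sum_add_distrib]
  refine Finset.sum_congr rfl fun i _ => ?_
  ring

lemma nec_ineq (α β : ℝ) (hD : 0 < (Fintype.card (Fin 2 × κ) : ℝ) + α + β)
    (h : ∀ ρ : Matrix (Fin 2 × κ) (Fin 2 × κ) ℂ, IsDM ρ → IsAbsSep (ctitMap α β ρ))
    (U : Matrix (Fin 2 × κ) (Fin 2 × κ) ℂ) (hU : U * Uᴴ = 1) (x a b : Fin 2 × κ → ℂ)
    (hx : star x ⬝ᵥ x = 1) (ha : U *ᵥ x = a) (hb : U *ᵥ star x = b) (s t : ℝ) (j0 j1 : κ) :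
    0 ≤ (s : ℂ) ^ 2 * (1 + α * (a (0, j0) * star (a (0, j0))) + β * (b (0, j0) * star (b (0, j0))))
      + (t : ℂ) ^ 2 * (1 + α * (a (1, j1) * star (a (1, j1))) + β * (b (1, j1) * star (b (1, j1))))
      + s * t * (α * (a (0, j1) * star (a (1, j0))) + β * (b (0, j1) * star (b (1, j0))) +
      (α * (a (1, j0) * star (a (0, j1))) + β * (b (1, j0) * star (b (0, j1))))) := by
  have hU' : Uᴴ * U = 1 := mul_eq_one_comm.1 hU
  have hDM : IsDM (vecMulVec x (star x)) := ⟨posSemidef_vecMulVec_self_star x, by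
    rw [trace_vecMulVec, dotProduct_comm, hx]⟩
  have h1 := h _ hDM U hU
  have hn : star a ⬝ᵥ a = 1 := by
    rw [← ha, star_mulVec, ← dotProduct_mulVec, mulVec_mulVec, hU', one_mulVec, hx]
  rw [ctit_apply, mul_smul_comm, smul_mul_assoc, conj_pure α β U hU, ha, hb, hn, one_smul] at h1
  have h2 := sep_ineq h1 s t j0 j1
  have h3 := mul_nonneg (show (0 : ℂ) ≤ (((Fintype.card (Fin 2 × κ) : ℝ) + α + β : ℝ) : ℂ) by
    exact_mod_cast hD.le) h2
  have hD0 : (((Fintype.card (Fin 2 × κ) : ℝ) + α + β : ℝ) : ℂ) ≠ 0 := by exact_mod_cast hD.ne'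
  generalize (((Fintype.card (Fin 2 × κ) : ℝ) + α + β : ℝ) : ℂ) = D at h3 hD0
  convert h3 using 1
  simp only [Matrix.smul_apply, Matrix.add_apply, vecMulVec_apply, Pi.star_apply, smul_eq_mul,
    Matrix.one_apply, Prod.mk.injEq]
  simp
  field_simp

lemma exists_unitary_cols {ι : Type*} [Fintype ι] [DecidableEq ι] (p q : ι) (hpq : p ≠ q)
    (u v : EuclideanSpace ℂ ι) (hu : ‖u‖ = 1) (hv : ‖v‖ = 1) (huv : inner ℂ u v = (0 : ℂ)) :
    ∃ U : Matrix ι ι ℂ, U * Uᴴ = 1 ∧ U *ᵥ (Pi.single p 1) = u.ofLp ∧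
      U *ᵥ (Pi.single q 1) = v.ofLp := by
  let f : ι → EuclideanSpace ℂ ι := fun i => if i = p then u else v
  have hf : Orthonormal ℂ (({p, q} : Set ι).domRestrict f) := by
    constructor
    · rintro ⟨i, rfl | rfl⟩
      · simp [f, hu]
      · simp [f, hpq.symm, hv]
    · have hvu : inner ℂ v u = (0 : ℂ) := by rw [← inner_conj_symm, huv]; simp
      rintro ⟨i, rfl | rfl⟩ ⟨j, rfl | rfl⟩ hij
      · exact absurd rfl hij
      · simp [f, hpq.symm, huv]
      · simp [f, hpq.symm, hvu]
      · exact absurd rfl hij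
  obtain ⟨b, hb⟩ := hf.exists_orthonormalBasis_extension_of_card_eq (by simp)
  refine ⟨Matrix.of fun i j => b j i, (Unitary.mem_iff.1 (onb_unitary b)).2, ?_, ?_⟩
  · ext i
    have := hb p (by simp)
    simp [this, f]
  · ext i
    have := hb q (by simp)
    simp [this, f, hpq.symm]

lemma exists_unitary_pair {ι : Type*} [Fintype ι] [DecidableEq ι] (p q : ι) (hpq : p ≠ q)
    (u v : EuclideanSpace ℂ ι) (hu : ‖u‖ = 1) (hv : ‖v‖ = 1) (huv : inner ℂ u v = (0 : ℂ)) :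
    ∃ (U : Matrix ι ι ℂ) (x : ι → ℂ), U * Uᴴ = 1 ∧ star x ⬝ᵥ x = 1 ∧ U *ᵥ x = u.ofLp ∧
      U *ᵥ (star x) = v.ofLp := by
  set r : ℂ := ((√2 : ℝ) : ℂ)⁻¹ with hr
  have hrr : r * r = 1 / 2 := by
    rw [hr, ← mul_inv]
    have : ((√2 : ℝ) : ℂ) * ((√2 : ℝ) : ℂ) = 2 := by
      exact_mod_cast Real.mul_self_sqrt (by norm_num : (0:ℝ) ≤ 2)
    rw [this]; norm_num
  have hrs : (starRingEnd ℂ) r = r := by rw [hr, ← Complex.ofReal_inv]; exact Complex.conj_ofReal _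
  have hvu : inner ℂ v u = (0 : ℂ) := by rw [← inner_conj_symm, huv]; simp
  have huu : inner ℂ u u = (1 : ℂ) := by rw [inner_self_eq_norm_sq_to_K, hu]; simp
  have hvv : inner ℂ v v = (1 : ℂ) := by rw [inner_self_eq_norm_sq_to_K, hv]; simp
  have nrm : ∀ w : EuclideanSpace ℂ ι, inner ℂ w w = (1 : ℂ) → ‖w‖ = 1 := by
    intro w hw
    rw [inner_self_eq_norm_sq_to_K] at hw
    have h2 : ‖w‖ ^ 2 = 1 := Complex.ofReal_injective (by simpa using hw)
    nlinarith [norm_nonneg w]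
  obtain ⟨U, hU, h1, h2⟩ := exists_unitary_cols p q hpq (r • (u + v)) ((r * -Complex.I) • (u - v))
    (nrm _ (by
      simp only [inner_smul_left, inner_smul_right, inner_add_left, inner_add_right, huu, hvv, huv,
        hvu, hrs]
      linear_combination 2 * hrr))
    (nrm _ (by
      simp only [inner_smul_left, inner_smul_right, inner_sub_left, inner_sub_right, huu, hvv, huv,
        hvu, hrs, map_mul, map_neg, Complex.conj_I]
      linear_combination 2 * hrr - 2 * r ^ 2 * Complex.I_mul_I))
    (by
      simp only [inner_smul_left, inner_smul_right, inner_sub_right, inner_add_left, huu, hvv, huv,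
        hvu]
      ring)
  have hx : star (r • (Pi.single p 1 + Complex.I • Pi.single q 1) : ι → ℂ) =
      r • (Pi.single p 1 - Complex.I • Pi.single q 1) := by
    rw [star_smul, star_add, star_smul, ← Pi.single_star, ← Pi.single_star]
    simp [hrs, sub_eq_add_neg]
  refine ⟨U, r • (Pi.single p 1 + Complex.I • Pi.single q 1), hU, ?_, ?_, ?_⟩
  · rw [hx]
    simp [add_dotProduct, sub_dotProduct, hpq, hpq.symm]
    linear_combination 2 * hrr -  r ^ 2 * Complex.I_mul_I
  · rw [mulVec_smul, mulVec_add, mulVec_smul, h1, h2]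
    ext i
    simp
    linear_combination 2 * u i * hrr - r * r * (u i - v i) * Complex.I_mul_I
  · rw [hx, mulVec_smul, mulVec_sub, mulVec_smul, h1, h2]
    ext i
    simp
    linear_combination 2 * v i * hrr + r * r * (u i - v i) * Complex.I_mul_I

end finalpart



section necpart
variable {κ : Type*} [Fintype κ] [DecidableEq κ]

lemma nec_all (α β : ℝ) (hD : 0 < (Fintype.card (Fin 2 × κ) : ℝ) + α + β)
    (h : ∀ ρ : Matrix (Fin 2 × κ) (Fin 2 × κ) ℂ, IsDM ρ → IsAbsSep (ctitMap α β ρ))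
    (j0 j1 : κ) (hj : j0 ≠ j1) :
    α + β ≤ 2 ∧ α ^ 2 ≤ 4 * (1 + β) ∧ β ^ 2 ≤ 4 * (1 + α) := by
  set r : ℂ := ((√2 : ℝ) : ℂ)⁻¹ with hr
  have hrr : r * r = 1 / 2 := by
    rw [hr, ← mul_inv]
    have : ((√2 : ℝ) : ℂ) * ((√2 : ℝ) : ℂ) = 2 := by
      exact_mod_cast Real.mul_self_sqrt (by norm_num : (0:ℝ) ≤ 2)
    rw [this]; norm_num
  have hrs : (starRingEnd ℂ) r = r := by rw [hr, ← Complex.ofReal_inv]; exact Complex.conj_ofReal _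
  let f1 : EuclideanSpace ℂ (Fin 2 × κ) :=
    r • (EuclideanSpace.single (0, j1) 1 - EuclideanSpace.single (1, j0) 1)
  let f2 : EuclideanSpace ℂ (Fin 2 × κ) := EuclideanSpace.single (0, j0) 1
  have hf1 : ‖f1‖ = 1 := by
    have : inner ℂ f1 f1 = (1 : ℂ) := by
      simp only [f1, inner_smul_left, inner_smul_right, inner_sub_left, inner_sub_right, hrs,
        EuclideanSpace.inner_single_left]
      simp
      linear_combination 2 * hrr
    rw [inner_self_eq_norm_sq_to_K] at this
    have h2 : ‖f1‖ ^ 2 = 1 := Complex.ofReal_injective (by simpa using this)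
    nlinarith [norm_nonneg f1]
  have hf2 : ‖f2‖ = 1 := by simp [f2]
  have hf12 : inner ℂ f1 f2 = (0 : ℂ) := by
    simp [f1, f2, inner_smul_left, inner_sub_left, EuclideanSpace.inner_single_left, hj, hj.symm]
  have hf21 : inner ℂ f2 f1 = (0 : ℂ) := by rw [← inner_conj_symm, hf12]; simp
  have hpq : ((0, j0) : Fin 2 × κ) ≠ (0, j1) := by simp [hj]
  have v1 : f1 (0, j0) = 0 := by simp [f1, hj]
  have v2 : f1 (1, j1) = 0 := by simp [f1, hj.symm]
  have v3 : f1 (0, j1) = r := by simp [f1]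
  have v4 : f1 (1, j0) = -r := by simp [f1]
  have w1 : f2 (0, j0) = 1 := by simp [f2]
  have w2 : f2 (1, j1) = 0 := by simp [f2]
  have w3 : f2 (0, j1) = 0 := by simp [f2, hj.symm]
  have w4 : f2 (1, j0) = 0 := by simp [f2]
  refine ⟨?_, ?_, ?_⟩
  · obtain ⟨U, hU, h1, -⟩ := exists_unitary_cols _ _ hpq f1 f2 hf1 hf2 hf12
    have := nec_ineq α β hD h U hU (Pi.single (0, j0) 1) f1.ofLp f1.ofLp (by simp)
      h1 (by rw [← Pi.single_star]; simpa using h1) 1 1 j0 j1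
    rw [v1, v2, v3, v4] at this
    have e : (0 : ℂ) ≤ ((2 - (α + β) : ℝ) : ℂ) := by
      convert this using 1
      simp [hrs]
      linear_combination (2 * α + 2 * β) * hrr
    have e' : 0 ≤ 2 - (α + β) := by exact_mod_cast e
    linarith
  · obtain ⟨U, x, hU, hx, h1, h2⟩ := exists_unitary_pair _ _ hpq f1 f2 hf1 hf2 hf12
    have := nec_ineq α β hD h U hU x _ _ hx h1 h2 2 α j0 j1
    rw [v1, v2, v3, v4, w1, w2, w3, w4] at this
    have e : (0 : ℂ) ≤ ((4 * (1 + β) - α ^ 2 : ℝ) : ℂ) := by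
      convert this using 1
      simp [hrs]
      linear_combination (4 * α ^ 2) * hrr
    have e' : 0 ≤ 4 * (1 + β) - α ^ 2 := by exact_mod_cast e
    linarith
  · obtain ⟨U, x, hU, hx, h1, h2⟩ := exists_unitary_pair _ _ hpq f2 f1 hf2 hf1 hf21
    have := nec_ineq α β hD h U hU x _ _ hx h1 h2 2 β j0 j1
    rw [v1, v2, v3, v4, w1, w2, w3, w4] at this
    have e : (0 : ℂ) ≤ ((4 * (1 + α) - β ^ 2 : ℝ) : ℂ) := by
      convert this using 1
      simp [hrs]
      linear_combination (4 * β ^ 2) * hrr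
    have e' : 0 ≤ 4 * (1 + α) - β ^ 2 := by exact_mod_cast e
    linarith

end necpart

theorem stmt17 (n : ℕ) (hn : 2 ≤ n) (α β : ℝ)
    (hα : 0 ≤ 1 + α) (hβ : 0 ≤ 1 + β) (hαβ : 0 ≤ 1 + α + β) :
    (∀ ρ : Matrix (Fin 2 × Fin n) (Fin 2 × Fin n) ℂ, IsDM ρ →
        IsAbsSep (ctitMap α β ρ)) ↔
      ((0 ≤ α ∧ 0 ≤ β ∧ α + β ≤ 2) ∨
        (0 ≤ α ∧ α ^ 2 - 4 ≤ 4 * β ∧ 4 * β < 0) ∨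
        (0 ≤ β ∧ β ^ 2 - 4 ≤ 4 * α ∧ 4 * α < 0) ∨
        (α < 0 ∧ β < 0 ∧ -1 ≤ α + β)) := by
  have hD : 0 < (Fintype.card (Fin 2 × Fin n) : ℝ) + α + β := by
    have : (2 : ℝ) ≤ n := by exact_mod_cast hn
    simp only [Fintype.card_prod, Fintype.card_fin]
    push_cast
    linarith
  have : Nonempty (Fin n) := ⟨⟨0, by omega⟩⟩
  constructor
  · intro h
    obtain ⟨h1, h2, h3⟩ := nec_all α β hD h ⟨0, by omega⟩ ⟨1, by omega⟩ (by simp)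
    rcases le_or_gt 0 α with ha | ha <;> rcases le_or_gt 0 β with hb | hb
    · exact Or.inl ⟨ha, hb, h1⟩
    · exact Or.inr (Or.inl ⟨ha, by linarith, by linarith⟩)
    · exact Or.inr (Or.inr (Or.inl ⟨hb, by linarith, by linarith⟩))
    · exact Or.inr (Or.inr (Or.inr ⟨ha, hb, by linarith⟩))
  · intro h
    exact suff α β hD (pure_case α β hαβ h)

end
end
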